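/- (Geller-type Lemma.) Let F be a Schwartz SO(3)-invariant function on ℝ³×ℝ³. Then there exist a Schwartz function f₀ ∈ 𝒮(ℝ) and Schwartz SO(3)-invariant functions F₀, F₁, F₂ on ℝ³×ℝ³ such that F = F₀ + ΔF₁ + DF₂, and moreover: f₀(R²) = ∫ F·φ_{0,R} for all R≥0; ∫ F₀·conj(φ_{λ,l,r}) = f₀(λ(2l+1)+r²) for all λ>0, l∈ℕ, r∈ℝ; and ∫ F₀·φ_{0,R} = f₀(R²) for all R≥0. -/

import Mathlib

open MeasureTheory Complex Matrix

noncomputable section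

abbrev V3 := Fin 3 → ℝ
abbrev Mat3 := Matrix (Fin 3) (Fin 3) ℝ

instance : MeasurableSpace Mat3 := (inferInstance : MeasurableSpace (Fin 3 → Fin 3 → ℝ))

/-- The set of special orthogonal 3×3 real matrices. -/
def SO3 : Set Mat3 := {A | A * A.transpose = 1 ∧ A.det = 1}

/-- `SO(3)`-invariance of a function on `ℝ³ × ℝ³` (simultaneous action on both factors). -/
def Inv3 (F : V3 × V3 → ℂ) : Prop :=
  ∀ k ∈ SO3, ∀ x y : V3, F (k.mulVec x, k.mulVec y) = F (x, y)

/-- `μ` is the Haar probability measure of `SO(3)`, viewed as a measure on the space of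
matrices: a left-invariant Borel probability measure concentrated on `SO3`.  (On the
compact metrizable group `SO(3)` such a measure is unique.) -/
def IsHaarSO3 (μ : Measure Mat3) : Prop :=
  IsProbabilityMeasure μ ∧ μ SO3ᶜ = 0 ∧ ∀ k ∈ SO3, μ.map (fun A => k * A) = μ

/-- The Laguerre function of order 0: `𝓛_l(u) = (1/l!) e^{u/2} (d/du)^l (u^l e^{-u})`. -/
def lag (l : ℕ) (u : ℝ) : ℝ :=
  (l.factorial : ℝ)⁻¹ * Real.exp (u / 2) * deriv^[l] (fun v : ℝ => v ^ l * Real.exp (-v)) u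

/-- The regular bounded spherical functions `φ_{λ,l,r}` of `(SO(3) ⋉ N_{3,2}, SO(3))`:
`φ_{λ,l,r}(x,y) = ∫_{SO(3)} e^{-iλ(ky)₃} 𝓛_l((λ/2)((kx)₁² + (kx)₂²)) e^{-ir(kx)₃} dk`. -/
def sph (μ : Measure Mat3) (lam : ℝ) (l : ℕ) (r : ℝ) (x y : V3) : ℂ :=
  ∫ k, Complex.exp (-(Complex.I * lam * ((k.mulVec y) 2))) *
      (lag l (lam / 2 * (((k.mulVec x) 0) ^ 2 + ((k.mulVec x) 1) ^ 2)) : ℝ) *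
      Complex.exp (-(Complex.I * r * ((k.mulVec x) 2))) ∂μ

/-- The Euclidean norm on `ℝ³`. -/
def nrm3 (x : V3) : ℝ := Real.sqrt (x 0 ^ 2 + x 1 ^ 2 + x 2 ^ 2)

/-- The singular bounded spherical functions `φ_{0,R}(x,y) = sin(R|x|)/(R|x|)`,
interpreted as `1` when `R|x| = 0`. -/
def sph0 (R : ℝ) (x : V3) : ℝ :=
  if R * nrm3 x = 0 then 1 else Real.sin (R * nrm3 x) / (R * nrm3 x)

/-- Partial derivative in the variable `x_j` of a function on `ℝ³ × ℝ³`. -/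
def pdx (j : Fin 3) (G : V3 × V3 → ℂ) : V3 × V3 → ℂ :=
  fun p => fderiv ℝ G p (Pi.single j 1, 0)

/-- Partial derivative in the variable `y_j` of a function on `ℝ³ × ℝ³`. -/
def pdy (j : Fin 3) (G : V3 × V3 → ℂ) : V3 × V3 → ℂ :=
  fun p => fderiv ℝ G p (0, Pi.single j 1)

/-- The left-invariant vector field `X₁ = ∂_{x₁} + ½(x₃ ∂_{y₂} − x₂ ∂_{y₃})` on `N_{3,2}`. -/
def X1 (G : V3 × V3 → ℂ) : V3 × V3 → ℂ :=
  fun p => pdx 0 G p + (1 / 2 : ℂ) * ((p.1 2 : ℂ) * pdy 1 G p - (p.1 1 : ℂ) * pdy 2 G p)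

/-- The left-invariant vector field `X₂ = ∂_{x₂} + ½(x₁ ∂_{y₃} − x₃ ∂_{y₁})` on `N_{3,2}`. -/
def X2 (G : V3 × V3 → ℂ) : V3 × V3 → ℂ :=
  fun p => pdx 1 G p + (1 / 2 : ℂ) * ((p.1 0 : ℂ) * pdy 2 G p - (p.1 2 : ℂ) * pdy 0 G p)

/-- The left-invariant vector field `X₃ = ∂_{x₃} + ½(x₂ ∂_{y₁} − x₁ ∂_{y₂})` on `N_{3,2}`. -/
def X3 (G : V3 × V3 → ℂ) : V3 × V3 → ℂ :=
  fun p => pdx 2 G p + (1 / 2 : ℂ) * ((p.1 1 : ℂ) * pdy 0 G p - (p.1 0 : ℂ) * pdy 1 G p)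

/-- The central Laplacian `Δ = −(∂_{y₁}² + ∂_{y₂}² + ∂_{y₃}²)`. -/
def DeltaOp (G : V3 × V3 → ℂ) : V3 × V3 → ℂ :=
  fun p => -(pdy 0 (pdy 0 G) p + pdy 1 (pdy 1 G) p + pdy 2 (pdy 2 G) p)

/-- The operator `D = −(X₁ ∂_{y₁} + X₂ ∂_{y₂} + X₃ ∂_{y₃})`. -/
def DOp (G : V3 × V3 → ℂ) : V3 × V3 → ℂ :=
  fun p => -(X1 (pdy 0 G) p + X2 (pdy 1 G) p + X3 (pdy 2 G) p)

set_option linter.unusedSectionVars false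
set_option linter.unusedVariables false

section toolkit

/-- polynomially bounded -/
def PB {E F : Type} [NormedAddCommGroup E] [NormedAddCommGroup F] (f : E → F) : Prop :=
  ∃ (k : ℕ) (C : ℝ), 0 ≤ C ∧ ∀ x, ‖f x‖ ≤ C * (1 + ‖x‖) ^ k

/-- rapidly decreasing -/
def RD {E F : Type} [NormedAddCommGroup E] [NormedAddCommGroup F] (f : E → F) : Prop :=
  ∀ k : ℕ, ∃ C : ℝ, 0 ≤ C ∧ ∀ x, (1 + ‖x‖) ^ k * ‖f x‖ ≤ C

def TG {E : Type} [NormedAddCommGroup E] [NormedSpace ℝ E] :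
    ℕ → ∀ {F : Type} [NormedAddCommGroup F] [NormedSpace ℝ F], (E → F) → Prop
  | 0, _, _, _, f => Continuous f ∧ PB f
  | n + 1, _, _, _, f => Differentiable ℝ f ∧ PB f ∧ TG n (fderiv ℝ f)

variable {E F G H : Type} [NormedAddCommGroup E] [NormedSpace ℝ E]
  [NormedAddCommGroup F] [NormedSpace ℝ F] [NormedAddCommGroup G] [NormedSpace ℝ G]
  [NormedAddCommGroup H] [NormedSpace ℝ H]

lemma one_le_jb (x : E) : (1:ℝ) ≤ 1 + ‖x‖ := by linarith [norm_nonneg x]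

lemma jb_pow_le (x : E) {a b : ℕ} (h : a ≤ b) : (1 + ‖x‖) ^ a ≤ (1 + ‖x‖) ^ b :=
  pow_le_pow_right₀ (one_le_jb x) h

lemma PB.add {f g : E → F} (hf : PB f) (hg : PB g) : PB (fun x => f x + g x) := by
  obtain ⟨k, C, hC, h1⟩ := hf
  obtain ⟨l, D, hD, h2⟩ := hg
  refine ⟨k + l, C + D, by positivity, fun x => (norm_add_le _ _).trans ?_⟩
  have := jb_pow_le x (Nat.le_add_right k l)
  have := jb_pow_le x (Nat.le_add_left l k)
  nlinarith [h1 x, h2 x]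

lemma PB.bilin (B : F →L[ℝ] G →L[ℝ] H) {f : E → F} {g : E → G} (hf : PB f) (hg : PB g) :
    PB (fun x => B (f x) (g x)) := by
  obtain ⟨k, C, hC, h1⟩ := hf
  obtain ⟨l, D, hD, h2⟩ := hg
  refine ⟨k + l, ‖B‖ * C * D, by positivity, fun x => (B.le_opNorm₂ _ _).trans ?_⟩
  calc ‖B‖ * ‖f x‖ * ‖g x‖ ≤ ‖B‖ * (C * (1 + ‖x‖) ^ k) * (D * (1 + ‖x‖) ^ l) := by
        gcongr
        · exact h1 x
        · exact h2 x
    _ = _ := by ring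

lemma PB.clm (B : F →L[ℝ] G) {f : E → F} (hf : PB f) :
    PB (fun x => B (f x)) := by
  obtain ⟨k, C, hC, h1⟩ := hf
  refine ⟨k, ‖B‖ * C, by positivity, fun x => (B.le_opNorm _).trans ?_⟩
  rw [mul_assoc]; gcongr; exact h1 x

lemma PB.mono {f : E → F} {g : E → G} (hf : PB f) (h : ∀ x, ‖g x‖ ≤ ‖f x‖) : PB g := by
  obtain ⟨k, C, hC, h1⟩ := hf
  exact ⟨k, C, hC, fun x => (h x).trans (h1 x)⟩

lemma PB.comp {f : E → F} {g : F → G} (hg : PB g) (hf : PB f) : PB (fun x => g (f x)) := by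
  obtain ⟨k, C, hC, h1⟩ := hf
  obtain ⟨l, D, hD, h2⟩ := hg
  refine ⟨k * l, D * (1 + C) ^ l, by positivity, fun x => (h2 _).trans ?_⟩
  rw [mul_assoc, pow_mul, ← mul_pow]
  gcongr
  have := one_le_pow₀ (n := k) (one_le_jb x)
  nlinarith [h1 x]

lemma TG.pb {n : ℕ} {f : E → F} (h : TG n f) : PB f := by
  cases n with
  | zero => exact h.2
  | succ n => exact h.2.1

lemma TG.continuous {n : ℕ} {f : E → F} (h : TG n f) : Continuous f := by
  cases n with
  | zero => exact h.1
  | succ n => exact h.1.continuous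

lemma TG.down {n : ℕ} : ∀ {F : Type} [NormedAddCommGroup F] [NormedSpace ℝ F] {f : E → F},
    TG (n + 1) f → TG n f := by
  induction n with
  | zero => intro F _ _ f h; exact ⟨h.continuous, h.pb⟩
  | succ n ih => intro F _ _ f h; exact ⟨h.1, h.2.1, ih h.2.2⟩

lemma TG.add {n : ℕ} : ∀ {F : Type} [NormedAddCommGroup F] [NormedSpace ℝ F] {f g : E → F},
    TG n f → TG n g → TG n (fun x => f x + g x) := by
  induction n with
  | zero => intro F _ _ f g h1 h2; exact ⟨h1.1.add h2.1, h1.2.add h2.2⟩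
  | succ n ih =>
    intro F _ _ f g h1 h2
    refine ⟨h1.1.add h2.1, h1.pb.add h2.pb, ?_⟩
    have : fderiv ℝ (fun x => f x + g x) = fun x => fderiv ℝ f x + fderiv ℝ g x := by
      ext1 x; exact fderiv_fun_add (h1.1 x) (h2.1 x)
    rw [this]; exact ih h1.2.2 h2.2.2

lemma TG.clm {n : ℕ} : ∀ {F G : Type} [NormedAddCommGroup F] [NormedSpace ℝ F]
    [NormedAddCommGroup G] [NormedSpace ℝ G] (B : F →L[ℝ] G) {f : E → F},
    TG n f → TG n (fun x => B (f x)) := by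
  induction n with
  | zero => intro F G _ _ _ _ B f h; exact ⟨B.continuous.comp h.1, h.2.clm B⟩
  | succ n ih =>
    intro F G _ _ _ _ B f h
    refine ⟨B.differentiable.comp h.1, h.pb.clm B, ?_⟩
    have : fderiv ℝ (fun x => B (f x)) =
        fun x => (ContinuousLinearMap.compL ℝ E F G B) (fderiv ℝ f x) := by
      ext1 x
      exact (B.hasFDerivAt.comp x (h.1 x).hasFDerivAt).fderiv
    rw [this]; exact ih _ h.2.2

lemma TG.bilin {n : ℕ} : ∀ {F G H : Type} [NormedAddCommGroup F] [NormedSpace ℝ F]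
    [NormedAddCommGroup G] [NormedSpace ℝ G] [NormedAddCommGroup H] [NormedSpace ℝ H]
    (B : F →L[ℝ] G →L[ℝ] H) {f : E → F} {g : E → G},
    TG n f → TG n g → TG n (fun x => B (f x) (g x)) := by
  induction n with
  | zero =>
    intro F G H _ _ _ _ _ _ B f g h1 h2
    exact ⟨B.continuous₂.comp (h1.1.prodMk h2.1), h1.2.bilin B h2.2⟩
  | succ n ih =>
    intro F G H _ _ _ _ _ _ B f g h1 h2
    have hd : ∀ x, HasFDerivAt (fun x => B (f x) (g x))
        (B.precompR E (f x) (fderiv ℝ g x) + B.precompL E (fderiv ℝ f x) (g x)) x :=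
      fun x => B.hasFDerivAt_of_bilinear (h1.1 x).hasFDerivAt (h2.1 x).hasFDerivAt
    refine ⟨fun x => (hd x).differentiableAt, h1.pb.bilin B h2.pb, ?_⟩
    have : fderiv ℝ (fun x => B (f x) (g x)) = fun x =>
        B.precompR E (f x) (fderiv ℝ g x) + B.precompL E (fderiv ℝ f x) (g x) := by
      ext1 x; exact (hd x).fderiv
    rw [this]
    exact (ih _ h1.down h2.2.2).add (ih _ h1.2.2 h2.down)

lemma TG.prodMk {n : ℕ} {f : E → F} {g : E → G} (hf : TG n f) (hg : TG n g) :
    TG n (fun x => (f x, g x)) := by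
  have := (hf.clm (ContinuousLinearMap.inl ℝ F G)).add (hg.clm (ContinuousLinearMap.inr ℝ F G))
  simpa using this

lemma TG.comp {n : ℕ} {f : E → F} : ∀ {G : Type} [NormedAddCommGroup G] [NormedSpace ℝ G]
    {g : F → G}, (∀ m, TG m g) → TG n f → TG n (fun x => g (f x)) := by
  induction n with
  | zero => intro G _ _ g hg hf; exact ⟨(hg 0).1.comp hf.1, (hg 0).2.comp hf.2⟩
  | succ n ih =>
    intro G _ _ g hg hf
    have hd : ∀ x, HasFDerivAt (fun x => g (f x))
        (ContinuousLinearMap.compL ℝ E F G (fderiv ℝ g (f x)) (fderiv ℝ f x)) x :=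
      fun x => ((hg 1).1 (f x)).hasFDerivAt.comp x (hf.1 x).hasFDerivAt
    refine ⟨fun x => (hd x).differentiableAt, (hg 0).pb.comp hf.pb, ?_⟩
    have : fderiv ℝ (fun x => g (f x)) = fun x =>
        ContinuousLinearMap.compL ℝ E F G (fderiv ℝ g (f x)) (fderiv ℝ f x) := by
      ext1 x; exact (hd x).fderiv
    rw [this]
    exact (ih (fun m => (hg (m+1)).2.2) hf.down).bilin _ hf.2.2

lemma htg_pb {f : E → F} (hf : f.HasTemperateGrowth) : PB f := by
  obtain ⟨k, C, h⟩ := hf.2 0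
  refine ⟨k, |C|, abs_nonneg _, fun x => ?_⟩
  have := h x
  rw [norm_iteratedFDeriv_zero] at this
  refine this.trans ?_
  gcongr
  exact le_abs_self C

lemma htg_fderiv {f : E → F} (hf : f.HasTemperateGrowth) :
    (fderiv ℝ f).HasTemperateGrowth := by
  refine ⟨hf.1.fderiv_right (m := ((⊤ : ℕ∞) : WithTop ℕ∞)) (by norm_cast), fun n => ?_⟩
  obtain ⟨k, C, h⟩ := hf.2 (n+1)
  refine ⟨k, C, fun x => ?_⟩
  rw [norm_iteratedFDeriv_fderiv]; exact h x

lemma htg_diff {f : E → F} (hf : f.HasTemperateGrowth) : Differentiable ℝ f :=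
  hf.1.differentiable (by norm_num)

lemma htg_tg (n : ℕ) : ∀ {F : Type} [NormedAddCommGroup F] [NormedSpace ℝ F] {f : E → F},
    f.HasTemperateGrowth → TG n f := by
  induction n with
  | zero => intro F _ _ f h; exact ⟨h.1.continuous, htg_pb h⟩
  | succ n ih => intro F _ _ f h; exact ⟨htg_diff h, htg_pb h, ih (htg_fderiv h)⟩

lemma tg_contDiff (n : ℕ) : ∀ {F : Type} [NormedAddCommGroup F] [NormedSpace ℝ F] {f : E → F},
    TG n f → ContDiff ℝ n f := by
  induction n with
  | zero => intro F _ _ f h; exact contDiff_zero.2 h.1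
  | succ n ih =>
    intro F _ _ f h
    rw [show ((n+1 : ℕ) : WithTop ℕ∞) = (n : WithTop ℕ∞) + 1 by norm_cast,
      contDiff_succ_iff_fderiv]
    exact ⟨h.1, by simp, ih h.2.2⟩

lemma tg_iter (n : ℕ) : ∀ {F : Type} [NormedAddCommGroup F] [NormedSpace ℝ F] {f : E → F},
    TG n f → PB (iteratedFDeriv ℝ n f) := by
  induction n with
  | zero => intro F _ _ f h; exact h.pb.mono (fun x => by rw [norm_iteratedFDeriv_zero])
  | succ n ih =>
    intro F _ _ f h
    exact (ih h.2.2).mono (fun x => by rw [norm_iteratedFDeriv_fderiv])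

lemma htg_of_tg {f : E → F} (h : ∀ n, TG n f) : f.HasTemperateGrowth := by
  refine ⟨contDiff_infty.2 fun n => tg_contDiff n (h n), fun n => ?_⟩
  obtain ⟨k, C, _, h⟩ := tg_iter n (h n)
  exact ⟨k, C, h⟩

lemma htg_iff {f : E → F} : f.HasTemperateGrowth ↔ ∀ n, TG n f :=
  ⟨fun h n => htg_tg n h, htg_of_tg⟩

lemma htg_pair {f : E → F} {g : E → G} (hf : f.HasTemperateGrowth) (hg : g.HasTemperateGrowth) :
    (fun x => (f x, g x)).HasTemperateGrowth :=
  htg_of_tg fun n => (htg_tg n hf).prodMk (htg_tg n hg)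

/-- solutions of ODE with polynomial bounds -/
lemma htg_ode {Y : E → F} {Φ : E × F → (E →L[ℝ] F)} (hΦ : Φ.HasTemperateGrowth)
    (hY : ∀ x, HasFDerivAt Y (Φ (x, Y x)) x) (hb : PB Y) : Y.HasTemperateGrowth := by
  refine htg_of_tg fun n => ?_
  induction n with
  | zero => exact ⟨continuous_iff_continuousAt.2 fun x => (hY x).continuousAt, hb⟩
  | succ n ih =>
    refine ⟨fun x => (hY x).differentiableAt, hb, ?_⟩
    have : fderiv ℝ Y = fun x => Φ (x, Y x) := by ext1 x; exact (hY x).fderiv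
    rw [this]
    exact TG.comp (fun m => htg_tg m hΦ) ((htg_tg n (Function.HasTemperateGrowth.id')).prodMk ih)

end toolkit

section toolkit2

variable {E F G H : Type} [NormedAddCommGroup E] [NormedSpace ℝ E]
  [NormedAddCommGroup F] [NormedSpace ℝ F] [NormedAddCommGroup G] [NormedSpace ℝ G]
  [NormedAddCommGroup H] [NormedSpace ℝ H]

lemma rd_fderiv {f : E → F} (hf : f.HasTemperateGrowth) (hr : RD f) : RD (fderiv ℝ f) := by
  intro k
  obtain ⟨N, M, hM, hM2⟩ := htg_pb (htg_fderiv (htg_fderiv hf))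
  obtain ⟨C, hC, hC2⟩ := hr (k + (k + N))
  refine ⟨(2 ^ (k + (k + N)) + 1) * C + M * 2 ^ N, by positivity, fun x => ?_⟩
  set J := 1 + ‖x‖ with hJ
  have hJ1 : 1 ≤ J := one_le_jb x
  have hJ0 : 0 < J := by linarith
  set h : ℝ := (J ^ (k + N))⁻¹ with hh
  have hh0 : 0 < h := by positivity
  have hh1 : h ≤ 1 := inv_le_one_of_one_le₀ (one_le_pow₀ hJ1)
  -- second derivative bound
  have h2 : ∀ z ∈ Metric.closedBall x h, ‖fderiv ℝ (fderiv ℝ f) z‖ ≤ M * 2 ^ N * J ^ N := by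
    intro z hz
    refine (hM2 z).trans ?_
    rw [mul_assoc, ← mul_pow]
    gcongr
    have : ‖z‖ ≤ ‖x‖ + h := by
      have := norm_le_norm_add_norm_sub x z
      rw [mem_closedBall_iff_norm] at hz
      linarith [norm_sub_rev x z]
    linarith
  have hd : ∀ z ∈ Metric.closedBall x h, ‖fderiv ℝ f z - fderiv ℝ f x‖ ≤ M * 2 ^ N * J ^ N * h := by
    intro z hz
    refine ((convex_closedBall x h).norm_image_sub_le_of_norm_fderiv_le
      (fun y _ => htg_diff (htg_fderiv hf) y) h2 (Metric.mem_closedBall_self hh0.le) hz).trans ?_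
    gcongr
    exact mem_closedBall_iff_norm.1 hz
  have key : ‖fderiv ℝ f x‖ ≤ ((2 ^ (k + (k + N)) + 1) * C / J ^ (k + (k + N))) / h
      + M * 2 ^ N * J ^ N * h := by
    refine ContinuousLinearMap.opNorm_le_of_unit_norm (by positivity) fun v hv => ?_
    have hmem : x + h • v ∈ Metric.closedBall x h := by
      rw [mem_closedBall_iff_norm, add_sub_cancel_left, norm_smul, hv, mul_one,
        Real.norm_of_nonneg hh0.le]
    have h3 := (convex_closedBall x h).norm_image_sub_le_of_norm_fderiv_le'
      (fun y _ => htg_diff hf y) hd (Metric.mem_closedBall_self hh0.le) hmem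
    rw [add_sub_cancel_left, norm_smul, hv, mul_one, Real.norm_of_nonneg hh0.le, map_smul] at h3
    have h4 : ‖h • fderiv ℝ f x v‖ ≤ ‖f (x + h • v)‖ + ‖f x‖ + M * 2 ^ N * J ^ N * h * h := by
      have e : h • fderiv ℝ f x v = f (x + h • v) - f x
          - (f (x + h • v) - f x - h • fderiv ℝ f x v) := by abel
      rw [e]
      refine (norm_sub_le _ _).trans (add_le_add (norm_sub_le _ _) h3)
    rw [norm_smul, Real.norm_of_nonneg hh0.le] at h4
    have h5 : ‖f x‖ ≤ C / J ^ (k + (k + N)) := by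
      rw [le_div_iff₀ (by positivity), mul_comm]; exact hC2 x
    have h6 : ‖f (x + h • v)‖ ≤ 2 ^ (k + (k + N)) * C / J ^ (k + (k + N)) := by
      rw [le_div_iff₀ (by positivity), mul_comm]
      calc J ^ (k + (k + N)) * ‖f (x + h • v)‖
          ≤ (2 * (1 + ‖x + h • v‖)) ^ (k + (k + N)) * ‖f (x + h • v)‖ := by
            gcongr
            have : ‖x‖ ≤ ‖x + h • v‖ + ‖h • v‖ := by
              have := norm_sub_le (x + h • v) (h • v); rwa [add_sub_cancel_right] at this
            rw [norm_smul, hv, mul_one, Real.norm_of_nonneg hh0.le] at this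
            linarith [norm_nonneg (x + h • v)]
        _ = 2 ^ (k + (k + N)) * ((1 + ‖x + h • v‖) ^ (k + (k + N)) * ‖f (x + h • v)‖) := by
            rw [mul_pow]; ring
        _ ≤ _ := by gcongr; exact hC2 _
    rw [← mul_le_mul_iff_right₀ hh0]
    refine h4.trans ?_
    have e2 : h * ((2 ^ (k + (k + N)) + 1) * C / J ^ (k + (k + N)) / h + M * 2 ^ N * J ^ N * h)
      = 2 ^ (k + (k + N)) * C / J ^ (k + (k + N)) + C / J ^ (k + (k + N)) +
        M * 2 ^ N * J ^ N * h * h := by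
      field_simp
    rw [e2]
    gcongr
  calc J ^ k * ‖fderiv ℝ f x‖ ≤ J ^ k * (((2 ^ (k + (k + N)) + 1) * C / J ^ (k + (k + N))) / h
      + M * 2 ^ N * J ^ N * h) := by gcongr
    _ = _ := by
      rw [hh]; simp only [pow_add]; field_simp

lemma rd_iter (n : ℕ) : ∀ {F : Type} [NormedAddCommGroup F] [NormedSpace ℝ F] {f : E → F},
    f.HasTemperateGrowth → RD f → RD (iteratedFDeriv ℝ n f) := by
  induction n with
  | zero => intro F _ _ f h hr k; simpa only [norm_iteratedFDeriv_zero] using hr k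
  | succ n ih =>
    intro F _ _ f h hr k
    simpa only [norm_iteratedFDeriv_fderiv] using ih (htg_fderiv h) (rd_fderiv h hr) k

def mkSchwartz (f : E → F) (hf : f.HasTemperateGrowth) (hr : RD f) : SchwartzMap E F where
  toFun := f
  smooth' := hf.1
  decay' := by
    intro k n
    obtain ⟨C, hC, h⟩ := rd_iter n hf hr k
    refine ⟨C, fun x => le_trans ?_ (h x)⟩
    gcongr
    linarith [norm_nonneg x]

@[simp] lemma mkSchwartz_apply (f : E → F) (hf : f.HasTemperateGrowth) (hr : RD f) (x : E) :
    mkSchwartz f hf hr x = f x := rfl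

lemma schwartz_rd (f : SchwartzMap E F) : RD f := by
  intro k
  refine ⟨2 ^ k * ((Finset.Iic (k, 0)).sup
    fun m => SchwartzMap.seminorm ℝ m.1 m.2) f, by positivity, fun x => ?_⟩
  have := SchwartzMap.one_add_le_sup_seminorm_apply (𝕜 := ℝ) (m := (k, 0)) (k := k) (n := 0)
    le_rfl le_rfl f x
  rwa [norm_iteratedFDeriv_zero] at this

lemma schwartz_htg (f : SchwartzMap E F) : (⇑f).HasTemperateGrowth := f.hasTemperateGrowth

end toolkit2

section toolkit3

variable {Θ P V F : Type} [NormedAddCommGroup Θ] [NormedSpace ℝ Θ] [MeasurableSpace Θ]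
  [OpensMeasurableSpace Θ] [SecondCountableTopology Θ]
  [NormedAddCommGroup P] [NormedSpace ℝ P]
  [NormedAddCommGroup F] [NormedSpace ℝ F]
  [NormedAddCommGroup V] [InnerProductSpace ℝ V]

/-- all moments finite -/
def Mom {K : Type} [NormedAddCommGroup K] (ν : Measure Θ) (m : Θ → K) : Prop :=
  AEStronglyMeasurable m ν ∧ ∀ k : ℕ, Integrable (fun θ => (1 + ‖θ‖) ^ k * ‖m θ‖) ν

lemma jb_prod (θ : Θ) (p : P) : 1 + ‖(θ, p)‖ ≤ (1 + ‖θ‖) * (1 + ‖p‖) := by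
  rw [Prod.norm_def]
  rcases max_cases ‖θ‖ ‖p‖ with h | h <;> rw [h.1] <;> nlinarith [norm_nonneg θ, norm_nonneg p]

lemma Mom.int_of_bound {ν : Measure Θ} {m : Θ → ℝ} (hm : Mom ν m) {f : Θ → F}
    (hf : Continuous f) {C : ℝ} {k : ℕ} (hb : ∀ θ, ‖f θ‖ ≤ C * (1 + ‖θ‖) ^ k) :
    Integrable (fun θ => m θ • f θ) ν := by
  refine ((hm.2 k).const_mul C).mono' (hm.1.smul hf.aestronglyMeasurable) ?_
  refine Filter.Eventually.of_forall fun θ => ?_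
  rw [norm_smul]
  calc ‖m θ‖ * ‖f θ‖ ≤ ‖m θ‖ * (C * (1 + ‖θ‖) ^ k) := by gcongr; exact hb θ
    _ = _ := by ring

lemma tg_integral {ν : Measure Θ} {m : Θ → ℝ} (hm : Mom ν m) (n : ℕ) :
    ∀ {F : Type} [NormedAddCommGroup F] [NormedSpace ℝ F] {T : Θ × P → F},
    T.HasTemperateGrowth → TG n (fun p => ∫ θ, m θ • T (θ, p) ∂ν) := by
  have bd : ∀ {F : Type} [NormedAddCommGroup F] [NormedSpace ℝ F] {T : Θ × P → F},
    T.HasTemperateGrowth → ∃ (k : ℕ) (C : ℝ), 0 ≤ C ∧ ∀ θ p,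
      ‖T (θ, p)‖ ≤ C * (1 + ‖p‖) ^ k * (1 + ‖θ‖) ^ k := by
    intro F _ _ T hT
    obtain ⟨k, C, hC, h⟩ := htg_pb hT
    refine ⟨k, C, hC, fun θ p => (h _).trans ?_⟩
    rw [mul_assoc, ← mul_pow, mul_comm (1 + ‖p‖)]
    gcongr
    exact jb_prod θ p
  have pb : ∀ {F : Type} [NormedAddCommGroup F] [NormedSpace ℝ F] {T : Θ × P → F},
    T.HasTemperateGrowth → PB (fun p => ∫ θ, m θ • T (θ, p) ∂ν) := by
    intro F _ _ T hT
    obtain ⟨k, C, hC, h⟩ := bd hT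
    have hI : 0 ≤ ∫ θ, (1 + ‖θ‖) ^ k * ‖m θ‖ ∂ν := integral_nonneg fun θ => by positivity
    refine ⟨k, C * ∫ θ, (1 + ‖θ‖) ^ k * ‖m θ‖ ∂ν, by positivity, fun p => ?_⟩
    have : C * (∫ θ, (1 + ‖θ‖) ^ k * ‖m θ‖ ∂ν) * (1 + ‖p‖) ^ k =
      ∫ θ, C * (1 + ‖p‖) ^ k * ((1 + ‖θ‖) ^ k * ‖m θ‖) ∂ν := by
      rw [integral_const_mul]; ring
    rw [this]
    refine norm_integral_le_of_norm_le ((hm.2 k).const_mul _) ?_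
    refine Filter.Eventually.of_forall fun θ => ?_
    rw [norm_smul]
    calc ‖m θ‖ * ‖T (θ, p)‖ ≤ ‖m θ‖ * (C * (1 + ‖p‖) ^ k * (1 + ‖θ‖) ^ k) := by
          gcongr; exact h θ p
      _ = _ := by ring
  have key : ∀ {F : Type} [NormedAddCommGroup F] [NormedSpace ℝ F] {T : Θ × P → F},
    T.HasTemperateGrowth → ∀ p, HasFDerivAt (fun p => ∫ θ, m θ • T (θ, p) ∂ν)
      (∫ θ, m θ • (fderiv ℝ T (θ, p)).comp (ContinuousLinearMap.inr ℝ Θ P) ∂ν) p := by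
    intro F _ _ T hT p
    obtain ⟨k, C, hC, h⟩ := bd hT
    have hD : Function.HasTemperateGrowth (fun z : Θ × P =>
      (ContinuousLinearMap.compL ℝ P (Θ × P) F).flip (ContinuousLinearMap.inr ℝ Θ P)
        (fderiv ℝ T z)) :=
      (ContinuousLinearMap.hasTemperateGrowth _).comp (htg_fderiv hT)
    obtain ⟨l, D, hD0, hDb⟩ := bd hD
    refine hasFDerivAt_integral_of_dominated_of_fderiv_le (𝕜 := ℝ) (F := fun p θ => m θ • T (θ, p))
      (F' := fun p θ => m θ • (fderiv ℝ T (θ, p)).comp (ContinuousLinearMap.inr ℝ Θ P)) (s := Metric.ball p 1)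
      (bound := fun θ => (D * (1 + (‖p‖ + 1)) ^ l) * ((1 + ‖θ‖) ^ l * ‖m θ‖))
      (Metric.ball_mem_nhds p one_pos) ?_ ?_ ?_ ?_ ((hm.2 l).const_mul _) ?_
    · refine Filter.Eventually.of_forall fun q => hm.1.smul ?_
      exact (hT.1.continuous.comp (by fun_prop : Continuous fun θ : Θ => (θ, q))).aestronglyMeasurable
    · exact hm.int_of_bound (hT.1.continuous.comp (by fun_prop : Continuous fun θ : Θ => (θ, p)))
        (fun θ => h θ p)
    · refine hm.1.smul ?_
      exact (hD.1.continuous.comp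
        (by fun_prop : Continuous fun θ : Θ => (θ, p))).aestronglyMeasurable
    · refine Filter.Eventually.of_forall fun θ q hq => ?_
      rw [norm_smul]
      have := hDb θ q
      have hq' : ‖q‖ ≤ ‖p‖ + 1 := by
        have := norm_le_norm_add_norm_sub p q
        rw [mem_ball_iff_norm] at hq
        linarith [norm_sub_rev p q]
      calc ‖m θ‖ * _ ≤ ‖m θ‖ * (D * (1 + ‖q‖) ^ l * (1 + ‖θ‖) ^ l) := by gcongr; exact this
        _ ≤ ‖m θ‖ * (D * (1 + (‖p‖ + 1)) ^ l * (1 + ‖θ‖) ^ l) := by gcongr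
        _ = _ := by ring
    · refine Filter.Eventually.of_forall fun θ q hq => ?_
      refine HasFDerivAt.const_smul ?_ (m θ)
      have h1 := (htg_diff hT (θ, q)).hasFDerivAt
      have h2 : HasFDerivAt (fun q : P => ((θ, q) : Θ × P)) (ContinuousLinearMap.inr ℝ Θ P) q :=
        hasFDerivAt_prodMk_right θ q
      exact h1.comp q h2
  induction n with
  | zero =>
    intro F _ _ T hT
    exact ⟨continuous_iff_continuousAt.2 fun p => (key hT p).continuousAt, pb hT⟩
  | succ n ih =>
    intro F _ _ T hT
    refine ⟨fun p => (key hT p).differentiableAt, pb hT, ?_⟩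
    have hD : Function.HasTemperateGrowth (fun z : Θ × P =>
      (ContinuousLinearMap.compL ℝ P (Θ × P) F).flip (ContinuousLinearMap.inr ℝ Θ P)
        (fderiv ℝ T z)) :=
      (ContinuousLinearMap.hasTemperateGrowth _).comp (htg_fderiv hT)
    have := ih hD
    convert this using 1
    ext1 p
    exact (key hT p).fderiv

lemma htg_integral {ν : Measure Θ} {m : Θ → ℝ} (hm : Mom ν m) {T : Θ × P → F}
    (hT : T.HasTemperateGrowth) :
    Function.HasTemperateGrowth (fun p => ∫ θ, m θ • T (θ, p) ∂ν) :=
  htg_of_tg fun n => tg_integral hm n hT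

lemma mom_unit : Mom (volume.restrict (Set.Ioc (0:ℝ) 1)) (fun _ : ℝ => (1:ℝ)) := by
  refine ⟨aestronglyMeasurable_const, fun k => ?_⟩
  refine Continuous.integrableOn_Ioc (by fun_prop)

lemma htg_integral_unit {T : ℝ × P → F} (hT : T.HasTemperateGrowth) :
    Function.HasTemperateGrowth (fun p => ∫ s in (0:ℝ)..1, T (s, p)) := by
  have := htg_integral (P := P) mom_unit hT
  simpa [intervalIntegral.integral_of_le zero_le_one] using this

lemma master {ν : Measure Θ} {m : Θ → ℂ} (hm : Mom ν m) {T : Θ × P → ℂ}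
    (hT : T.HasTemperateGrowth)
    (hd : ∀ k : ℕ, ∃ (N : ℕ) (C : ℝ), 0 ≤ C ∧ ∀ θ p,
      (1 + ‖p‖) ^ k * ‖T (θ, p)‖ ≤ C * (1 + ‖θ‖) ^ N) :
    ∃ S : SchwartzMap P ℂ, ∀ p, S p = ∫ θ, m θ * T (θ, p) ∂ν := by
  have hmr : Mom ν (fun θ => (m θ).re) :=
    ⟨Complex.continuous_re.comp_aestronglyMeasurable hm.1, fun k => (hm.2 k).mono'
      ((Continuous.aestronglyMeasurable (by fun_prop)).mul
        (Complex.continuous_re.comp_aestronglyMeasurable hm.1).norm)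
      (Filter.Eventually.of_forall fun θ => by
        rw [norm_mul, norm_norm, Real.norm_of_nonneg (by positivity)]
        gcongr
        exact Complex.abs_re_le_norm _)⟩
  have hmi : Mom ν (fun θ => (m θ).im) :=
    ⟨Complex.continuous_im.comp_aestronglyMeasurable hm.1, fun k => (hm.2 k).mono'
      ((Continuous.aestronglyMeasurable (by fun_prop)).mul
        (Complex.continuous_im.comp_aestronglyMeasurable hm.1).norm)
      (Filter.Eventually.of_forall fun θ => by
        rw [norm_mul, norm_norm, Real.norm_of_nonneg (by positivity)]
        gcongr
        exact Complex.abs_im_le_norm _)⟩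
  have h1 := htg_integral hmr hT
  have h2 := htg_integral hmi hT
  have hTb : ∀ p, ∃ (N : ℕ) (C : ℝ), ∀ θ, ‖T (θ, p)‖ ≤ C * (1 + ‖θ‖) ^ N := by
    intro p
    obtain ⟨N, C, _, h⟩ := hd 0
    exact ⟨N, C, fun θ => by simpa using h θ p⟩
  have hTc : ∀ p, Continuous fun θ => T (θ, p) := fun p =>
    hT.1.continuous.comp (by fun_prop : Continuous fun θ : Θ => (θ, p))
  have e : (fun p => ∫ θ, m θ * T (θ, p) ∂ν) = fun p =>
      (∫ θ, (m θ).re • T (θ, p) ∂ν) + Complex.I * ∫ θ, (m θ).im • T (θ, p) ∂ν := by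
    ext1 p
    obtain ⟨N, C, hb⟩ := hTb p
    rw [← integral_const_mul, ← integral_add (hmr.int_of_bound (hTc p) hb)
      ((hmi.int_of_bound (hTc p) hb).const_mul _)]
    congr 1; ext1 θ
    conv_lhs => rw [← Complex.re_add_im (m θ)]
    simp only [Complex.real_smul]; ring
  have hh : Function.HasTemperateGrowth (fun p => ∫ θ, m θ * T (θ, p) ∂ν) := by
    rw [e]; fun_prop
  have hr : RD (fun p => ∫ θ, m θ * T (θ, p) ∂ν) := by
    intro k
    obtain ⟨N, C, hC, h⟩ := hd k
    refine ⟨∫ θ, C * ((1 + ‖θ‖) ^ N * ‖m θ‖) ∂ν, integral_nonneg fun θ => by positivity,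
      fun p => ?_⟩
    have : (1 + ‖p‖) ^ k * ‖∫ θ, m θ * T (θ, p) ∂ν‖ =
        ‖∫ θ, ((1 + ‖p‖) ^ k : ℝ) • (m θ * T (θ, p)) ∂ν‖ := by
      rw [integral_smul, norm_smul, Real.norm_of_nonneg (by positivity)]
    rw [this]
    refine norm_integral_le_of_norm_le ((hm.2 N).const_mul C)
      (Filter.Eventually.of_forall fun θ => ?_)
    rw [norm_smul, Real.norm_of_nonneg (by positivity), norm_mul]
    calc _ = ‖m θ‖ * ((1 + ‖p‖) ^ k * ‖T (θ, p)‖) := by ring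
      _ ≤ ‖m θ‖ * (C * (1 + ‖θ‖) ^ N) := mul_le_mul_of_nonneg_left (h θ p) (norm_nonneg _)
      _ = _ := by ring
  exact ⟨mkSchwartz _ hh hr, fun p => rfl⟩

def sgnL : ℝ × P →L[ℝ] ℝ × P :=
  (-(ContinuousLinearMap.fst ℝ ℝ P)).prod (ContinuousLinearMap.snd ℝ ℝ P)

@[simp] lemma sgnL_apply (z : ℝ × P) : (sgnL z : ℝ × P) = (-z.1, z.2) := rfl

/-- partial derivative in first real variable -/
def dOne (g : ℝ × P → F) (z : ℝ × P) : F := fderiv ℝ g z (1, 0)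

lemma htg_dOne {g : ℝ × P → F} (hg : g.HasTemperateGrowth) : (dOne g).HasTemperateGrowth :=
  (ContinuousLinearMap.hasTemperateGrowth
    (ContinuousLinearMap.apply ℝ F ((1, 0) : ℝ × P))).comp (htg_fderiv hg)

lemma dOne_hasDerivAt {g : ℝ × P → F} (hg : g.HasTemperateGrowth) (a : ℝ) (p : P) :
    HasDerivAt (fun a => g (a, p)) (dOne g (a, p)) a := by
  have h1 := (htg_diff hg (a, p)).hasFDerivAt
  have h2 : HasDerivAt (fun a : ℝ => ((a, p) : ℝ × P)) (1, 0) a :=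
    (hasDerivAt_id a).prodMk (hasDerivAt_const a p)
  exact h1.comp_hasDerivAt a h2

lemma fderiv_sgnL {g : ℝ × P → F} (hg : Differentiable ℝ g) {c : ℝ}
    (h : ∀ z, g (sgnL z) = c • g z) (z : ℝ × P) :
    (fderiv ℝ g (sgnL z)).comp sgnL = c • fderiv ℝ g z := by
  have h1 : HasFDerivAt (fun z => g (sgnL z)) ((fderiv ℝ g (sgnL z)).comp sgnL) z :=
    (hg (sgnL z)).hasFDerivAt.comp z (sgnL : ℝ × P →L[ℝ] ℝ × P).hasFDerivAt
  have h2 : HasFDerivAt (fun z => g (sgnL z)) (c • fderiv ℝ g z) z := by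
    simp only [h]; exact (hg z).hasFDerivAt.const_smul c
  exact h1.unique h2

lemma dOne_sgnL {g : ℝ × P → F} (hg : Differentiable ℝ g) {c : ℝ}
    (h : ∀ z, g (sgnL z) = c • g z) (z : ℝ × P) : dOne g (sgnL z) = (-c) • dOne g z := by
  have := congrArg (fun L => L ((-1 : ℝ), (0 : P))) (fderiv_sgnL hg h z)
  simp only [ContinuousLinearMap.comp_apply, _root_.smul_apply] at this
  have e1 : (sgnL ((-1 : ℝ), (0 : P)) : ℝ × P) = (1, 0) := by simp
  have e2 : (((-1 : ℝ), (0 : P)) : ℝ × P) = -(1, 0) := by simp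
  rw [e1, e2, map_neg, smul_neg, ← neg_smul] at this
  exact this

lemma integral_dOne {g : ℝ × P → F} [CompleteSpace F] (hg : g.HasTemperateGrowth) (a : ℝ) (p : P) :
    a • (∫ s in (0:ℝ)..1, dOne g (s * a, p)) = g (a, p) - g (0, p) := by
  have hc : Continuous fun s : ℝ => dOne g (s * a, p) :=
    (htg_dOne hg).1.continuous.comp (by fun_prop)
  rw [← intervalIntegral.integral_smul]
  have hd : ∀ s ∈ Set.uIcc (0:ℝ) 1, HasDerivAt (fun s => g (s * a, p))
      (a • dOne g (s * a, p)) s := by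
    intro s _
    have := (dOne_hasDerivAt hg (s * a) p).scomp s ((hasDerivAt_id s).mul_const a)
    simpa [Function.comp_def] using this
  rw [intervalIntegral.integral_eq_sub_of_hasDerivAt hd
    ((hc.const_smul a).intervalIntegrable _ _)]
  simp

lemma dOne_even_zero {g : ℝ × P → F} (hg : g.HasTemperateGrowth)
    (he : ∀ a p, g (-a, p) = g (a, p)) (p : P) : dOne g (0, p) = 0 := by
  have he' : ∀ z, g (sgnL z) = (1:ℝ) • g z := fun z => by
    rw [one_smul, sgnL_apply]; exact he z.1 z.2
  have hodd : ∀ z, dOne g (sgnL z) = (-1:ℝ) • dOne g z := dOne_sgnL (htg_diff hg) he'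
  have := hodd (0, p)
  simp only [sgnL_apply, neg_zero, neg_smul, one_smul] at this
  have h2 : (2:ℝ) • dOne g (0, p) = 0 := by
    rw [two_smul]; nth_rewrite 1 [this]; simp
  exact (smul_eq_zero.1 h2).resolve_left two_ne_zero

lemma even_div [CompleteSpace F] {g : ℝ × P → F} (hg : g.HasTemperateGrowth)
    (he : ∀ a p, g (-a, p) = g (a, p)) :
    ∃ q : ℝ × P → F, q.HasTemperateGrowth ∧ (∀ a p, q (-a, p) = q (a, p)) ∧
      ∀ a p, dOne g (a, p) = a • q (a, p) := by
  have hd0 := dOne_even_zero hg he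
  have he' : ∀ z, g (sgnL z) = (1:ℝ) • g z := fun z => by
    rw [one_smul, sgnL_apply]; exact he z.1 z.2
  set q : ℝ × P → F := fun z => ∫ s in (0:ℝ)..1, dOne (dOne g) (s * z.1, z.2) with hq
  have hq1 : q.HasTemperateGrowth := by
    refine htg_integral_unit (T := fun y : ℝ × (ℝ × P) => dOne (dOne g) (y.1 * y.2.1, y.2.2)) ?_
    refine (htg_dOne (htg_dOne hg)).comp (htg_pair ?_ ?_)
    · exact ((ContinuousLinearMap.fst ℝ ℝ (ℝ × P)).hasTemperateGrowth).mul
        (((ContinuousLinearMap.fst ℝ ℝ P).comp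
          (ContinuousLinearMap.snd ℝ ℝ (ℝ × P))).hasTemperateGrowth)
    · exact ((ContinuousLinearMap.snd ℝ ℝ P).comp
          (ContinuousLinearMap.snd ℝ ℝ (ℝ × P))).hasTemperateGrowth
  have hodd : ∀ z, dOne g (sgnL z) = (-1:ℝ) • dOne g z := dOne_sgnL (htg_diff hg) he'
  have hq2 : ∀ a p, q (-a, p) = q (a, p) := by
    intro a p
    simp only [hq]
    congr 1; ext1 s
    have := dOne_sgnL (htg_diff (htg_dOne hg)) hodd (s * a, p)
    simp only [sgnL_apply, neg_neg, one_smul] at this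
    rw [← this]; simp
  have hq3 : ∀ a p, dOne g (a, p) = a • q (a, p) := by
    intro a p
    have := integral_dOne (htg_dOne hg) a p
    rw [hd0, sub_zero] at this
    exact this.symm
  exact ⟨q, hq1, hq2, hq3⟩

lemma tg_even (n : ℕ) : ∀ {F : Type} [NormedAddCommGroup F] [NormedSpace ℝ F] [CompleteSpace F]
    {g : ℝ × P → F}, g.HasTemperateGrowth → (∀ a p, g (-a, p) = g (a, p)) →
    TG n (fun z : V × P => g (‖z.1‖, z.2)) := by
  have pb : ∀ {F : Type} [NormedAddCommGroup F] [NormedSpace ℝ F] [CompleteSpace F]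
    {g : ℝ × P → F}, g.HasTemperateGrowth → PB (fun z : V × P => g (‖z.1‖, z.2)) := by
    intro F _ _ _ g hg
    refine (htg_pb hg).comp ⟨1, 1, zero_le_one, fun z => ?_⟩
    simp [Prod.norm_def]
  have ct : ∀ {F : Type} [NormedAddCommGroup F] [NormedSpace ℝ F] [CompleteSpace F]
    {g : ℝ × P → F}, g.HasTemperateGrowth → Continuous (fun z : V × P => g (‖z.1‖, z.2)) := by
    intro F _ _ _ g hg
    exact hg.1.continuous.comp (by fun_prop)
  induction n with
  | zero =>
    intro F _ _ _ g hg he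
    exact ⟨ct hg, pb hg⟩
  | succ n ih =>
    intro F _ _ _ g hg he
    have he' : ∀ z, g (sgnL z) = (1:ℝ) • g z := fun z => by
      rw [one_smul, sgnL_apply]; exact he z.1 z.2
    have hd0 := dOne_even_zero hg he
    obtain ⟨q, hq1, hq2, hq3⟩ := even_div hg he
    set gp : ℝ × P → (P →L[ℝ] F) := fun z =>
      (ContinuousLinearMap.compL ℝ P (ℝ × P) F).flip (ContinuousLinearMap.inr ℝ ℝ P)
        (fderiv ℝ g z) with hgp
    have hgp1 : gp.HasTemperateGrowth :=
      (ContinuousLinearMap.hasTemperateGrowth _).comp (htg_fderiv hg)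
    have hgp2 : ∀ a p, gp (-a, p) = gp (a, p) := by
      intro a p
      ext v
      have := congrArg (fun L => L ((0 : ℝ), v)) (fderiv_sgnL (htg_diff hg) he' (a, p))
      simpa [hgp] using this
    have hdec : ∀ a p, ∀ w : ℝ × P, fderiv ℝ g (a, p) w = w.1 • dOne g (a, p) + gp (a, p) w.2 := by
      intro a p w
      have : w = w.1 • ((1:ℝ), (0:P)) + (0, w.2) := by ext <;> simp
      conv_lhs => rw [this]
      rw [map_add, map_smul]; rfl
    have hder : ∀ z : V × P, HasFDerivAt (fun z : V × P => g (‖z.1‖, z.2))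
        (ContinuousLinearMap.smulRightL ℝ (V × P) F
          ((ContinuousLinearMap.compL ℝ (V × P) V ℝ).flip (ContinuousLinearMap.fst ℝ V P)
            (innerSL ℝ (ContinuousLinearMap.fst ℝ V P z))) (q (‖z.1‖, z.2))
         + (ContinuousLinearMap.compL ℝ (V × P) P F).flip (ContinuousLinearMap.snd ℝ V P)
            (gp (‖z.1‖, z.2))) z := by
      intro z
      by_cases hz : z.1 = 0
      · have h1 := (htg_diff hg (‖z.1‖, z.2)).hasFDerivAt
        rw [hasFDerivAt_iff_isLittleO] at h1 ⊢
        have ht : Filter.Tendsto (fun w : V × P => ((‖w.1‖, w.2) : ℝ × P)) (nhds z)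
            (nhds (‖z.1‖, z.2)) := by
          have : Continuous (fun w : V × P => ((‖w.1‖, w.2) : ℝ × P)) := by fun_prop
          exact this.tendsto z
        have h2 := h1.comp_tendsto ht
        refine (h2.congr_left ?_).trans_isBigO ?_
        · intro w
          simp only [Function.comp]
          rw [hdec]
          simp [hz, hd0]
        · refine Asymptotics.IsBigO.of_bound 1 (Filter.Eventually.of_forall fun w => ?_)
          simp only [Function.comp, hz, Prod.norm_def, Prod.fst_sub, Prod.snd_sub, norm_zero,
            sub_zero, norm_norm, one_mul, le_refl]
      · have h1 := (htg_diff hg (‖z.1‖, z.2)).hasFDerivAt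
        have hn : HasFDerivAt (fun w : V × P => ‖w.1‖)
            (((‖z.1‖)⁻¹ • innerSL ℝ z.1).comp (ContinuousLinearMap.fst ℝ V P)) z := by
          have h3 : HasFDerivAt (fun v : V => ‖v‖) ((‖z.1‖)⁻¹ • innerSL ℝ z.1) z.1 := by
            have h4 := (hasStrictFDerivAt_norm_sq z.1).hasFDerivAt.sqrt
              (by positivity)
            have e : (fun v : V => √(‖v‖ ^ 2)) = fun v => ‖v‖ := by
              ext1 v; exact Real.sqrt_sq (norm_nonneg v)
            rw [e] at h4
            convert h4 using 1
            rw [Real.sqrt_sq (norm_nonneg _)]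
            have : ‖z.1‖ ≠ 0 := norm_ne_zero_iff.2 hz
            rw [two_smul, ← two_smul ℝ, smul_smul]; congr 1; field_simp
          exact h3.comp z (ContinuousLinearMap.fst ℝ V P).hasFDerivAt
        have h2 : HasFDerivAt (fun w : V × P => ((‖w.1‖, w.2) : ℝ × P)) _ z :=
          hn.prodMk (ContinuousLinearMap.snd ℝ V P).hasFDerivAt
        refine (h1.comp z h2).congr_fderiv ?_
        ext1
        · ext v
          have : ‖z.1‖ ≠ 0 := norm_ne_zero_iff.2 hz
          simp [hdec, hq3, smul_smul]
          congr 1; field_simp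
        · ext v
          simp [hdec]
    refine ⟨fun z => (hder z).differentiableAt, pb hg, ?_⟩
    have : fderiv ℝ (fun z : V × P => g (‖z.1‖, z.2)) = _ := funext fun z => (hder z).fderiv
    rw [this]
    refine TG.add ?_ ?_
    · refine TG.bilin _ (TG.clm _ (TG.clm _ (htg_tg n
        (ContinuousLinearMap.hasTemperateGrowth _)))) (ih hq1 hq2)
    · exact TG.clm _ (ih hgp1 hgp2)

lemma htg_even [CompleteSpace F] {g : ℝ × P → F} (hg : g.HasTemperateGrowth)
    (he : ∀ a p, g (-a, p) = g (a, p)) :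
    Function.HasTemperateGrowth (fun z : V × P => g (‖z.1‖, z.2)) :=
  htg_of_tg fun n => tg_even n hg he

end toolkit3

section expo
variable {E : Type} [NormedAddCommGroup E] [NormedSpace ℝ E]

lemma htg_ofReal {q : E → ℝ} (hq : q.HasTemperateGrowth) :
    Function.HasTemperateGrowth (fun x => (q x : ℂ)) :=
  (Complex.ofRealCLM).hasTemperateGrowth.comp hq

lemma htg_cexp {Q : E → ℂ} (hQ : Q.HasTemperateGrowth) (hb : PB (fun x => Complex.exp (Q x))) :
    Function.HasTemperateGrowth (fun x => Complex.exp (Q x)) := by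
  refine htg_ode (Φ := fun z : E × ℂ =>
    ((ContinuousLinearMap.compL ℝ E ℂ ℂ).comp (ContinuousLinearMap.mul ℝ ℂ) z.2)
      (fderiv ℝ Q z.1)) ?_ ?_ hb
  · refine ContinuousLinearMap.bilinear_hasTemperateGrowth
      ((ContinuousLinearMap.compL ℝ E ℂ ℂ).comp (ContinuousLinearMap.mul ℝ ℂ)) ?_ ?_
    · exact (ContinuousLinearMap.snd ℝ E ℂ).hasTemperateGrowth
    · exact (htg_fderiv hQ).comp (ContinuousLinearMap.fst ℝ E ℂ).hasTemperateGrowth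
  · intro x
    refine (((htg_diff hQ x).hasFDerivAt).cexp).congr_fderiv ?_
    ext v
    simp

lemma htg_cexp_of_le {Q : E → ℂ} (hQ : Q.HasTemperateGrowth) {C : ℝ} (hb : ∀ x, (Q x).re ≤ C) :
    Function.HasTemperateGrowth (fun x => Complex.exp (Q x)) :=
  htg_cexp hQ ⟨0, Real.exp C, by positivity, fun x => by
    simpa [Complex.norm_exp] using hb x⟩

end expo

/-- `1/⟨w⟩` -/
def jw (w : ℝ) : ℝ := (1 + ‖w‖ ^ 2) ^ (-(1 / 2) : ℝ)

lemma htg_jw : jw.HasTemperateGrowth :=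
  Function.hasTemperateGrowth_one_add_norm_sq_rpow ℝ _

lemma jw_pos (w : ℝ) : 0 < jw w := by unfold jw; positivity

lemma jw_le_one (w : ℝ) : jw w ≤ 1 := by
  unfold jw
  apply Real.rpow_le_one_of_one_le_of_nonpos
  · nlinarith [norm_nonneg w]
  · norm_num

lemma jw_sq (w : ℝ) : jw w ^ 2 * (1 + w ^ 2) = 1 := by
  have h : 0 < 1 + ‖w‖ ^ 2 := by positivity
  unfold jw
  rw [← Real.rpow_natCast, ← Real.rpow_mul h.le]
  norm_num
  rw [Real.rpow_neg_one, inv_mul_cancel₀]; positivity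

lemma jw_mul_abs (w : ℝ) : jw w * |w| ≤ 1 := by
  have := jw_sq w
  have h0 := jw_pos w
  have : (jw w * |w|) ^ 2 ≤ 1 := by rw [mul_pow, sq_abs]; nlinarith [sq_nonneg (jw w)]
  nlinarith [mul_nonneg h0.le (abs_nonneg w)]

lemma one_le_jw_mul (w : ℝ) : 1 ≤ jw w * (1 + |w|) := by
  have := jw_sq w
  have h0 := jw_pos w
  have : 1 ≤ (jw w * (1 + |w|)) ^ 2 := by
    rw [mul_pow]; nlinarith [sq_nonneg (jw w), sq_abs w, abs_nonneg w,
      mul_nonneg (sq_nonneg (jw w)) (abs_nonneg w)]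
  by_contra hlt
  push Not at hlt
  have h1 : 0 ≤ jw w * (1 + |w|) := by positivity
  nlinarith

section rdmom
variable {Θ K : Type} [NormedAddCommGroup Θ] [NormedSpace ℝ Θ] [MeasurableSpace Θ]
  [BorelSpace Θ] [FiniteDimensional ℝ Θ] [NormedAddCommGroup K]

lemma mom_of_rd {ν : Measure Θ} [ν.IsAddHaarMeasure] {m : Θ → K} (h1 : AEStronglyMeasurable m ν)
    (h2 : RD m) : Mom ν m := by
  refine ⟨h1, fun k => ?_⟩
  obtain ⟨C, hC, h⟩ := h2 (k + (Module.finrank ℝ Θ + 1))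
  have hi := (integrable_one_add_norm (E := Θ) (μ := ν)
    (r := (Module.finrank ℝ Θ + 1 : ℕ)) (by push_cast; linarith)).const_mul C
  refine hi.mono' ((Continuous.aestronglyMeasurable (by fun_prop)).mul h1.norm)
    (Filter.Eventually.of_forall fun θ => ?_)
  rw [norm_mul, norm_norm, Real.norm_of_nonneg (by positivity), Real.rpow_neg (by positivity),
    Real.rpow_natCast, ← div_eq_mul_inv, le_div_iff₀ (by positivity)]
  refine le_trans (le_of_eq ?_) (h θ)
  rw [pow_add]; ring

end rdmom

section wlemma
open scoped FourierTransform SchwartzMap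
variable {E : Type} [NormedAddCommGroup E] [InnerProductSpace ℝ E] [FiniteDimensional ℝ E]
  [MeasurableSpace E] [BorelSpace E]

lemma slice_iter (Ψ : 𝓢(ℝ × E, ℂ)) (w : ℝ) (n : ℕ) (X : E) :
    ‖iteratedFDeriv ℝ n (fun X => Ψ (w, X)) X‖ ≤ ‖iteratedFDeriv ℝ n Ψ (w, X)‖ := by
  have e : (fun X => Ψ (w, X)) = (fun z : ℝ × E => Ψ ((w, 0) + z)) ∘
      (ContinuousLinearMap.inr ℝ ℝ E) := by ext1 X; simp
  have hs : ContDiff ℝ n (fun z : ℝ × E => Ψ ((w, 0) + z)) :=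
    (Ψ.smooth n).comp (by fun_prop)
  rw [e, ContinuousLinearMap.iteratedFDeriv_comp_right _ hs _ le_rfl, iteratedFDeriv_comp_add_left]
  refine (ContinuousMultilinearMap.norm_compContinuousLinearMap_le _ _).trans ?_
  simp only [Finset.prod_const, Finset.card_univ, Fintype.card_fin]
  have : ‖ContinuousLinearMap.inr ℝ ℝ E‖ ≤ 1 :=
    ContinuousLinearMap.opNorm_le_bound _ zero_le_one fun x => by simp
  have h2 : ((w, (0:E)) + (ContinuousLinearMap.inr ℝ ℝ E) X : ℝ × E) = (w, X) := by simp
  rw [h2]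
  exact mul_le_of_le_one_right (norm_nonneg _) (pow_le_one₀ (norm_nonneg _) this)

def slice (Ψ : 𝓢(ℝ × E, ℂ)) (w : ℝ) : 𝓢(E, ℂ) where
  toFun := fun X => Ψ (w, X)
  smooth' := (Ψ.smooth ⊤).comp (by fun_prop)
  decay' := by
    intro k n
    obtain ⟨C, h⟩ := Ψ.decay' k n
    refine ⟨C, fun X => le_trans ?_ (h (w, X))⟩
    gcongr
    · exact le_max_right _ _
    · exact slice_iter Ψ w n X

@[simp] lemma slice_apply (Ψ : 𝓢(ℝ × E, ℂ)) (w : ℝ) (X : E) : slice Ψ w X = Ψ (w, X) := rfl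

lemma slice_seminorm (Ψ : 𝓢(ℝ × E, ℂ)) (K : ℕ) (k n : ℕ) : ∃ C : ℝ, 0 ≤ C ∧ ∀ w,
    (1 + |w|) ^ K * SchwartzMap.seminorm ℂ k n (slice Ψ w) ≤ C := by
  obtain ⟨C, hC, h⟩ := rd_iter n (schwartz_htg Ψ) (schwartz_rd Ψ) (K + k)
  refine ⟨C, hC, fun w => ?_⟩
  have h0 : 0 < (1 + |w|) ^ K := by positivity
  rw [← le_div_iff₀' h0]
  refine SchwartzMap.seminorm_le_bound ℂ k n _ (by positivity) fun X => ?_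
  rw [le_div_iff₀' h0]
  refine le_trans ?_ (h (w, X))
  rw [pow_add, mul_assoc]
  gcongr ?_ ^ _ * (?_ ^ _ * ?_)
  · have := le_max_left |w| ‖X‖
    simp only [Prod.norm_def, Real.norm_eq_abs]; linarith
  · have := le_max_right |w| ‖X‖
    simp only [Prod.norm_def, Real.norm_eq_abs]; linarith
  · exact slice_iter Ψ w n X

lemma slice_fourier_rd (Ψ : 𝓢(ℝ × E, ℂ)) : RD (fun z : ℝ × E => 𝓕 (slice Ψ z.1) z.2) := by
  have key : ∀ K k : ℕ, ∃ C : ℝ, 0 ≤ C ∧ ∀ w Y,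
      (1 + |w|) ^ K * (‖Y‖ ^ k * ‖𝓕 (slice Ψ w) Y‖) ≤ C := by
    intro K k
    let q : Seminorm ℂ 𝓢(E, ℂ) := (SchwartzMap.seminorm ℂ k 0).comp
      (SchwartzMap.fourierTransformCLM ℂ (V := E) (E := ℂ)).toLinearMap
    have hq : Continuous q :=
      ((schwartz_withSeminorms ℂ E ℂ).continuous_seminorm (k, 0)).comp
        (SchwartzMap.fourierTransformCLM ℂ (V := E) (E := ℂ)).continuous
    obtain ⟨s, C, hC, hb⟩ := Seminorm.bound_of_continuous (schwartz_withSeminorms ℂ E ℂ) q hq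
    choose D hD0 hD using fun i : ℕ × ℕ => slice_seminorm Ψ K i.1 i.2
    refine ⟨C * ∑ i ∈ s, D i, mul_nonneg C.2 (Finset.sum_nonneg fun i _ => hD0 i), fun w Y => ?_⟩
    have h1 : ‖Y‖ ^ k * ‖𝓕 (slice Ψ w) Y‖ ≤ q (slice Ψ w) :=
      SchwartzMap.norm_pow_mul_le_seminorm ℂ (𝓕 (slice Ψ w)) k Y
    have h2 := hb (slice Ψ w)
    have h3 : (s.sup (schwartzSeminormFamily ℂ E ℂ)) (slice Ψ w) ≤
        ∑ i ∈ s, SchwartzMap.seminorm ℂ i.1 i.2 (slice Ψ w) := by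
      have := Seminorm.finset_sup_le_sum (schwartzSeminormFamily ℂ E ℂ) s (slice Ψ w)
      refine this.trans (le_of_eq ?_)
      rw [← FunLike.coeAddMonoidHom_apply, map_sum, Finset.sum_apply]; rfl
    calc (1 + |w|) ^ K * (‖Y‖ ^ k * ‖𝓕 (slice Ψ w) Y‖)
        ≤ (1 + |w|) ^ K * (C * ∑ i ∈ s, SchwartzMap.seminorm ℂ i.1 i.2 (slice Ψ w)) := by
          refine mul_le_mul_of_nonneg_left (h1.trans (h2.trans ?_)) (by positivity)
          exact mul_le_mul_of_nonneg_left h3 C.2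
      _ = C * ∑ i ∈ s, (1 + |w|) ^ K * SchwartzMap.seminorm ℂ i.1 i.2 (slice Ψ w) := by
          rw [Finset.mul_sum, Finset.mul_sum, Finset.mul_sum]
          refine Finset.sum_congr rfl fun i _ => by ring
      _ ≤ _ := by
          refine mul_le_mul_of_nonneg_left (Finset.sum_le_sum fun i _ => hD i w) C.2
  intro k
  obtain ⟨C0, hC0, h0⟩ := key k 0
  obtain ⟨C1, hC1, h1⟩ := key k k
  refine ⟨2 ^ k * (C0 + C1), by positivity, fun z => ?_⟩
  have a := h0 z.1 z.2
  have b := h1 z.1 z.2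
  have h2 : (1 + ‖z‖) ^ k ≤ (1 + |z.1|) ^ k * (2 ^ k * (1 + ‖z.2‖ ^ k)) := by
    calc (1 + ‖z‖) ^ k ≤ ((1 + |z.1|) * (1 + ‖z.2‖)) ^ k := by
          gcongr; exact jb_prod z.1 z.2
      _ ≤ _ := by
          rw [mul_pow]; gcongr
          calc (1 + ‖z.2‖) ^ k ≤ 2 ^ (k - 1) * (1 ^ k + ‖z.2‖ ^ k) :=
                add_pow_le zero_le_one (norm_nonneg _) k
            _ ≤ 2 ^ k * (1 + ‖z.2‖ ^ k) := by
                rw [one_pow]; gcongr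
                · norm_num
                · omega
  calc _ ≤ (1 + |z.1|) ^ k * (2 ^ k * (1 + ‖z.2‖ ^ k)) * ‖𝓕 (slice Ψ z.1) z.2‖ := by gcongr
    _ = 2 ^ k * ((1 + |z.1|) ^ k * (‖z.2‖ ^ 0 * ‖𝓕 (slice Ψ z.1) z.2‖) +
        (1 + |z.1|) ^ k * (‖z.2‖ ^ k * ‖𝓕 (slice Ψ z.1) z.2‖)) := by ring
    _ ≤ _ := by gcongr

lemma slice_fourier_mom (Ψ : 𝓢(ℝ × E, ℂ)) :
    Mom (volume : Measure (ℝ × E)) (fun z : ℝ × E => 𝓕 (slice Ψ z.1) z.2) := by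
  have : (volume : Measure (ℝ × E)).IsAddHaarMeasure :=
    inferInstanceAs ((volume : Measure ℝ).prod (volume : Measure E)).IsAddHaarMeasure
  refine mom_of_rd ?_ (slice_fourier_rd Ψ)
  have e : (fun z : ℝ × E => 𝓕 (slice Ψ z.1) z.2) = fun z : ℝ × E =>
      ∫ v, Complex.exp ((↑(-2 * Real.pi * inner ℝ v z.2) * Complex.I)) • Ψ (z.1, v) := by
    ext1 z
    rw [SchwartzMap.fourier_coe, Real.fourier_eq']; rfl
  rw [e]
  refine StronglyMeasurable.aestronglyMeasurable ?_
  refine StronglyMeasurable.integral_prod_right' (f := fun y : (ℝ × E) × E =>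
    Complex.exp ((↑(-2 * Real.pi * inner ℝ y.2 y.1.2) * Complex.I)) • Ψ (y.1.1, y.2)) ?_
  refine Continuous.stronglyMeasurable ?_
  have := Ψ.continuous
  fun_prop

lemma exp_decay_bound (k : ℕ) (d : ℝ) (hd : 0 ≤ d) :
    (1 + d) ^ k * Real.exp (-d) ≤ k.factorial * Real.exp 1 := by
  have h := Real.pow_div_factorial_le_exp (x := 1 + d) (by linarith) k
  rw [div_le_iff₀ (by positivity)] at h
  calc (1 + d) ^ k * Real.exp (-d) ≤ (Real.exp (1 + d) * k.factorial) * Real.exp (-d) := by gcongr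
    _ = k.factorial * (Real.exp (1 + d) * Real.exp (-d)) := by ring
    _ = _ := by rw [← Real.exp_add]; congr 2; ring

lemma wlemma (φ : 𝓢(E, ℂ)) (q : E → ℝ) (hq : q.HasTemperateGrowth) :
    ∃ m : ℝ × E → ℂ, Mom (volume : Measure (ℝ × E)) m ∧ ∀ X, φ X =
      ∫ z : ℝ × E, m z * Complex.exp (2 * Real.pi * Complex.I * (inner ℝ X z.2 : ℝ)
        - (jw z.1 * q X : ℝ)) := by
  set Q : ℝ × E → ℝ := fun z => -(q z.2 - z.1) ^ 2 + jw z.1 * q z.2 with hQ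
  have hQt : Q.HasTemperateGrowth := by
    have h1 : Function.HasTemperateGrowth (fun z : ℝ × E => q z.2) :=
      hq.comp (ContinuousLinearMap.snd ℝ ℝ E).hasTemperateGrowth
    have h2 : Function.HasTemperateGrowth (fun z : ℝ × E => jw z.1) :=
      htg_jw.comp (ContinuousLinearMap.fst ℝ ℝ E).hasTemperateGrowth
    have h3 : Function.HasTemperateGrowth (fun z : ℝ × E => z.1) :=
      (ContinuousLinearMap.fst ℝ ℝ E).hasTemperateGrowth
    exact (((h1.sub h3).pow 2).neg).add (h2.mul h1)
  have hQb : ∀ z, Q z ≤ 2 - |q z.2 - z.1| := by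
    intro z
    have h1 := jw_mul_abs z.1
    have h2 := jw_le_one z.1
    have h3 := jw_pos z.1
    have h4 : jw z.1 * q z.2 ≤ jw z.1 * |z.1| + jw z.1 * |q z.2 - z.1| := by
      rw [← mul_add]; gcongr
      linarith [le_abs_self z.1, le_abs_self (q z.2 - z.1)]
    have h5 : jw z.1 * |q z.2 - z.1| ≤ |q z.2 - z.1| := mul_le_of_le_one_left (abs_nonneg _) h2
    simp only [hQ]
    nlinarith [sq_abs (q z.2 - z.1), sq_nonneg (|q z.2 - z.1| - 1)]
  set c : ℂ := (((√Real.pi)⁻¹ : ℝ) : ℂ) with hc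
  set ψ : ℝ × E → ℂ := fun z => c * (φ z.2 * Complex.exp (Q z : ℝ)) with hψ
  have hψt : ψ.HasTemperateGrowth := by
    have h1 : Function.HasTemperateGrowth (fun z : ℝ × E => φ z.2) :=
      (schwartz_htg φ).comp (ContinuousLinearMap.snd ℝ ℝ E).hasTemperateGrowth
    have h2 : Function.HasTemperateGrowth (fun z : ℝ × E => Complex.exp (Q z : ℝ)) :=
      htg_cexp_of_le (C := 2) (htg_ofReal hQt) (fun z => by
        rw [Complex.ofReal_re]; linarith [hQb z, abs_nonneg (q z.2 - z.1)])
    exact (Function.HasTemperateGrowth.const c).mul (h1.mul h2)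
  have hψr : RD ψ := by
    intro k
    obtain ⟨N, D, hD, hq2⟩ := htg_pb hq
    obtain ⟨C, hC, h⟩ := schwartz_rd φ (N * k + k)
    refine ⟨‖c‖ * (k.factorial * Real.exp 1 * Real.exp 2 * ((1 + D) ^ k * C)), by positivity,
      fun z => ?_⟩
    have h1 := exp_decay_bound k |q z.2 - z.1| (abs_nonneg _)
    have h2 : 1 + ‖z‖ ≤ (1 + |q z.2 - z.1|) * ((1 + D) * (1 + ‖z.2‖) ^ N) * (1 + ‖z.2‖) := by
      refine (jb_prod z.1 z.2).trans ?_
      gcongr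
      have h3 := hq2 z.2
      have h4 : |z.1| ≤ |q z.2| + |q z.2 - z.1| := by
        have := abs_sub (q z.2) (q z.2 - z.1); rwa [sub_sub_cancel] at this
      have h5 := one_le_pow₀ (n := N) (one_le_jb z.2)
      rw [Real.norm_eq_abs] at h3 ⊢
      have h6 : 1 + |q z.2| ≤ (1 + D) * (1 + ‖z.2‖) ^ N := by linarith
      nlinarith [abs_nonneg (q z.2), abs_nonneg (q z.2 - z.1)]
    have h3 : Real.exp (Q z) ≤ Real.exp 2 * Real.exp (-|q z.2 - z.1|) := by
      rw [← Real.exp_add]; exact Real.exp_le_exp.2 (by linarith [hQb z])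
    simp only [hψ, norm_mul, Complex.norm_exp, Complex.ofReal_re]
    calc (1 + ‖z‖) ^ k * (‖c‖ * (‖φ z.2‖ * Real.exp (Q z)))
        ≤ ((1 + |q z.2 - z.1|) * ((1 + D) * (1 + ‖z.2‖) ^ N) * (1 + ‖z.2‖)) ^ k *
          (‖c‖ * (‖φ z.2‖ * (Real.exp 2 * Real.exp (-|q z.2 - z.1|)))) := by gcongr
      _ = ‖c‖ * (((1 + |q z.2 - z.1|) ^ k * Real.exp (-|q z.2 - z.1|)) * Real.exp 2 *
          ((1 + D) ^ k * ((1 + ‖z.2‖) ^ (N * k + k) * ‖φ z.2‖))) := by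
          rw [mul_pow, mul_pow, mul_pow, pow_add, pow_mul]; ring
      _ ≤ _ := by gcongr; exact h _
  set Ψ : 𝓢(ℝ × E, ℂ) := mkSchwartz ψ hψt hψr with hΨ
  have hmom := slice_fourier_mom Ψ
  refine ⟨_, hmom, fun X => ?_⟩
  have hint : Integrable (fun z : ℝ × E => 𝓕 (slice Ψ z.1) z.2 *
      Complex.exp (2 * Real.pi * Complex.I * (inner ℝ X z.2 : ℝ) - (jw z.1 * q X : ℝ))) volume := by
    have := hmom.2 0
    simp only [pow_zero, one_mul] at this
    have h2 := (integrable_norm_iff hmom.1).1 this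
    refine h2.mul_bdd (c := Real.exp |q X|) ?_ ?_
    · refine Continuous.aestronglyMeasurable ?_
      have := htg_jw.1.continuous
      fun_prop
    · refine Filter.Eventually.of_forall fun z => ?_
      rw [Complex.norm_exp]
      refine Real.exp_le_exp.2 ?_
      have h1 := jw_le_one z.1
      have h3 := jw_pos z.1
      have : -(jw z.1 * q X) ≤ |q X| := by
        rw [← mul_neg]
        calc jw z.1 * -q X ≤ jw z.1 * |q X| := by gcongr; exact neg_le_abs _
          _ ≤ _ := mul_le_of_le_one_left (abs_nonneg _) h1
      simpa using this
  have : (volume : Measure (ℝ × E)) = (volume : Measure ℝ).prod (volume : Measure E) := rfl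
  rw [this, integral_prod _ (by rwa [this] at hint)]
  have inner_eq : ∀ w : ℝ, ∫ Y, 𝓕 (slice Ψ w) Y *
      Complex.exp (2 * Real.pi * Complex.I * (inner ℝ X Y : ℝ) - (jw w * q X : ℝ)) =
      c * φ X * (Real.exp (-1 * (w - q X) ^ 2) : ℝ) := by
    intro w
    have h1 : (𝓕⁻ (𝓕 (slice Ψ w))) X = slice Ψ w X := by
      rw [FourierTransform.fourierInv_fourier_eq]
    rw [SchwartzMap.fourierInv_coe, Real.fourierInv_eq'] at h1
    have h2 : ∀ Y, 𝓕 (slice Ψ w) Y *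
      Complex.exp (2 * Real.pi * Complex.I * (inner ℝ X Y : ℝ) - (jw w * q X : ℝ)) =
      Complex.exp (-(jw w * q X : ℝ)) *
        (Complex.exp (((2 * Real.pi * inner ℝ Y X : ℝ) * Complex.I)) • 𝓕 (slice Ψ w) Y) := by
      intro Y
      rw [sub_eq_add_neg, Complex.exp_add, smul_eq_mul, real_inner_comm]
      push_cast; ring_nf
    simp_rw [h2]
    rw [integral_const_mul, h1, slice_apply, hΨ, mkSchwartz_apply, hψ]
    simp only
    rw [Complex.ofReal_exp, mul_comm, mul_assoc c, mul_assoc c, mul_assoc (φ X), ← Complex.exp_add]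
    congr 3
    simp only [hQ]; push_cast; ring
  simp_rw [inner_eq]
  rw [integral_const_mul, integral_complex_ofReal,
    integral_sub_right_eq_self (fun w : ℝ => Real.exp (-1 * w ^ 2)) (q X), integral_gaussian, hc]
  have : √Real.pi ≠ 0 := by positivity
  rw [div_one, mul_right_comm, ← Complex.ofReal_mul, inv_mul_cancel₀ this]
  simp

end wlemma

section cosroot

def Cc (z : ℂ) : ℂ := ∑' n : ℕ, (-z) ^ n / (2 * n).factorial

lemma Cc_diff : Differentiable ℂ Cc := by
  intro z
  have h : DifferentiableOn ℂ Cc (Metric.ball 0 (‖z‖ + 1)) := by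
    refine differentiableOn_tsum_of_summable_norm
      (u := fun n : ℕ => (‖z‖ + 1) ^ n / n.factorial) (Real.summable_pow_div_factorial _)
      (fun i => by fun_prop) Metric.isOpen_ball fun n w hw => ?_
    rw [norm_div, norm_pow, norm_neg, Complex.norm_natCast]
    rw [mem_ball_zero_iff] at hw
    gcongr
    omega
  exact h.differentiableAt (Metric.isOpen_ball.mem_nhds (by simp))

lemma Cc_sq (z : ℂ) : Cc (z ^ 2) = Complex.cos z := by
  rw [Complex.cos_eq_tsum, Cc]
  congr 1; ext1 n
  rw [neg_pow, ← pow_mul, ]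

def Cr (s : ℝ) : ℝ := (Cc s).re

lemma Cr_smooth : ContDiff ℝ ⊤ Cr := by
  have h : ContDiff ℝ ⊤ Cc := (Cc_diff.contDiff (n := ⊤)).restrict_scalars ℝ
  exact Complex.reCLM.contDiff.comp (h.comp Complex.ofRealCLM.contDiff)

lemma Cr_sq (z : ℝ) : Cr (z ^ 2) = Real.cos z := by
  have := Cc_sq z
  rw [Cr, Complex.ofReal_pow, this, ← Complex.ofReal_cos, Complex.ofReal_re]

lemma htg_cos : Function.HasTemperateGrowth Real.cos := by
  refine ⟨Real.contDiff_cos, fun n => ⟨0, 1, fun x => ?_⟩⟩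
  rw [norm_iteratedFDeriv_eq_norm_iteratedDeriv]
  simpa using Real.abs_iteratedDeriv_cos_le_one n x

lemma Cr_iter (n : ℕ) : ∃ g : ℝ × ℝ → ℝ, g.HasTemperateGrowth ∧ (∀ a p, g (-a, p) = g (a, p)) ∧
    ∀ a p, iteratedDeriv n Cr (a ^ 2) = g (a, p) := by
  induction n with
  | zero =>
    refine ⟨fun z => Real.cos z.1, htg_cos.comp (ContinuousLinearMap.fst ℝ ℝ ℝ).hasTemperateGrowth,
      fun a p => by simp, fun a p => by simp [Cr_sq]⟩
  | succ n ih =>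
    obtain ⟨g, hg, he, h⟩ := ih
    obtain ⟨q, hq, hqe, hq3⟩ := even_div hg he
    refine ⟨fun z => (1 / 2) * q z, (Function.HasTemperateGrowth.const _).mul hq,
      fun a p => by simp only [hqe], fun a p => ?_⟩
    have hne : ∀ a ∈ ({0}ᶜ : Set ℝ), iteratedDeriv (n + 1) Cr (a ^ 2) = (1 / 2) * q (a, p) := by
      intro a ha
      have h1 := dOne_hasDerivAt hg a p
      have h2 : HasDerivAt (fun a : ℝ => iteratedDeriv n Cr (a ^ 2))
          (iteratedDeriv (n + 1) Cr (a ^ 2) * (2 * a)) a := by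
        have h3 : HasDerivAt (iteratedDeriv n Cr) (iteratedDeriv (n + 1) Cr (a ^ 2)) (a ^ 2) := by
          rw [iteratedDeriv_succ]
          refine DifferentiableAt.hasDerivAt ?_
          exact (Cr_smooth.differentiable_iteratedDeriv n (by exact_mod_cast WithTop.coe_lt_top _)) _
        have h4 : HasDerivAt (fun a : ℝ => a ^ 2) (2 * a) a := by
          simpa using hasDerivAt_pow 2 a
        exact HasDerivAt.comp (h := fun a : ℝ => a ^ 2) a h3 h4
      have e : (fun a : ℝ => iteratedDeriv n Cr (a ^ 2)) = fun a => g (a, p) := by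
        ext1 b; exact h b p
      rw [e] at h2
      have := h2.unique h1
      rw [hq3, smul_eq_mul] at this
      have ha' : a ≠ 0 := ha
      have := mul_left_cancel₀ ha' (a := a) (b := 2 * iteratedDeriv (n + 1) Cr (a ^ 2))
        (c := q (a, p)) (by linarith)
      linarith
    have c1 : Continuous fun a : ℝ => iteratedDeriv (n + 1) Cr (a ^ 2) :=
      (Cr_smooth.continuous_iteratedDeriv (n + 1) le_top).comp (by fun_prop)
    have c2 : Continuous fun a : ℝ => (1 / 2) * q (a, p) := by
      have := hq.1.continuous
      fun_prop
    exact congrFun (Continuous.ext_on (dense_compl_singleton (0:ℝ)) c1 c2 hne) a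

def chi (s : ℝ) : ℝ := Real.smoothTransition (s + 1)

lemma chi_of_nonneg {s : ℝ} (h : 0 ≤ s) : chi s = 1 :=
  Real.smoothTransition.one_of_one_le (by linarith)

lemma chi_of_le {s : ℝ} (h : s ≤ -1) : chi s = 0 :=
  Real.smoothTransition.zero_of_nonpos (by linarith)

lemma chi_nonneg (s : ℝ) : 0 ≤ chi s := Real.smoothTransition.nonneg _

lemma chi_le_one (s : ℝ) : chi s ≤ 1 := Real.smoothTransition.le_one _

lemma chi_smooth : ContDiff ℝ ((⊤ : ℕ∞) : WithTop ℕ∞) chi :=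
  (Real.smoothTransition.contDiff (n := ⊤)).comp (by fun_prop)

/-- gluing lemma -/
lemma htg_chi_mul {B : ℝ → ℝ} (hB : ContDiff ℝ ((⊤ : ℕ∞) : WithTop ℕ∞) B)
    (hb : ∀ n : ℕ, ∃ (k : ℕ) (C : ℝ), ∀ s, 0 ≤ s → |iteratedDeriv n B s| ≤ C * (1 + |s|) ^ k) :
    Function.HasTemperateGrowth (fun s => chi s * B s) := by
  have hs : ContDiff ℝ ((⊤ : ℕ∞) : WithTop ℕ∞) (fun s => chi s * B s) := chi_smooth.mul hB
  refine ⟨hs, fun n => ?_⟩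
  obtain ⟨k, C, h⟩ := hb n
  obtain ⟨M, hM⟩ := (isCompact_Icc (a := (-1:ℝ)) (b := 0)).exists_bound_of_continuousOn
    (hs.continuous_iteratedDeriv n (by exact_mod_cast le_top)).continuousOn
  refine ⟨k, |C| + |M|, fun s => ?_⟩
  rw [norm_iteratedFDeriv_eq_norm_iteratedDeriv]
  have hone : 1 ≤ (1 + |s|) ^ k := one_le_pow₀ (by linarith [abs_nonneg s])
  rcases lt_or_ge s (-1) with h1 | h1
  · have : (fun s => chi s * B s) =ᶠ[nhds s] fun _ => (0:ℝ) := by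
      filter_upwards [Iio_mem_nhds h1] with y hy
      rw [chi_of_le (le_of_lt hy), zero_mul]
    rw [this.iteratedDeriv_eq]
    simp; positivity
  rcases le_or_gt s 0 with h2 | h2
  · refine (hM s ⟨h1, h2⟩).trans ?_
    rw [Real.norm_eq_abs]
    nlinarith [abs_nonneg C, le_abs_self M, abs_nonneg M]
  · have : (fun s => chi s * B s) =ᶠ[nhds s] B := by
      filter_upwards [Ioi_mem_nhds h2] with y hy
      rw [chi_of_nonneg (le_of_lt hy), one_mul]
    rw [this.iteratedDeriv_eq, Real.norm_eq_abs]
    refine (h s h2.le).trans ?_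
    rw [Real.norm_eq_abs]
    nlinarith [abs_nonneg C, le_abs_self C, abs_nonneg M]

/-- `Ac (z^2) = cos z`, smooth of temperate growth on the whole line -/
def Ac (s : ℝ) : ℝ := chi s * Cr s

lemma Ac_sq (z : ℝ) : Ac (z ^ 2) = Real.cos z := by
  rw [Ac, chi_of_nonneg (sq_nonneg z), one_mul, Cr_sq]

lemma htg_Ac : Function.HasTemperateGrowth Ac := by
  refine htg_chi_mul (Cr_smooth.of_le le_top) fun n => ?_
  obtain ⟨g, hg, -, h⟩ := Cr_iter n
  obtain ⟨k, C, hC, hb⟩ := htg_pb hg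
  refine ⟨k, C * 2 ^ k, fun s hs => ?_⟩
  have := h (√s) 0
  rw [Real.sq_sqrt hs] at this
  rw [this]
  refine (hb _).trans ?_
  rw [mul_assoc, ← mul_pow]
  gcongr
  have h2 : √s ≤ 1 + s := by
    rw [Real.sqrt_le_left (by linarith)]; nlinarith
  simp only [Prod.norm_def, Real.norm_eq_abs, abs_zero, abs_of_nonneg hs,
    abs_of_nonneg (Real.sqrt_nonneg s)]
  rw [max_eq_left (Real.sqrt_nonneg s)]; linarith

lemma Ac_bdd : ∃ C : ℝ, 0 ≤ C ∧ ∀ s, |Ac s| ≤ C := by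
  obtain ⟨M, hM⟩ := (isCompact_Icc (a := (-1:ℝ)) (b := 0)).exists_bound_of_continuousOn
    htg_Ac.1.continuous.continuousOn
  refine ⟨|M| + 1, by positivity, fun s => ?_⟩
  rcases lt_or_ge s (-1) with h1 | h1
  · rw [Ac, chi_of_le h1.le]; simp; positivity
  rcases le_or_gt s 0 with h2 | h2
  · exact (hM s ⟨h1, h2⟩).trans (by linarith [le_abs_self M])
  · rw [← Real.sq_sqrt h2.le, Ac_sq]
    exact (Real.abs_cos_le_one _).trans (by linarith [abs_nonneg M])

/-- smooth substitute for `|s|`, equal to `s` for nonnegative `s` -/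
def phs (s : ℝ) : ℝ := s * (2 * chi s - 1)

lemma phs_of_nonneg {s : ℝ} (h : 0 ≤ s) : phs s = s := by
  rw [phs, chi_of_nonneg h]; ring

lemma phs_ge (s : ℝ) : |s| - 2 ≤ phs s := by
  rcases le_or_gt s (-1) with h1 | h1
  · rw [phs, chi_of_le h1, abs_of_neg (by linarith)]; linarith
  rcases le_or_gt s 0 with h2 | h2
  · rw [abs_of_nonpos h2, phs]
    nlinarith [chi_nonneg s, chi_le_one s]
  · rw [phs_of_nonneg h2.le, abs_of_pos h2]; linarith

lemma htg_chi : chi.HasTemperateGrowth := by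
  have := htg_chi_mul (B := fun _ => 1) contDiff_const (fun n => ⟨0, 1, fun s _ => by
    rw [iteratedDeriv_const]; split_ifs <;> simp⟩)
  simpa using this

lemma htg_phs : phs.HasTemperateGrowth :=
  Function.HasTemperateGrowth.id'.mul
    (((Function.HasTemperateGrowth.const 2).mul htg_chi).sub (Function.HasTemperateGrowth.const 1))

end cosroot

section evenroot
open scoped SchwartzMap

lemma exp_decay_a (k : ℕ) {a d : ℝ} (ha : 0 < a) (ha1 : a ≤ 1) (hd : 0 ≤ d) :
    (1 + d) ^ k * Real.exp (-(a * d)) ≤ (1 / a) ^ k * (k.factorial * Real.exp 1) := by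
  have h := exp_decay_bound k (a * d) (by positivity)
  have h2 : 1 + d ≤ (1 / a) * (1 + a * d) := by
    rw [div_mul_eq_mul_div, le_div_iff₀ ha]; nlinarith
  calc (1 + d) ^ k * Real.exp (-(a * d)) ≤ ((1 / a) * (1 + a * d)) ^ k * Real.exp (-(a * d)) := by
        gcongr
    _ = (1 / a) ^ k * ((1 + a * d) ^ k * Real.exp (-(a * d))) := by rw [mul_pow]; ring
    _ ≤ _ := by gcongr

lemma inv_jw_le (w : ℝ) : 1 / jw w ≤ 1 + |w| := by
  rw [div_le_iff₀ (jw_pos w), mul_comm]; exact one_le_jw_mul w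

lemma exp_decay_jw (k : ℕ) (w : ℝ) {d : ℝ} (hd : 0 ≤ d) :
    (1 + d) ^ k * Real.exp (-(jw w * d)) ≤ (1 + |w|) ^ k * (k.factorial * Real.exp 1) := by
  refine (exp_decay_a k (jw_pos w) (jw_le_one w) hd).trans ?_
  have := inv_jw_le w
  have := jw_pos w
  gcongr

lemma Mom.int_mul {Θ : Type} [NormedAddCommGroup Θ] [NormedSpace ℝ Θ] [MeasurableSpace Θ]
    [OpensMeasurableSpace Θ] [SecondCountableTopology Θ] {ν : Measure Θ} {m : Θ → ℂ}
    (hm : Mom ν m) {f : Θ → ℂ}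
    (hf : Continuous f) {C : ℝ} {k : ℕ} (hb : ∀ θ, ‖f θ‖ ≤ C * (1 + ‖θ‖) ^ k) :
    Integrable (fun θ => m θ * f θ) ν := by
  refine ((hm.2 k).const_mul C).mono' (hm.1.mul hf.aestronglyMeasurable) ?_
  refine Filter.Eventually.of_forall fun θ => ?_
  rw [norm_mul]
  calc ‖m θ‖ * ‖f θ‖ ≤ ‖m θ‖ * (C * (1 + ‖θ‖) ^ k) := by gcongr; exact hb θ
    _ = _ := by ring

lemma even_root (h : 𝓢(ℝ, ℂ)) (he : ∀ R, h (-R) = h R) :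
    ∃ f0 : 𝓢(ℝ, ℂ), ∀ R, f0 (R ^ 2) = h R := by
  obtain ⟨m, hm, hφ⟩ := wlemma h (fun R => R ^ 2) (Function.HasTemperateGrowth.id'.pow 2)
  have hs1 : Function.HasTemperateGrowth (fun z : (ℝ × ℝ) × ℝ => z.2) :=
    (ContinuousLinearMap.snd ℝ (ℝ × ℝ) ℝ).hasTemperateGrowth
  have hw1 : Function.HasTemperateGrowth (fun z : (ℝ × ℝ) × ℝ => z.1.1) :=
    ((ContinuousLinearMap.fst ℝ ℝ ℝ).comp (ContinuousLinearMap.fst ℝ (ℝ × ℝ) ℝ)).hasTemperateGrowth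
  have hy1 : Function.HasTemperateGrowth (fun z : (ℝ × ℝ) × ℝ => z.1.2) :=
    ((ContinuousLinearMap.snd ℝ ℝ ℝ).comp (ContinuousLinearMap.fst ℝ (ℝ × ℝ) ℝ)).hasTemperateGrowth
  have hle : ∀ z : (ℝ × ℝ) × ℝ, -(jw z.1.1 * phs z.2) ≤ 2 - jw z.1.1 * |z.2| := by
    intro z
    have h1 := phs_ge z.2
    have h2 := jw_pos z.1.1
    have h3 := jw_le_one z.1.1
    nlinarith [mul_le_mul_of_nonneg_left h1 h2.le]
  let T : (ℝ × ℝ) × ℝ → ℂ := fun z =>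
    (Ac (4 * Real.pi ^ 2 * z.2 * z.1.2 ^ 2) : ℂ) * Complex.exp ((-(jw z.1.1 * phs z.2) : ℝ) : ℂ)
  have hT : T.HasTemperateGrowth := by
    refine (htg_ofReal (htg_Ac.comp (((Function.HasTemperateGrowth.const _).mul hs1).mul
      (hy1.pow 2)))).mul (htg_cexp_of_le (C := 2) (htg_ofReal
        ((htg_jw.comp hw1).mul (htg_phs.comp hs1)).neg) ?_)
    intro z
    rw [Complex.ofReal_re]
    have := hle z
    have := mul_nonneg (jw_pos z.1.1).le (abs_nonneg z.2)
    exact (hle z).trans (by linarith)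
  obtain ⟨C, hC, hAb⟩ := Ac_bdd
  obtain ⟨S, hS⟩ := master hm hT (fun k => by
    refine ⟨k, C * Real.exp 2 * (k.factorial * Real.exp 1), by positivity, fun θ s => ?_⟩
    simp only [T, norm_mul, Complex.norm_exp, Complex.ofReal_re, Complex.norm_real]
    have h1 : Real.exp (-(jw θ.1 * phs s)) ≤ Real.exp 2 * Real.exp (-(jw θ.1 * |s|)) := by
      rw [← Real.exp_add]; exact Real.exp_le_exp.2 (by linarith [hle (θ, s)])
    have h2 := exp_decay_jw k θ.1 (abs_nonneg s)
    have h3 : (1 + |θ.1|) ^ k ≤ (1 + ‖θ‖) ^ k := by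
      gcongr; exact le_max_left _ _
    rw [Real.norm_eq_abs, Real.norm_eq_abs]
    calc (1 + |s|) ^ k * (|Ac (4 * Real.pi ^ 2 * s * θ.2 ^ 2)| * Real.exp (-(jw θ.1 * phs s)))
        ≤ (1 + |s|) ^ k * (C * (Real.exp 2 * Real.exp (-(jw θ.1 * |s|)))) := by
          gcongr; exact hAb _
      _ = C * Real.exp 2 * ((1 + |s|) ^ k * Real.exp (-(jw θ.1 * |s|))) := by ring
      _ ≤ C * Real.exp 2 * ((1 + ‖θ‖) ^ k * (k.factorial * Real.exp 1)) := by
          exact mul_le_mul_of_nonneg_left (h2.trans (mul_le_mul_of_nonneg_right h3 (by positivity)))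
            (by positivity)
      _ = _ := by ring)
  refine ⟨S, fun R => ?_⟩
  have hi : ∀ R : ℝ, Integrable (fun z : ℝ × ℝ => m z * Complex.exp (2 * Real.pi * Complex.I *
      (inner ℝ R z.2 : ℝ) - (jw z.1 * R ^ 2 : ℝ))) volume := by
    intro R
    refine hm.int_mul (C := 1) (k := 0) ?_ ?_
    · have := htg_jw.1.continuous
      fun_prop
    · intro z
      rw [Complex.norm_exp]
      simp only [pow_zero, mul_one, Real.exp_le_one_iff]
      have := mul_nonneg (jw_pos z.1).le (sq_nonneg R)
      rw [Complex.sub_re, Complex.ofReal_re, Complex.re_mul_ofReal]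
      simpa using this
  have e : h R = (1 / 2) * (h R + h (-R)) := by rw [he]; ring
  rw [hS, e, hφ R, hφ (-R), ← integral_add (hi R) (hi (-R)), ← integral_const_mul]
  congr 1; ext1 z
  simp only [T]
  have h1 : 4 * Real.pi ^ 2 * R ^ 2 * z.2 ^ 2 = (2 * Real.pi * (R * z.2)) ^ 2 := by ring
  rw [h1, Ac_sq, phs_of_nonneg (sq_nonneg R), Complex.ofReal_cos, Complex.cos]
  simp only [sub_eq_add_neg, Complex.exp_add]
  have i1 : (inner ℝ R z.2 : ℝ) = R * z.2 := by simp [mul_comm]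
  have i2 : (inner ℝ (-R) z.2 : ℝ) = -(R * z.2) := by simp [mul_comm]
  rw [i1, i2, neg_sq]
  push_cast
  ring_nf

end evenroot

section fourier6
open scoped SchwartzMap FourierTransform LineDeriv

abbrev E6 := EuclideanSpace ℝ (Fin 3 ⊕ Fin 3)

def e6 : E6 ≃L[ℝ] V3 × V3 :=
  (EuclideanSpace.equiv (Fin 3 ⊕ Fin 3) ℝ).trans
    (ContinuousLinearEquiv.sumPiEquivProdPi ℝ (Fin 3) (Fin 3) (fun _ => ℝ))

lemma e6_mp : MeasurePreserving e6 (volume : Measure E6) (volume : Measure (V3 × V3)) :=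
  (volume_measurePreserving_sumPiEquivProdPi (fun _ : Fin 3 ⊕ Fin 3 => ℝ)).comp
    (PiLp.volume_preserving_ofLp (Fin 3 ⊕ Fin 3))

lemma e6_emb : MeasurableEmbedding e6 := e6.toHomeomorph.measurableEmbedding

def dt (p q : V3 × V3) : ℝ := p.1 ⬝ᵥ q.1 + p.2 ⬝ᵥ q.2

lemma dt_comm (p q : V3 × V3) : dt p q = dt q p := by
  simp only [dt, dotProduct_comm]

lemma inner_e6 (a b : E6) : inner ℝ a b = dt (e6 a) (e6 b) := by
  have h1 : ∀ c : E6, (e6 c).1 = fun i => c (Sum.inl i) := fun c => rfl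
  have h2 : ∀ c : E6, (e6 c).2 = fun i => c (Sum.inr i) := fun c => rfl
  rw [dt, h1, h2, h1, h2, PiLp.inner_apply, Fintype.sum_sum_type]
  simp [dotProduct, mul_comm]

def pull6 (f : 𝓢(V3 × V3, ℂ)) : 𝓢(E6, ℂ) := SchwartzMap.compCLMOfContinuousLinearEquiv ℂ e6 f
def push6 (f : 𝓢(E6, ℂ)) : 𝓢(V3 × V3, ℂ) :=
  SchwartzMap.compCLMOfContinuousLinearEquiv ℂ e6.symm f

lemma push_pull (f : 𝓢(V3 × V3, ℂ)) : push6 (pull6 f) = f := by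
  ext x; simp [push6, pull6]
lemma pull_push (f : 𝓢(E6, ℂ)) : pull6 (push6 f) = f := by
  ext x; simp [push6, pull6]

def FT (f : 𝓢(V3 × V3, ℂ)) : 𝓢(V3 × V3, ℂ) := push6 (𝓕 (pull6 f))
def FTI (f : 𝓢(V3 × V3, ℂ)) : 𝓢(V3 × V3, ℂ) := push6 (𝓕⁻ (pull6 f))

lemma FTI_FT (f : 𝓢(V3 × V3, ℂ)) : FTI (FT f) = f := by
  rw [FTI, FT, pull_push, FourierTransform.fourierInv_fourier_eq, push_pull]

lemma FT_FTI (f : 𝓢(V3 × V3, ℂ)) : FT (FTI f) = f := by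
  rw [FTI, FT, pull_push, FourierTransform.fourier_fourierInv_eq, push_pull]

lemma FT_apply (f : 𝓢(V3 × V3, ℂ)) (q : V3 × V3) :
    FT f q = ∫ p, Complex.exp ((-2 * Real.pi * dt p q : ℝ) * Complex.I) * f p := by
  have h : FT f q = 𝓕 (pull6 f : E6 → ℂ) (e6.symm q) := by
    rw [← SchwartzMap.fourier_coe]; rfl
  rw [h, Real.fourier_eq', ← e6_mp.integral_comp e6_emb]
  congr 1; ext1 v
  rw [inner_e6, e6.apply_symm_apply]; rfl

lemma FTI_apply (f : 𝓢(V3 × V3, ℂ)) (q : V3 × V3) :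
    FTI f q = ∫ p, Complex.exp ((2 * Real.pi * dt p q : ℝ) * Complex.I) * f p := by
  have h : FTI f q = 𝓕⁻ (pull6 f : E6 → ℂ) (e6.symm q) := by
    rw [← SchwartzMap.fourierInv_coe]; rfl
  rw [h, Real.fourierInv_eq', ← e6_mp.integral_comp e6_emb]
  congr 1; ext1 v
  rw [inner_e6, e6.apply_symm_apply]; rfl

lemma FTI_add (f g : 𝓢(V3 × V3, ℂ)) : FTI (f + g) = FTI f + FTI g := by
  simp only [FTI, pull6, push6, map_add, FourierTransform.fourierInv_add]

lemma FTI_smul (c : ℂ) (g : 𝓢(V3 × V3, ℂ)) : FTI (c • g) = c • FTI g := by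
  simp only [FTI, pull6, push6, map_smul, FourierTransform.fourierInv_smul]

lemma FTI_fderiv (f g : 𝓢(V3 × V3, ℂ)) (v : V3 × V3)
    (h : ∀ q, g q = 2 * Real.pi * Complex.I * dt q v * f q) (p : V3 × V3) :
    fderiv ℝ (FTI f) p v = FTI g p := by
  rw [← SchwartzMap.lineDerivOp_apply_eq_fderiv]
  have e : ∂_{v} (FTI f) = push6 (∂_{e6.symm v} (𝓕⁻ (pull6 f))) := by
    rw [FTI, push6, SchwartzMap.lineDerivOp_compCLMOfContinuousLinearEquiv]
    rfl
  rw [e, SchwartzMap.lineDerivOp_fourierInv_eq, FTI]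
  congr 3
  ext x
  rw [_root_.smul_apply, SchwartzMap.smulLeftCLM_apply_apply (by fun_prop), inner_e6, e6.apply_symm_apply]
  have : pull6 g x = g (e6 x) := rfl
  rw [this, h]
  simp [pull6]; ring

def cmul (c : V3 × V3 → ℝ) (f : 𝓢(V3 × V3, ℂ)) : 𝓢(V3 × V3, ℂ) := SchwartzMap.smulLeftCLM ℂ c f

lemma cmul_apply {c : V3 × V3 → ℝ} (hc : c.HasTemperateGrowth) (f : 𝓢(V3 × V3, ℂ)) (p) :
    cmul c f p = c p * f p := by
  simp [cmul, SchwartzMap.smulLeftCLM_apply_apply hc]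

lemma htg_x1 (j : Fin 3) : (fun q : V3 × V3 => q.1 j).HasTemperateGrowth :=
  ((ContinuousLinearMap.proj j : V3 →L[ℝ] ℝ).comp (ContinuousLinearMap.fst ℝ V3 V3)).hasTemperateGrowth
lemma htg_x2 (j : Fin 3) : (fun q : V3 × V3 => q.2 j).HasTemperateGrowth :=
  ((ContinuousLinearMap.proj j : V3 →L[ℝ] ℝ).comp (ContinuousLinearMap.snd ℝ V3 V3)).hasTemperateGrowth

lemma htg_dt (v : V3 × V3) : (fun q => dt q v).HasTemperateGrowth := by
  have : (fun q => dt q v) = fun q : V3 × V3 => q.1 0 * v.1 0 + q.1 1 * v.1 1 + q.1 2 * v.1 2 +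
    (q.2 0 * v.2 0 + q.2 1 * v.2 1 + q.2 2 * v.2 2) := by
    ext q; simp [dt, dotProduct, Fin.sum_univ_three]
  rw [this]
  have h1 := fun j => (htg_x1 j).mul (Function.HasTemperateGrowth.const (v.1 j))
  have h2 := fun j => (htg_x2 j).mul (Function.HasTemperateGrowth.const (v.2 j))
  exact (((h1 0).add (h1 1)).add (h1 2)).add (((h2 0).add (h2 1)).add (h2 2))

def mulI (v : V3 × V3) (f : 𝓢(V3 × V3, ℂ)) : 𝓢(V3 × V3, ℂ) :=
  (2 * Real.pi * Complex.I) • cmul (fun q => dt q v) f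

lemma mulI_apply (v) (f : 𝓢(V3 × V3, ℂ)) (q) :
    mulI v f q = 2 * Real.pi * Complex.I * dt q v * f q := by
  simp [mulI, cmul_apply (htg_dt v)]; ring

lemma fd_FTI (f : 𝓢(V3 × V3, ℂ)) (v : V3 × V3) :
    (fun p => fderiv ℝ (FTI f) p v) = FTI (mulI v f) := by
  ext p; exact FTI_fderiv f _ v (mulI_apply v f) p

lemma pdx_FTI (j) (f : 𝓢(V3 × V3, ℂ)) : pdx j (FTI f) = FTI (mulI (Pi.single j 1, 0) f) := fd_FTI f _
lemma pdy_FTI (j) (f : 𝓢(V3 × V3, ℂ)) : pdy j (FTI f) = FTI (mulI (0, Pi.single j 1) f) := fd_FTI f _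

lemma delta_FTI (f g : 𝓢(V3 × V3, ℂ))
    (h : ∀ q, g q = 4 * Real.pi ^ 2 * (q.2 ⬝ᵥ q.2 : ℝ) * f q) (p) :
    DeltaOp (FTI f) p = FTI g p := by
  simp only [DeltaOp, pdy_FTI]
  have : g = (-1 : ℂ) • (mulI (0, Pi.single 0 1) (mulI (0, Pi.single 0 1) f) +
    mulI (0, Pi.single 1 1) (mulI (0, Pi.single 1 1) f) +
    mulI (0, Pi.single 2 1) (mulI (0, Pi.single 2 1) f)) := by
    ext q
    simp only [_root_.smul_apply, _root_.add_apply, mulI_apply, h]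
    simp [dt, dotProduct, Fin.sum_univ_three]
    ring_nf
    simp
  rw [this, FTI_smul, FTI_add, FTI_add]
  simp
  ring

lemma dop_FTI (f g : 𝓢(V3 × V3, ℂ))
    (h : ∀ q, g q = 4 * Real.pi ^ 2 * (q.1 ⬝ᵥ q.2 : ℝ) * f q) (p) :
    DOp (FTI f) p = FTI g p := by
  have comm : ∀ u v, mulI u (mulI v f) = mulI v (mulI u f) := by
    intro u v; ext q; simp only [mulI_apply]; ring
  simp only [DOp, X1, X2, X3, pdy_FTI, pdx_FTI]
  rw [comm (0, Pi.single 1 1) (0, Pi.single 0 1), comm (0, Pi.single 2 1) (0, Pi.single 0 1),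
    comm (0, Pi.single 2 1) (0, Pi.single 1 1)]
  have : g = (-1 : ℂ) • (mulI (Pi.single 0 1, 0) (mulI (0, Pi.single 0 1) f) +
    mulI (Pi.single 1 1, 0) (mulI (0, Pi.single 1 1) f) +
    mulI (Pi.single 2 1, 0) (mulI (0, Pi.single 2 1) f)) := by
    ext q
    simp only [_root_.smul_apply, _root_.add_apply, mulI_apply, h]
    simp [dt, dotProduct, Fin.sum_univ_three]
    ring_nf
    simp
  rw [this, FTI_smul, FTI_add, FTI_add]
  simp
  ring

/-! rotations -/

lemma so3_det {k : Mat3} (hk : k ∈ SO3) : k.det = 1 := hk.2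
lemma so3_mul_tr {k : Mat3} (hk : k ∈ SO3) : k * k.transpose = 1 := hk.1
lemma so3_tr_mul {k : Mat3} (hk : k ∈ SO3) : k.transpose * k = 1 := mul_eq_one_comm.1 hk.1
lemma so3_tr {k : Mat3} (hk : k ∈ SO3) : k.transpose ∈ SO3 :=
  ⟨by rw [transpose_transpose]; exact so3_tr_mul hk, by rw [det_transpose]; exact hk.2⟩

lemma so3_dot {k : Mat3} (hk : k ∈ SO3) (x y : V3) : k.mulVec x ⬝ᵥ k.mulVec y = x ⬝ᵥ y := by
  rw [dotProduct_mulVec, ← mulVec_transpose, mulVec_mulVec, so3_tr_mul hk, one_mulVec]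

lemma so3_inv {k : Mat3} (hk : k ∈ SO3) (x : V3) : k.transpose.mulVec (k.mulVec x) = x := by
  rw [mulVec_mulVec, so3_tr_mul hk, one_mulVec]

lemma so3_inv' {k : Mat3} (hk : k ∈ SO3) (x : V3) : k.mulVec (k.transpose.mulVec x) = x := by
  rw [mulVec_mulVec, so3_mul_tr hk, one_mulVec]

def rotE (k : Mat3) (hk : k ∈ SO3) : V3 ≃L[ℝ] V3 :=
  LinearEquiv.toContinuousLinearEquiv
    { Matrix.mulVecLin k with
      invFun := fun x => k.transpose.mulVec x
      left_inv := fun x => so3_inv hk x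
      right_inv := fun x => so3_inv' hk x }

lemma rotE_apply (k : Mat3) (hk : k ∈ SO3) (x : V3) : rotE k hk x = k.mulVec x := rfl

lemma rot_mp {k : Mat3} (hk : k ∈ SO3) :
    MeasurePreserving (fun x : V3 => k.mulVec x) volume volume := by
  refine ⟨(rotE k hk).continuous.measurable, ?_⟩
  have := Real.map_matrix_volume_pi_eq_smul_volume_pi (M := k) (by rw [hk.2]; exact one_ne_zero)
  rw [hk.2] at this
  have e : (fun x : V3 => k.mulVec x) = ⇑(toLin' k) := by ext1 x; rw [toLin'_apply]
  rw [e]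
  simpa using this

lemma rot_int {k : Mat3} (hk : k ∈ SO3) (G : V3 × V3 → ℂ) :
    ∫ p : V3 × V3, G (k.mulVec p.1, k.mulVec p.2) = ∫ p, G p := by
  have h1 : MeasurePreserving (Prod.map (fun x : V3 => k.mulVec x) (fun x : V3 => k.mulVec x))
    (volume : Measure (V3 × V3)) volume := (rot_mp hk).prod (rot_mp hk)
  exact h1.integral_comp (((rotE k hk).prodCongr (rotE k hk)).toHomeomorph.measurableEmbedding) G

lemma FTI_inv {f : 𝓢(V3 × V3, ℂ)} (hf : Inv3 f) : Inv3 (FTI f) := by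
  intro k hk x y
  rw [FTI_apply, FTI_apply, ← rot_int hk]
  congr 1; ext1 p
  simp only [dt, so3_dot hk, hf k hk]

lemma FT_inv {f : 𝓢(V3 × V3, ℂ)} (hf : Inv3 f) : Inv3 (FT f) := by
  intro k hk x y
  rw [FT_apply, FT_apply, ← rot_int hk]
  congr 1; ext1 p
  simp only [dt, so3_dot hk, hf k hk]

end fourier6

section haar
open scoped SchwartzMap

instance : BorelSpace Mat3 := inferInstanceAs (BorelSpace (Fin 3 → Fin 3 → ℝ))
instance : SecondCountableTopology Mat3 :=
  inferInstanceAs (SecondCountableTopology (Fin 3 → Fin 3 → ℝ))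

instance : (volume : Measure (V3 × V3)).IsAddHaarMeasure :=
  Measure.prod.instIsAddHaarMeasure (volume : Measure V3) (volume : Measure V3)

variable {μ : Measure Mat3}

lemma haar_ae (hμ : IsHaarSO3 μ) : ∀ᵐ k ∂μ, k ∈ SO3 := hμ.2.1

lemma cont_mulVec (x : V3) : Continuous (fun k : Mat3 => k.mulVec x) :=
  Continuous.matrix_mulVec continuous_id continuous_const

lemma haar_left (hμ : IsHaarSO3 μ) {r : Mat3} (hr : r ∈ SO3) {h : Mat3 → ℂ} (hh : Continuous h) :
    ∫ k, h (r * k) ∂μ = ∫ k, h k ∂μ := by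
  have hc : Continuous (fun k : Mat3 => r * k) := continuous_const.matrix_mul continuous_id
  rw [← integral_map (f := h) (φ := fun k : Mat3 => r * k) hc.measurable.aemeasurable
    hh.aestronglyMeasurable, hμ.2.2 r hr]

lemma haar_avg (hμ : IsHaarSO3 μ) (G : 𝓢(V3 × V3, ℂ)) (hG : Inv3 G) {H : V3 × V3 → ℂ}
    (hH : Continuous H) {C : ℝ} (hb : ∀ p, ‖H p‖ ≤ C) :
    ∫ p, G p * ∫ k, H (k.mulVec p.1, k.mulVec p.2) ∂μ = ∫ p, G p * H p := by
  have := hμ.1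
  have hcont : Continuous (fun z : (V3 × V3) × Mat3 => G z.1 * H (z.2.mulVec z.1.1, z.2.mulVec z.1.2)) := by
    have h1 : Continuous fun z : (V3 × V3) × Mat3 => (z.2.mulVec z.1.1, z.2.mulVec z.1.2) :=
      (Continuous.matrix_mulVec continuous_snd (continuous_fst.comp continuous_fst)).prodMk
        (Continuous.matrix_mulVec continuous_snd (continuous_snd.comp continuous_fst))
    exact (G.continuous.comp continuous_fst).mul (hH.comp h1)
  have hint : Integrable (fun z : (V3 × V3) × Mat3 => G z.1 * H (z.2.mulVec z.1.1, z.2.mulVec z.1.2))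
      (volume.prod μ) := by
    have h0 : Integrable (fun z : (V3 × V3) × Mat3 => ‖G z.1‖ * C) (volume.prod μ) :=
      (G.integrable.norm.mul_prod (integrable_const C : Integrable (fun _ : Mat3 => C) μ))
    refine h0.mono' hcont.aestronglyMeasurable (Filter.Eventually.of_forall fun z => ?_)
    rw [norm_mul]
    gcongr; exact hb _
  have e1 : (fun p => G p * ∫ k, H (k.mulVec p.1, k.mulVec p.2) ∂μ) =
      fun p => ∫ k, G p * H (k.mulVec p.1, k.mulVec p.2) ∂μ := by
    ext p; rw [integral_const_mul]
  rw [e1, integral_integral_swap hint]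
  have e2 : ∀ k ∈ SO3, ∫ p, G p * H (k.mulVec p.1, k.mulVec p.2) = ∫ p, G p * H p := by
    intro k hk
    rw [← rot_int hk (fun p => G p * H p)]
    congr 1; ext1 p
    rw [hG k hk]
  rw [integral_congr_ae ((haar_ae hμ).mono fun k hk => e2 k hk)]
  simp

def r13 (a : ℝ) : Mat3 := !![Real.cos a, 0, -Real.sin a; 0, 1, 0; Real.sin a, 0, Real.cos a]
def r23 (a : ℝ) : Mat3 := !![1, 0, 0; 0, Real.cos a, -Real.sin a; 0, Real.sin a, Real.cos a]

lemma r13_mem (a : ℝ) : r13 a ∈ SO3 := by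
  have := Real.sin_sq_add_cos_sq a
  constructor
  · ext i j
    fin_cases i <;> fin_cases j <;> simp [r13, Matrix.mul_apply, Fin.sum_univ_three] <;> linarith
  · simp [r13, det_fin_three]; linarith

lemma r23_mem (a : ℝ) : r23 a ∈ SO3 := by
  have := Real.sin_sq_add_cos_sq a
  constructor
  · ext i j
    fin_cases i <;> fin_cases j <;> simp [r23, Matrix.mul_apply, Fin.sum_univ_three] <;> linarith
  · simp [r23, det_fin_three]; linarith

lemma nrm3_sq (x : V3) : nrm3 x ^ 2 = x 0 ^ 2 + x 1 ^ 2 + x 2 ^ 2 := by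
  rw [nrm3, Real.sq_sqrt (by positivity)]

lemma nrm3_nonneg (x : V3) : 0 ≤ nrm3 x := Real.sqrt_nonneg _

lemma dot_self3 (x : V3) : x ⬝ᵥ x = nrm3 x ^ 2 := by
  rw [nrm3_sq]; simp [dotProduct, Fin.sum_univ_three]; ring

lemma nrm3_rot {k : Mat3} (hk : k ∈ SO3) (x : V3) : nrm3 (k.mulVec x) = nrm3 x := by
  have := so3_dot hk x x
  rw [dot_self3, dot_self3] at this
  exact (sq_eq_sq₀ (nrm3_nonneg _) (nrm3_nonneg _)).1 this

lemma abs_le_nrm3 (x : V3) (j : Fin 3) : |x j| ≤ nrm3 x := by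
  apply Real.abs_le_sqrt
  fin_cases j <;> simp <;> nlinarith [sq_nonneg (x 0), sq_nonneg (x 1), sq_nonneg (x 2)]

lemma dint (hμ : IsHaarSO3 μ) {g g' : V3 → ℝ → ℂ} (x : V3) {C D : ℝ} (s : ℝ)
    (hc : ∀ s, Continuous (fun v => g v s)) (hc' : ∀ s, Continuous (fun v => g' v s))
    (hd : ∀ v s, HasDerivAt (g v) (g' v s) s)
    (hC : ∀ v s, nrm3 v = nrm3 x → ‖g v s‖ ≤ C) (hD : ∀ v s, nrm3 v = nrm3 x → ‖g' v s‖ ≤ D) :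
    HasDerivAt (fun s => ∫ k, g (k.mulVec x) s ∂μ) (∫ k, g' (k.mulVec x) s ∂μ) s := by
  have := hμ.1
  have hm := cont_mulVec x
  refine (hasDerivAt_integral_of_dominated_loc_of_deriv_le (F := fun s (k : Mat3) => g (k.mulVec x) s)
    (F' := fun s (k : Mat3) => g' (k.mulVec x) s) (bound := fun _ => D)
    (s := Set.univ) Filter.univ_mem
    (Filter.Eventually.of_forall fun t => ((hc t).comp hm).aestronglyMeasurable) ?_
    ((hc' s).comp hm).aestronglyMeasurable ?_ (integrable_const D) ?_).2
  · refine (integrable_const C).mono' ((hc s).comp hm).aestronglyMeasurable ?_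
    exact (haar_ae hμ).mono fun k hk => hC _ _ (nrm3_rot hk x)
  · exact (haar_ae hμ).mono fun k hk t _ => hD _ _ (nrm3_rot hk x)
  · exact Filter.Eventually.of_forall fun k t _ => hd _ _

lemma haar_int (hμ : IsHaarSO3 μ) (x : V3) {h : V3 → ℂ} (hh : Continuous h) {C : ℝ}
    (hC : ∀ v, nrm3 v = nrm3 x → ‖h v‖ ≤ C) : Integrable (fun k : Mat3 => h (k.mulVec x)) μ := by
  have := hμ.1
  refine (integrable_const C).mono' (hh.comp (cont_mulVec x)).aestronglyMeasurable ?_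
  exact (haar_ae hμ).mono fun k hk => hC _ (nrm3_rot hk x)

def ee (R : ℝ) (v : V3) : ℂ := Complex.exp (((R * v 2 : ℝ) : ℂ) * Complex.I)

lemma norm_ee (R : ℝ) (v : V3) : ‖ee R v‖ = 1 := Complex.norm_exp_ofReal_mul_I _
lemma cont_ee (R : ℝ) : Continuous (ee R) := by unfold ee; fun_prop

lemma ee_deriv {f : ℝ → ℝ} {f' s : ℝ} (hf : HasDerivAt f f' s) :
    HasDerivAt (fun s => Complex.exp ((f s : ℂ) * Complex.I))
      (((f' : ℝ) : ℂ) * Complex.I * Complex.exp ((f s : ℂ) * Complex.I)) s := by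
  have := ((hf.ofReal_comp).mul_const Complex.I).cexp
  convert this using 1; ring

/-- generic step: one coordinate `j` -/
lemma plane_id (hμ : IsHaarSO3 μ) (x : V3) (R : ℝ) (j : Fin 3) (rr : ℝ → Mat3)
    (hr : ∀ a, rr a ∈ SO3)
    (h1 : ∀ a v, ((rr a).mulVec v) j = Real.cos a * v j - Real.sin a * v 2)
    (h2 : ∀ a v, ((rr a).mulVec v) 2 = Real.sin a * v j + Real.cos a * v 2) :
    ∫ k, ((-(k.mulVec x 2) : ℝ) + Complex.I * R * ((k.mulVec x j) ^ 2 : ℝ)) * ee R (k.mulVec x) ∂μ = 0 := by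
  let g : V3 → ℝ → ℂ := fun v a => ((Real.cos a * v j - Real.sin a * v 2 : ℝ) : ℂ) *
    Complex.exp (((R * (Real.sin a * v j + Real.cos a * v 2) : ℝ) : ℂ) * Complex.I)
  let g' : V3 → ℝ → ℂ := fun v a => ((-Real.sin a * v j - Real.cos a * v 2 : ℝ) : ℂ) *
    Complex.exp (((R * (Real.sin a * v j + Real.cos a * v 2) : ℝ) : ℂ) * Complex.I) +
    ((Real.cos a * v j - Real.sin a * v 2 : ℝ) : ℂ) *
    (((R * (Real.cos a * v j + -Real.sin a * v 2) : ℝ) : ℂ) * Complex.I *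
    Complex.exp (((R * (Real.sin a * v j + Real.cos a * v 2) : ℝ) : ℂ) * Complex.I))
  have b1 : ∀ (v : V3) a, nrm3 v = nrm3 x → |Real.cos a * v j - Real.sin a * v 2| ≤ 2 * nrm3 x := by
    intro v a hv
    have e1 := abs_le_nrm3 v j
    have e2 := abs_le_nrm3 v 2
    have e3 := Real.abs_cos_le_one a
    have e4 := Real.abs_sin_le_one a
    refine (abs_sub _ _).trans ?_
    rw [abs_mul, abs_mul]
    rw [hv] at e1 e2
    nlinarith [abs_nonneg (v j), abs_nonneg (v 2), abs_nonneg (Real.cos a), abs_nonneg (Real.sin a)]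
  have b2 : ∀ (v : V3) a, nrm3 v = nrm3 x → |-Real.sin a * v j - Real.cos a * v 2| ≤ 2 * nrm3 x := by
    intro v a hv
    have := b1 v (a + Real.pi / 2) hv
    rwa [Real.cos_add_pi_div_two, Real.sin_add_pi_div_two] at this
  have hd := dint hμ (g := g) (g' := g') x (C := 2 * nrm3 x) (D := 2 * nrm3 x + 2 * nrm3 x * (|R| * (2 * nrm3 x))) 0
    (by intro s; fun_prop) (by intro s; fun_prop) (by
      intro v s
      have k1 : HasDerivAt (fun a => Real.cos a * v j - Real.sin a * v 2)
          (-Real.sin s * v j - Real.cos s * v 2) s :=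
        ((Real.hasDerivAt_cos s).mul_const _).sub ((Real.hasDerivAt_sin s).mul_const _)
      have k2 : HasDerivAt (fun a => R * (Real.sin a * v j + Real.cos a * v 2))
          (R * (Real.cos s * v j + -Real.sin s * v 2)) s :=
        (((Real.hasDerivAt_sin s).mul_const _).add ((Real.hasDerivAt_cos s).mul_const _)).const_mul R
      exact k1.ofReal_comp.mul (ee_deriv k2)) (by
      intro v s hv
      simp only [g, norm_mul, Complex.norm_exp_ofReal_mul_I, mul_one, Complex.norm_real]
      exact b1 v s hv) (by
      intro v s hv
      refine (norm_add_le _ _).trans ?_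
      simp only [norm_mul, Complex.norm_exp_ofReal_mul_I, mul_one, Complex.norm_real, Complex.norm_I,
        Real.norm_eq_abs]
      have := b1 v s hv
      have := b2 v s hv
      have := nrm3_nonneg x
      have h3 : |Real.cos s * v j + -Real.sin s * v 2| ≤ 2 * nrm3 x := by
        have := b1 v s hv
        rwa [sub_eq_add_neg, ← neg_mul] at this
      gcongr)
  have hconst : (fun s => ∫ k, g (k.mulVec x) s ∂μ) = fun _ => ∫ k, g (k.mulVec x) 0 ∂μ := by
    ext s
    rw [← haar_left hμ (hr s) (h := fun k => g (k.mulVec x) 0)]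
    · congr 1; ext1 k
      simp only [g, ← mulVec_mulVec, h1, h2, Real.cos_zero, Real.sin_zero, one_mul, zero_mul,
        sub_zero, zero_add]
    · have := cont_mulVec x
      fun_prop
  rw [hconst] at hd
  have := hd.unique (hasDerivAt_const _ _)
  rw [← this]
  congr 1; ext1 k
  simp only [g', ee, Real.cos_zero, Real.sin_zero]
  push_cast
  simp only [one_mul, zero_mul, zero_add, neg_zero, zero_sub, sub_zero, add_zero]
  ring

lemma sinc_avg (hμ : IsHaarSO3 μ) (x : V3) (R : ℝ) :
    ∫ k, ee R (k.mulVec x) ∂μ = (sph0 R x : ℂ) := by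
  have := hμ.1
  set ρ := nrm3 x with hρ
  let c : ℕ → ℝ → ℂ := fun n R => ∫ k, ((k.mulVec x 2 : ℝ) * Complex.I) ^ n * ee R (k.mulVec x) ∂μ
  have hbd : ∀ n R (v : V3), nrm3 v = nrm3 x → ‖((v 2 : ℝ) * Complex.I) ^ n * ee R v‖ ≤ ρ ^ n := by
    intro n R v hv
    rw [norm_mul, norm_ee, mul_one, norm_pow, norm_mul, Complex.norm_I, mul_one, Complex.norm_real]
    gcongr
    rw [hρ, ← hv]; exact abs_le_nrm3 v 2
  have hcc : ∀ n R, Continuous fun v : V3 => ((v 2 : ℝ) * Complex.I) ^ n * ee R v := by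
    intro n R
    have := cont_ee R
    fun_prop
  have hc : ∀ n R, HasDerivAt (c n) (c (n + 1) R) R := by
    intro n R
    refine dint hμ (g := fun v s => ((v 2 : ℝ) * Complex.I) ^ n * ee s v)
      (g' := fun v s => ((v 2 : ℝ) * Complex.I) ^ (n + 1) * ee s v) x R (hcc n) (hcc (n + 1)) ?_
      (fun v s hv => hbd n s v hv) (fun v s hv => hbd (n + 1) s v hv)
    intro v s
    have := ee_deriv (f := fun s => s * v 2) (hasDerivAt_mul_const (x := s) (v 2))
    have := this.const_mul (((v 2 : ℝ) * Complex.I) ^ n)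
    exact HasDerivAt.congr_deriv this (by rw [pow_succ]; simp only [ee]; ring)
  have p1 : ∀ R, 2 * c 1 R + R * c 2 R + ρ ^ 2 * R * c 0 R = 0 := by
    intro R
    have q1 := plane_id hμ x R 0 r13 r13_mem (by
      intro a v; simp [r13, mulVec, dotProduct, Fin.sum_univ_three]; ring) (by
      intro a v; simp [r13, mulVec, dotProduct, Fin.sum_univ_three])
    have q2 := plane_id hμ x R 1 r23 r23_mem (by
      intro a v; simp [r23, mulVec, dotProduct, Fin.sum_univ_three]; ring) (by
      intro a v; simp [r23, mulVec, dotProduct, Fin.sum_univ_three])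
    have ii : ∀ j, Integrable (fun k : Mat3 => ((-(k.mulVec x 2) : ℝ) + Complex.I * R *
        ((k.mulVec x j) ^ 2 : ℝ)) * ee R (k.mulVec x)) μ := by
      intro j
      refine haar_int hμ x (h := fun v => ((-(v 2) : ℝ) + Complex.I * R * ((v j) ^ 2 : ℝ)) * ee R v)
        (C := ρ + |R| * ρ ^ 2) ?_ ?_
      · have := cont_ee R
        fun_prop
      · intro v hv
        rw [norm_mul, norm_ee, mul_one]
        refine (norm_add_le _ _).trans ?_
        simp only [norm_mul, Complex.norm_real, Complex.norm_I, one_mul, norm_neg, norm_pow,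
          Real.norm_eq_abs, abs_neg, abs_pow]
        have e1 := abs_le_nrm3 v j
        have e2 := abs_le_nrm3 v 2
        rw [hv] at e1 e2
        gcongr
    have ic : ∀ n R, Integrable (fun k : Mat3 => ((k.mulVec x 2 : ℝ) * Complex.I) ^ n * ee R (k.mulVec x)) μ :=
      fun n R => haar_int hμ x (hcc n R) (hbd n R)
    have q3 : ∫ k, (((-(k.mulVec x 2) : ℝ) + Complex.I * R *
        ((k.mulVec x 0) ^ 2 : ℝ)) * ee R (k.mulVec x) + ((-(k.mulVec x 2) : ℝ) + Complex.I * R *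
        ((k.mulVec x 1) ^ 2 : ℝ)) * ee R (k.mulVec x)) ∂μ = 0 := by
      rw [integral_add (ii 0) (ii 1), q1, q2, add_zero]
    have q4 : 2 * c 1 R + R * c 2 R + ρ ^ 2 * R * c 0 R = ∫ k, (2 * (((k.mulVec x 2 : ℝ) * Complex.I) ^ 1 * ee R (k.mulVec x))
        + R * (((k.mulVec x 2 : ℝ) * Complex.I) ^ 2 * ee R (k.mulVec x))
        + ρ ^ 2 * R * (((k.mulVec x 2 : ℝ) * Complex.I) ^ 0 * ee R (k.mulVec x))) ∂μ := by
      have i1 := (ic 1 R).const_mul (2 : ℂ)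
      have i2 := (ic 2 R).const_mul (R : ℂ)
      have i3 := (ic 0 R).const_mul ((ρ : ℂ) ^ 2 * R)
      have i12 : Integrable (fun k : Mat3 => 2 * (((k.mulVec x 2 : ℝ) * Complex.I) ^ 1 * ee R (k.mulVec x))
        + R * (((k.mulVec x 2 : ℝ) * Complex.I) ^ 2 * ee R (k.mulVec x))) μ := i1.add i2
      rw [integral_add i12 i3, integral_add i1 i2, integral_const_mul,
        integral_const_mul, integral_const_mul]
    rw [q4, ← mul_zero (-Complex.I), ← q3, ← integral_const_mul]
    refine integral_congr_ae ((haar_ae hμ).mono fun k hk => ?_)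
    have hn : (ρ : ℂ) ^ 2 = (((k.mulVec x 0) ^ 2 + (k.mulVec x 1) ^ 2 + (k.mulVec x 2) ^ 2 : ℝ) : ℂ) := by
      rw [← nrm3_sq, nrm3_rot hk]; push_cast; rfl
    simp only [hn]
    push_cast
    linear_combination (ee R (k *ᵥ x)) * (R * ((k *ᵥ x) 2 : ℂ) ^ 2 + R * ((k *ᵥ x) 0 : ℂ) ^ 2 + R * ((k *ᵥ x) 1 : ℂ) ^ 2) * Complex.I_sq
  -- u = R g
  have hu : ∀ R : ℝ, HasDerivAt (fun R : ℝ => (R : ℂ) * c 0 R) (c 0 R + R * c 1 R) R := by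
    intro R
    have := (hasDerivAt_id R).ofReal_comp.mul (hc 0 R)
    exact HasDerivAt.congr_deriv this (by simp)
  have hu' : ∀ R : ℝ, HasDerivAt (fun R : ℝ => c 0 R + R * c 1 R) (-(ρ ^ 2 * (R * c 0 R))) R := by
    intro R
    have := (hc 0 R).add ((hasDerivAt_id R).ofReal_comp.mul (hc 1 R))
    refine HasDerivAt.congr_deriv this ?_
    have := p1 R
    simp
    linear_combination this
  have hco : ∀ R : ℝ, HasDerivAt (fun R : ℝ => (Real.cos (ρ * R) : ℂ)) (-(ρ * Real.sin (ρ * R)) : ℂ) R := by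
    intro R
    have := ((Real.hasDerivAt_cos (ρ * R)).comp R ((hasDerivAt_id R).const_mul ρ)).ofReal_comp
    exact HasDerivAt.congr_deriv this (by push_cast; ring)
  have hsi : ∀ R : ℝ, HasDerivAt (fun R : ℝ => (Real.sin (ρ * R) : ℂ)) (ρ * Real.cos (ρ * R) : ℂ) R := by
    intro R
    have := ((Real.hasDerivAt_sin (ρ * R)).comp R ((hasDerivAt_id R).const_mul ρ)).ofReal_comp
    exact HasDerivAt.congr_deriv this (by push_cast; ring)
  have c00 : c 0 0 = 1 := by
    simp [c, ee]
  have hA : ∀ R : ℝ, (c 0 R + R * c 1 R) * Real.cos (ρ * R) + ρ * (R * c 0 R) * Real.sin (ρ * R) = 1 := by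
    have hd : ∀ R : ℝ, HasDerivAt (fun R : ℝ => (c 0 R + R * c 1 R) * Real.cos (ρ * R) +
        ρ * (R * c 0 R) * Real.sin (ρ * R)) 0 R := by
      intro R
      have := ((hu' R).mul (hco R)).add (((hu R).const_mul (ρ : ℂ)).mul (hsi R))
      exact HasDerivAt.congr_deriv this (by ring)
    intro R
    have := is_const_of_deriv_eq_zero (fun R => (hd R).differentiableAt) (fun R => (hd R).deriv) R 0
    simpa [c00] using this
  have hB : ∀ R : ℝ, (c 0 R + R * c 1 R) * Real.sin (ρ * R) - ρ * (R * c 0 R) * Real.cos (ρ * R) = 0 := by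
    have hd : ∀ R : ℝ, HasDerivAt (fun R : ℝ => (c 0 R + R * c 1 R) * Real.sin (ρ * R) -
        ρ * (R * c 0 R) * Real.cos (ρ * R)) 0 R := by
      intro R
      have := ((hu' R).mul (hsi R)).sub (((hu R).const_mul (ρ : ℂ)).mul (hco R))
      exact HasDerivAt.congr_deriv this (by ring)
    intro R
    have := is_const_of_deriv_eq_zero (fun R => (hd R).differentiableAt) (fun R => (hd R).deriv) R 0
    simpa [c00] using this
  have hfin : (ρ : ℂ) * (R * c 0 R) = Real.sin (ρ * R) := by
    have h1 : (Real.sin (ρ * R) : ℂ) ^ 2 + (Real.cos (ρ * R) : ℂ) ^ 2 = 1 := by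
      exact_mod_cast Real.sin_sq_add_cos_sq (ρ * R)
    linear_combination (Real.sin (ρ * R) : ℂ) * hA R - (Real.cos (ρ * R) : ℂ) * hB R - (ρ : ℂ) * (R * c 0 R) * h1
  have hlhs : ∫ k, ee R (k.mulVec x) ∂μ = c 0 R := by simp [c]
  rw [hlhs, sph0]
  split_ifs with h0
  · rcases mul_eq_zero.1 h0 with h | h
    · rw [h, c00]; simp
    · have hz : ∀ᵐ k ∂μ, ((k.mulVec x 2 : ℝ) * Complex.I) ^ 0 * ee R (k.mulVec x) = 1 := by
        refine (haar_ae hμ).mono fun k hk => ?_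
        have := abs_le_nrm3 (k.mulVec x) 2
        rw [nrm3_rot hk, h] at this
        have h3 : (k.mulVec x) 2 = 0 := abs_eq_zero.1 (le_antisymm this (abs_nonneg _))
        simp [ee, h3]
      simp only [c]
      rw [integral_congr_ae hz]; simp
  · have hR : (R : ℂ) * (nrm3 x : ℂ) ≠ 0 := by exact_mod_cast h0
    push_cast
    rw [eq_div_iff hR]
    rw [mul_comm ρ R, hρ] at hfin
    push_cast at hfin
    rw [← hfin]; ring

lemma sph0_int (hμ : IsHaarSO3 μ) (G : 𝓢(V3 × V3, ℂ)) (hG : Inv3 G) (R : ℝ) :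
    ∫ p, G p * (sph0 R p.1 : ℂ) = ∫ p, G p * ee R p.1 := by
  rw [← haar_avg hμ G hG (H := fun p => ee R p.1) ((cont_ee R).comp continuous_fst) (C := 1)
    (fun p => (norm_ee R p.1).le)]
  congr 1; ext1 p
  rw [sinc_avg hμ]

end haar

section hyper
open scoped SchwartzMap

lemma htg_ode1 {E : Type} [NormedAddCommGroup E] [NormedSpace ℝ E] {Q : E → ℂ}
    (hQ : Q.HasTemperateGrowth) {f : E × ℂ → ℂ} (hf : f.HasTemperateGrowth) {Y : E → ℂ} {h : ℂ → ℂ}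
    {h' : E → ℂ} (hY : ∀ x, Y x = h (Q x)) (hh : ∀ x, HasDerivAt h (h' x) (Q x))
    (he : ∀ x, h' x = f (x, Y x)) (hb : PB Y) : Y.HasTemperateGrowth := by
  have hY' : Y = fun x => h (Q x) := funext hY
  refine htg_ode (Φ := fun z : E × ℂ =>
    ((ContinuousLinearMap.compL ℝ E ℂ ℂ).comp (ContinuousLinearMap.mul ℝ ℂ) (f z))
      (fderiv ℝ Q z.1)) ?_ ?_ hb
  · refine ContinuousLinearMap.bilinear_hasTemperateGrowth
      ((ContinuousLinearMap.compL ℝ E ℂ ℂ).comp (ContinuousLinearMap.mul ℝ ℂ)) hf ?_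
    exact (htg_fderiv hQ).comp (ContinuousLinearMap.fst ℝ E ℂ).hasTemperateGrowth
  · intro x
    have h1 := (hh x).complexToReal_fderiv.comp x (htg_diff hQ x).hasFDerivAt
    rw [hY']
    refine h1.congr_fderiv ?_
    ext v
    simp [he, hY]

def tt (θ : ℝ × ℝ) : ℂ := (jw θ.1 : ℝ) - ((2 * Real.pi * θ.2 : ℝ) : ℂ) * Complex.I

lemma tt_re (θ) : (tt θ).re = jw θ.1 := by simp [tt]
lemma tt_im (θ) : (tt θ).im = -(2 * Real.pi * θ.2) := by simp [tt]

lemma htg_fst1 : (fun θ : ℝ × ℝ => θ.1).HasTemperateGrowth :=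
  (ContinuousLinearMap.fst ℝ ℝ ℝ).hasTemperateGrowth
lemma htg_snd1 : (fun θ : ℝ × ℝ => θ.2).HasTemperateGrowth :=
  (ContinuousLinearMap.snd ℝ ℝ ℝ).hasTemperateGrowth

lemma htg_tt : tt.HasTemperateGrowth := by
  refine (htg_ofReal (htg_jw.comp htg_fst1)).sub ((htg_ofReal
    ((Function.HasTemperateGrowth.const (2 * Real.pi)).mul htg_snd1)).mul
    (Function.HasTemperateGrowth.const _))

abbrev Z3 := ℝ × (ℝ × ℝ)

def Qf (z : Z3) : ℂ := tt z.2 * z.1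

lemma htg_Qf : Qf.HasTemperateGrowth :=
  (htg_tt.comp (ContinuousLinearMap.snd ℝ ℝ (ℝ × ℝ)).hasTemperateGrowth).mul
    (htg_ofReal (ContinuousLinearMap.fst ℝ ℝ (ℝ × ℝ)).hasTemperateGrowth)

lemma normSq_cosh (z : ℂ) : ‖Complex.cosh z‖ ^ 2 = Real.sinh z.re ^ 2 + Real.cos z.im ^ 2 := by
  rw [← Complex.normSq_eq_norm_sq]
  conv_lhs => rw [← Complex.re_add_im z, Complex.cosh_add, Complex.cosh_mul_I, Complex.sinh_mul_I]
  rw [← Complex.ofReal_cosh, ← Complex.ofReal_sinh, ← Complex.ofReal_cos, ← Complex.ofReal_sin]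
  rw [Complex.normSq_apply]
  simp only [Complex.add_re, Complex.add_im, Complex.mul_re, Complex.mul_im, Complex.ofReal_re,
    Complex.ofReal_im, Complex.I_re, Complex.I_im, mul_zero, mul_one, sub_zero, zero_mul, add_zero,
    zero_add]
  have h1 := Real.cosh_sq z.re
  have h2 := Real.sin_sq_add_cos_sq z.im
  linear_combination (Real.cos z.im ^ 2) * h1 + (Real.sinh z.re ^ 2) * h2

lemma normSq_sinh (z : ℂ) : ‖Complex.sinh z‖ ^ 2 = Real.sinh z.re ^ 2 + Real.sin z.im ^ 2 := by
  rw [← Complex.normSq_eq_norm_sq]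
  conv_lhs => rw [← Complex.re_add_im z, Complex.sinh_add, Complex.cosh_mul_I, Complex.sinh_mul_I]
  rw [← Complex.ofReal_cosh, ← Complex.ofReal_sinh, ← Complex.ofReal_cos, ← Complex.ofReal_sin]
  rw [Complex.normSq_apply]
  simp only [Complex.add_re, Complex.add_im, Complex.mul_re, Complex.mul_im, Complex.ofReal_re,
    Complex.ofReal_im, Complex.I_re, Complex.I_im, mul_zero, mul_one, sub_zero, zero_mul, add_zero,
    zero_add]
  have h1 := Real.cosh_sq z.re
  have h2 := Real.sin_sq_add_cos_sq z.im
  linear_combination (Real.sin z.im ^ 2) * h1 + (Real.sinh z.re ^ 2) * h2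

def Kf (θ : ℝ × ℝ) : ℝ := 5 * (1 + |θ.1|) * (1 + 2 * Real.pi * |θ.2|)

lemma Kf_pos (θ) : 0 < Kf θ := by unfold Kf; positivity

lemma Kf_le (θ : ℝ × ℝ) : Kf θ ≤ (5 * (1 + 2 * Real.pi)) * (1 + ‖θ‖) ^ 2 := by
  have h1 : |θ.1| ≤ ‖θ‖ := le_max_left _ _
  have h2 : |θ.2| ≤ ‖θ‖ := le_max_right _ _
  have h3 : 1 + 2 * Real.pi * |θ.2| ≤ (1 + 2 * Real.pi) * (1 + ‖θ‖) := by
    have := Real.pi_pos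
    nlinarith [norm_nonneg θ, abs_nonneg θ.2]
  unfold Kf
  calc _ ≤ 5 * (1 + ‖θ‖) * ((1 + 2 * Real.pi) * (1 + ‖θ‖)) := by gcongr
    _ = _ := by ring

lemma cosh_lower (z : Z3) : Real.exp (jw z.2.1 * |z.1|) ≤ Kf z.2 * ‖Complex.cosh (Qf z)‖ := by
  obtain ⟨l, w, τ⟩ := z
  set α := jw w with hα
  set β := 2 * Real.pi * τ with hβ
  have hα0 : 0 < α := jw_pos w
  have hα1 : α ≤ 1 := jw_le_one w
  have hαw : 1 ≤ α * (1 + |w|) := one_le_jw_mul w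
  have hre : (Qf (l, w, τ)).re = α * l := by simp [Qf, tt, hα]
  have him : (Qf (l, w, τ)).im = -(β * l) := by simp [Qf, tt, hβ]
  have hc := normSq_cosh (Qf (l, w, τ))
  rw [hre, him, Real.cos_neg] at hc
  set c := ‖Complex.cosh (Qf (l, w, τ))‖ with hcc
  have hc0 : 0 ≤ c := norm_nonneg _
  have hs : (α * l) ^ 2 ≤ Real.sinh (α * l) ^ 2 := by
    rw [sq_le_sq, Real.abs_sinh]; exact Real.self_le_sinh_iff.2 (abs_nonneg _)
  have h1 : α ^ 2 ≤ c ^ 2 * (4 * (α ^ 2 + β ^ 2)) := by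
    rw [hc]
    by_cases hb : (β * l) ^ 2 ≤ 1 / 4
    · have hcos : 3 / 4 ≤ Real.cos (β * l) ^ 2 := by
        have h2 := Real.sin_sq_add_cos_sq (β * l)
        have h3 : Real.sin (β * l) ^ 2 ≤ (β * l) ^ 2 := Real.sin_sq_le_sq
        linarith
      nlinarith [sq_nonneg α, sq_nonneg β, sq_nonneg (Real.sinh (α * l)),
        mul_nonneg (sq_nonneg (Real.sinh (α * l))) (add_nonneg (sq_nonneg α) (sq_nonneg β)),
        mul_le_mul_of_nonneg_right hcos (add_nonneg (sq_nonneg α) (sq_nonneg β))]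
    · push Not at hb
      have h4 : (α * l) ^ 2 * (4 * (α ^ 2 + β ^ 2)) ≤ (Real.sinh (α * l) ^ 2 + Real.cos (β * l) ^ 2) * (4 * (α ^ 2 + β ^ 2)) := by
        gcongr; nlinarith [sq_nonneg (Real.cos (β * l))]
      refine le_trans ?_ h4
      nlinarith [mul_le_mul_of_nonneg_left hb.le (sq_nonneg α), sq_nonneg (α * l), sq_nonneg (α * l * α)]
  have h2 : Real.cosh (α * l) ^ 2 - 1 ≤ c ^ 2 := by
    rw [hc, Real.cosh_sq]; nlinarith [sq_nonneg (Real.cos (β * l))]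
  have h3 : Real.exp (α * |l|) ≤ 2 * Real.cosh (α * l) := by
    rw [← Real.cosh_abs, abs_mul, abs_of_pos hα0, Real.cosh_eq]
    have := Real.exp_pos (-(α * |l|))
    linarith
  have h5 : 1 ≤ c ^ 2 * (4 + 4 * β ^ 2 * (1 + |w|) ^ 2) := by
    have h6 : (1 : ℝ) ≤ (α * (1 + |w|)) ^ 2 := one_le_pow₀ hαw
    have h7 := mul_le_mul_of_nonneg_right h1 (sq_nonneg (1 + |w|))
    have h8 : α ^ 2 * (c ^ 2 * (4 + 4 * β ^ 2 * (1 + |w|) ^ 2)) ≥ α ^ 2 := by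
      have h9 : β ^ 2 * c ^ 2 ≤ β ^ 2 * c ^ 2 * (α * (1 + |w|)) ^ 2 :=
        le_mul_of_one_le_right (by positivity) h6
      nlinarith
    have h10 : 0 < α ^ 2 := by positivity
    nlinarith
  have h4 : Real.cosh (α * l) ^ 2 ≤ c ^ 2 * (5 + 4 * β ^ 2 * (1 + |w|) ^ 2) := by linarith
  have h6 : Real.exp (α * |l|) ^ 2 ≤ (Kf (w, τ) * c) ^ 2 := by
    have h7 : Real.exp (α * |l|) ^ 2 ≤ 4 * Real.cosh (α * l) ^ 2 := by
      have := pow_le_pow_left₀ (Real.exp_pos _).le h3 2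
      linarith
    have h8 : 4 * (5 + 4 * β ^ 2 * (1 + |w|) ^ 2) ≤ Kf (w, τ) ^ 2 := by
      have : Kf (w, τ) = 5 * (1 + |w|) * (1 + |β|) := by
        simp only [Kf, hβ, abs_mul, abs_of_pos Real.pi_pos, abs_two]
      rw [this]
      have e1 : |β| ^ 2 = β ^ 2 := sq_abs β
      rw [← e1]
      have e2 : (1 : ℝ) ≤ (1 + |w|) ^ 2 := one_le_pow₀ (by linarith [abs_nonneg w])
      nlinarith [abs_nonneg β, sq_nonneg (|β| * (1 + |w|)), mul_nonneg (abs_nonneg β) (sq_nonneg (1 + |w|))]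
    calc _ ≤ 4 * Real.cosh (α * l) ^ 2 := h7
      _ ≤ 4 * (c ^ 2 * (5 + 4 * β ^ 2 * (1 + |w|) ^ 2)) := by gcongr
      _ = (4 * (5 + 4 * β ^ 2 * (1 + |w|) ^ 2)) * c ^ 2 := by ring
      _ ≤ Kf (w, τ) ^ 2 * c ^ 2 := by gcongr
      _ = _ := by ring
  exact (pow_le_pow_iff_left₀ (Real.exp_pos _).le (mul_nonneg (Kf_pos _).le hc0) two_ne_zero).1 h6

lemma cosh_ne (z : Z3) : Complex.cosh (Qf z) ≠ 0 := by
  intro h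
  have := cosh_lower z
  rw [h, norm_zero, mul_zero] at this
  exact absurd this (not_le.2 (Real.exp_pos _))

def Sf (z : Z3) : ℂ := 1 / Complex.cosh (Qf z)
def Tf (z : Z3) : ℂ := Complex.sinh (Qf z) / Complex.cosh (Qf z)

lemma Sf_le (z : Z3) : ‖Sf z‖ ≤ Kf z.2 * Real.exp (-(jw z.2.1 * |z.1|)) := by
  have h1 := cosh_lower z
  have h2 : 0 < ‖Complex.cosh (Qf z)‖ := norm_pos_iff.2 (cosh_ne z)
  rw [Sf, norm_div, norm_one, div_le_iff₀ h2, Real.exp_neg]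
  have h3 := Real.exp_pos (jw z.2.1 * |z.1|)
  rw [show Kf z.2 * (Real.exp (jw z.2.1 * |z.1|))⁻¹ * ‖Complex.cosh (Qf z)‖ =
    (Kf z.2 * ‖Complex.cosh (Qf z)‖) * (Real.exp (jw z.2.1 * |z.1|))⁻¹ by ring]
  rw [← div_eq_mul_inv, le_div_iff₀ h3, one_mul]; exact h1

lemma Sf_le' (z : Z3) : ‖Sf z‖ ≤ Kf z.2 := by
  refine (Sf_le z).trans (mul_le_of_le_one_right (Kf_pos _).le ?_)
  rw [Real.exp_le_one_iff, neg_nonpos]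
  exact mul_nonneg (jw_pos _).le (abs_nonneg _)

lemma pb_Sf : PB Sf := by
  refine ⟨2, 5 * (1 + 2 * Real.pi), by positivity, fun z => (Sf_le' z).trans ((Kf_le _).trans ?_)⟩
  have : ‖z.2‖ ≤ ‖z‖ := le_max_right _ _
  gcongr

lemma Tf_sq (z : Z3) : Sf z ^ 2 = 1 - Tf z ^ 2 := by
  have h := Complex.cosh_sq (Qf z)
  have h0 := cosh_ne z
  simp only [Sf, Tf, div_pow]
  field_simp
  rw [h]; ring

lemma pb_Tf : PB Tf := by
  have h1 : PB (fun z => Sf z * Sf z) := pb_Sf.bilin (ContinuousLinearMap.mul ℝ ℂ) pb_Sf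
  obtain ⟨k, C, hC, h⟩ := h1
  refine ⟨k, 1 + C + 1, by positivity, fun z => ?_⟩
  have h2 := h z
  have h3 : ‖Tf z‖ ^ 2 ≤ 1 + ‖Sf z * Sf z‖ := by
    have : Tf z ^ 2 = 1 - Sf z * Sf z := by rw [← sq, Tf_sq]; ring
    rw [← norm_pow, this]
    refine (norm_sub_le _ _).trans (by simp)
  have h4 : ‖Tf z‖ ≤ 1 + ‖Tf z‖ ^ 2 := by nlinarith [sq_nonneg (‖Tf z‖ - 1)]
  have h5 := one_le_pow₀ (n := k) (one_le_jb z)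
  nlinarith

lemma htg_Tf : Tf.HasTemperateGrowth := by
  refine htg_ode1 htg_Qf (f := fun z => 1 - z.2 * z.2) ?_ (h := fun u => Complex.sinh u / Complex.cosh u)
    (h' := fun z => 1 - Tf z * Tf z) (fun x => rfl) ?_ (fun x => rfl) pb_Tf
  · exact (Function.HasTemperateGrowth.const _).sub
      ((ContinuousLinearMap.snd ℝ Z3 ℂ).hasTemperateGrowth.mul (ContinuousLinearMap.snd ℝ Z3 ℂ).hasTemperateGrowth)
  · intro x
    have := (Complex.hasDerivAt_sinh (Qf x)).div (Complex.hasDerivAt_cosh (Qf x)) (cosh_ne x)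
    refine this.congr_deriv ?_
    have h0 := cosh_ne x
    simp only [Tf]
    field_simp

lemma htg_Sf : Sf.HasTemperateGrowth := by
  refine htg_ode1 htg_Qf (f := fun z => -(z.2 * Tf z.1)) ?_ (h := fun u => 1 / Complex.cosh u)
    (h' := fun z => -(Sf z * Tf z)) (fun x => rfl) ?_ (fun x => rfl) pb_Sf
  · exact ((ContinuousLinearMap.snd ℝ Z3 ℂ).hasTemperateGrowth.mul
      (htg_Tf.comp (ContinuousLinearMap.fst ℝ Z3 ℂ).hasTemperateGrowth)).neg
  · intro x
    have := (hasDerivAt_const (Qf x) (1:ℂ)).div (Complex.hasDerivAt_cosh (Qf x)) (cosh_ne x)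
    refine this.congr_deriv ?_
    have h0 := cosh_ne x
    simp only [Tf, Sf]
    field_simp
    simp

def Bf (z : Z3) : ℂ := ∫ u in (0:ℝ)..1, tt z.2 * Sf (u * z.1, z.2) ^ 2

lemma htg_Bf : Bf.HasTemperateGrowth := by
  refine htg_integral_unit (T := fun y : ℝ × Z3 => tt y.2.2 * Sf (y.1 * y.2.1, y.2.2) ^ 2) ?_
  have h2 : (fun y : ℝ × Z3 => y.2.2).HasTemperateGrowth :=
    ((ContinuousLinearMap.snd ℝ ℝ (ℝ × ℝ)).comp (ContinuousLinearMap.snd ℝ ℝ Z3)).hasTemperateGrowth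
  have h1 : (fun y : ℝ × Z3 => y.2.1).HasTemperateGrowth :=
    ((ContinuousLinearMap.fst ℝ ℝ (ℝ × ℝ)).comp (ContinuousLinearMap.snd ℝ ℝ Z3)).hasTemperateGrowth
  have h0 : (fun y : ℝ × Z3 => y.1).HasTemperateGrowth :=
    (ContinuousLinearMap.fst ℝ ℝ Z3).hasTemperateGrowth
  exact (htg_tt.comp h2).mul ((htg_Sf.comp (htg_pair (h0.mul h1) h2)).pow 2)

lemma Sf_even (a θ) : Sf (-a, θ) = Sf (a, θ) := by
  simp [Sf, Qf]

lemma Bf_even (a θ) : Bf (-a, θ) = Bf (a, θ) := by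
  simp only [Bf, mul_neg, Sf_even]

lemma Sf_zero (θ) : Sf (0, θ) = 1 := by simp [Sf, Qf]

lemma Bf_zero (θ) : Bf (0, θ) = tt θ := by simp [Bf, Sf_zero]

lemma Bf_mul (z : Z3) : (z.1 : ℂ) * Bf z = Tf z := by
  obtain ⟨a, θ⟩ := z
  have hd : ∀ u : ℝ, HasDerivAt (fun u : ℝ => Tf (u * a, θ)) ((a : ℂ) * (tt θ * Sf (u * a, θ) ^ 2)) u := by
    intro u
    have h1 : HasDerivAt (fun u : ℝ => tt θ * ((u * a : ℝ) : ℂ)) (tt θ * a) u := by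
      have := ((hasDerivAt_mul_const (x := u) a).ofReal_comp).const_mul (tt θ)
      exact this
    have h0 := cosh_ne (u * a, θ)
    have h2 := (Complex.hasDerivAt_sinh (Qf (u * a, θ))).div (Complex.hasDerivAt_cosh (Qf (u * a, θ))) h0
    have h3 := HasDerivAt.scomp u h2 h1
    refine HasDerivAt.congr_deriv h3 ?_
    have h := Complex.cosh_sq (Qf (u * a, θ))
    simp only [Sf, smul_eq_mul]
    field_simp
    rw [h]; ring
  have hc : Continuous fun u : ℝ => (a : ℂ) * (tt θ * Sf (u * a, θ) ^ 2) := by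
    have := htg_Sf.1.continuous
    fun_prop
  have := intervalIntegral.integral_eq_sub_of_hasDerivAt (a := 0) (b := 1)
    (fun u _ => hd u) (hc.intervalIntegrable _ _)
  rw [intervalIntegral.integral_const_mul] at this
  simp only [Bf]
  rw [this]
  simp [Tf, Qf]

lemma even_sub {P F : Type} [NormedAddCommGroup P] [NormedSpace ℝ P] [NormedAddCommGroup F]
    [NormedSpace ℝ F] [CompleteSpace F] {g : ℝ × P → F} (hg : g.HasTemperateGrowth)
    (he : ∀ a p, g (-a, p) = g (a, p)) :
    ∃ M : ℝ × P → F, M.HasTemperateGrowth ∧ (∀ a p, M (-a, p) = M (a, p)) ∧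
      ∀ a p, g (a, p) = g (0, p) + a ^ 2 • M (a, p) := by
  obtain ⟨q, hq, hqe, hd⟩ := even_div hg he
  refine ⟨fun z => ∫ s in (0:ℝ)..1, s • q (s * z.1, z.2), ?_, ?_, ?_⟩
  · refine htg_integral_unit (T := fun y : ℝ × (ℝ × P) => y.1 • q (y.1 * y.2.1, y.2.2)) ?_
    have h2 : (fun y : ℝ × (ℝ × P) => y.2.2).HasTemperateGrowth :=
      ((ContinuousLinearMap.snd ℝ ℝ P).comp (ContinuousLinearMap.snd ℝ ℝ (ℝ × P))).hasTemperateGrowth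
    have h1 : (fun y : ℝ × (ℝ × P) => y.2.1).HasTemperateGrowth :=
      ((ContinuousLinearMap.fst ℝ ℝ P).comp (ContinuousLinearMap.snd ℝ ℝ (ℝ × P))).hasTemperateGrowth
    have h0 : (fun y : ℝ × (ℝ × P) => y.1).HasTemperateGrowth :=
      (ContinuousLinearMap.fst ℝ ℝ (ℝ × P)).hasTemperateGrowth
    exact h0.smul (hq.comp (htg_pair (h0.mul h1) h2))
  · intro a p
    simp only [mul_neg, hqe]
  · intro a p
    have h := integral_dOne hg a p
    simp only [hd] at h
    rw [← sub_eq_iff_eq_add', ← h, sq, mul_smul]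
    simp only [mul_comm _ a, mul_smul, intervalIntegral.integral_smul]

end hyper

section sigma
open scoped SchwartzMap

def Mf : Z3 → ℂ := Classical.choose (even_sub htg_Bf Bf_even)
lemma htg_Mf : Mf.HasTemperateGrowth := (Classical.choose_spec (even_sub htg_Bf Bf_even)).1
lemma Mf_even (a p) : Mf (-a, p) = Mf (a, p) :=
  (Classical.choose_spec (even_sub htg_Bf Bf_even)).2.1 a p
lemma Mf_eq (a : ℝ) (θ) : Bf (a, θ) = tt θ + (a : ℂ) ^ 2 * Mf (a, θ) := by
  have := (Classical.choose_spec (even_sub htg_Bf Bf_even)).2.2 a θ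
  rw [this, Bf_zero]
  simp [Mf]

lemma nrm3_eq_norm (x : V3) : nrm3 x = ‖(WithLp.toLp 2 x : EuclideanSpace ℝ (Fin 3))‖ := by
  rw [EuclideanSpace.norm_eq, nrm3]; simp [Fin.sum_univ_three]

abbrev E3 := EuclideanSpace ℝ (Fin 3)

lemma htg_toE3 {E : Type} [NormedAddCommGroup E] [NormedSpace ℝ E] {f : E → V3}
    (hf : f.HasTemperateGrowth) :
    Function.HasTemperateGrowth (fun x => (WithLp.toLp 2 (f x) : E3)) :=
  ((EuclideanSpace.equiv (Fin 3) ℝ).symm : V3 →L[ℝ] E3).hasTemperateGrowth.comp hf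

lemma htg_even3 {E P : Type} [NormedAddCommGroup E] [NormedSpace ℝ E] [NormedAddCommGroup P]
    [NormedSpace ℝ P] {g : ℝ × P → ℂ} (hg : g.HasTemperateGrowth)
    (he : ∀ a p, g (-a, p) = g (a, p)) {v : E → V3} (hv : v.HasTemperateGrowth) {u : E → P}
    (hu : u.HasTemperateGrowth) : Function.HasTemperateGrowth (fun x => g (nrm3 (v x), u x)) := by
  have h1 := htg_even (V := E3) hg he
  have h2 := htg_pair (htg_toE3 hv) hu
  have h3 : (fun x => g (nrm3 (v x), u x)) = (fun z : E3 × P => g (‖z.1‖, z.2)) ∘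
      (fun x => ((WithLp.toLp 2 (v x) : E3), u x)) := by
    funext x; simp only [Function.comp, nrm3_eq_norm]
  rw [h3]
  exact h1.comp h2

lemma htg_proj {E : Type} [NormedAddCommGroup E] [NormedSpace ℝ E] {f : E → V3}
    (hf : f.HasTemperateGrowth) (j : Fin 3) : Function.HasTemperateGrowth (fun x => f x j) :=
  (ContinuousLinearMap.proj (R := ℝ) (φ := fun _ : Fin 3 => ℝ) j).hasTemperateGrowth.comp hf

lemma htg_dot {E : Type} [NormedAddCommGroup E] [NormedSpace ℝ E] {f g : E → V3}
    (hf : f.HasTemperateGrowth) (hg : g.HasTemperateGrowth) :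
    Function.HasTemperateGrowth (fun x => f x ⬝ᵥ g x) := by
  simp only [dotProduct, Fin.sum_univ_three]
  exact (((htg_proj hf 0).mul (htg_proj hg 0)).add ((htg_proj hf 1).mul (htg_proj hg 1))).add
    ((htg_proj hf 2).mul (htg_proj hg 2))

def cr2 (p : V3 × V3) : ℝ := (p.1 ⬝ᵥ p.1) * (p.2 ⬝ᵥ p.2) - (p.1 ⬝ᵥ p.2) ^ 2

lemma cr2_nonneg (p) : 0 ≤ cr2 p := by
  have : cr2 p = (p.1 0 * p.2 1 - p.1 1 * p.2 0) ^ 2 + (p.1 0 * p.2 2 - p.1 2 * p.2 0) ^ 2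
      + (p.1 1 * p.2 2 - p.1 2 * p.2 1) ^ 2 := by
    simp only [cr2, dotProduct, Fin.sum_univ_three]; ring
  rw [this]; positivity

lemma tanh_re (z : ℂ) (h0 : 0 ≤ z.re) (hz : Complex.cosh z ≠ 0) :
    z.re / (1 + z.re) ≤ (Complex.sinh z / Complex.cosh z).re := by
  have hn := normSq_cosh z
  have hp : 0 < ‖Complex.cosh z‖ ^ 2 := by positivity
  have hs : (Complex.sinh z / Complex.cosh z).re
      = Real.sinh z.re * Real.cosh z.re / ‖Complex.cosh z‖ ^ 2 := by
    rw [Complex.div_re, ← add_div, Complex.normSq_eq_norm_sq]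
    congr 1
    conv_lhs => rw [← Complex.re_add_im z, Complex.cosh_add, Complex.sinh_add, Complex.cosh_mul_I,
      Complex.sinh_mul_I]
    rw [← Complex.ofReal_cosh, ← Complex.ofReal_sinh, ← Complex.ofReal_cos, ← Complex.ofReal_sin]
    simp only [Complex.add_re, Complex.add_im, Complex.mul_re, Complex.mul_im, Complex.ofReal_re,
      Complex.ofReal_im, Complex.I_re, Complex.I_im, mul_zero, mul_one, sub_zero, zero_mul,
      add_zero, zero_add]
    have h2 := Real.sin_sq_add_cos_sq z.im
    linear_combination (Real.sinh z.re * Real.cosh z.re) * h2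
  rw [hs, div_le_div_iff₀ (by positivity) hp]
  have h1 := Real.cosh_sq z.re
  have h2 := Real.sin_sq_add_cos_sq z.im
  have h3 : ‖Complex.cosh z‖ ^ 2 ≤ Real.cosh z.re ^ 2 := by
    rw [hn, h1]; nlinarith [sq_nonneg (Real.sin z.im)]
  have h4 : z.re * Real.cosh z.re ≤ Real.sinh z.re * (1 + z.re) := by
    have e1 := Real.self_le_sinh_iff.2 h0
    have e2 := Real.cosh_sub_sinh z.re
    have e3 : Real.exp (-z.re) ≤ 1 := Real.exp_le_one_iff.2 (by linarith)
    nlinarith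
  have h5 := Real.cosh_pos z.re
  calc z.re * ‖Complex.cosh z‖ ^ 2 ≤ z.re * Real.cosh z.re ^ 2 := by gcongr
    _ = (z.re * Real.cosh z.re) * Real.cosh z.re := by ring
    _ ≤ (Real.sinh z.re * (1 + z.re)) * Real.cosh z.re := by gcongr
    _ = _ := by ring

lemma Bf_re {l : ℝ} (hl : 0 < l) (θ : ℝ × ℝ) : jw θ.1 / (1 + l) ≤ (Bf (l, θ)).re := by
  have h1 := Bf_mul (l, θ)
  have hre : (Qf (l, θ)).re = jw θ.1 * l := by simp [Qf, tt]
  have ha := jw_pos θ.1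
  have ha1 := jw_le_one θ.1
  have h2 := tanh_re (Qf (l, θ)) (by rw [hre]; positivity) (cosh_ne _)
  have h3 : l * (Bf (l, θ)).re = (Tf (l, θ)).re := by
    rw [← h1]; simp
  rw [Tf] at h3
  rw [← h3, hre] at h2
  have h4 : jw θ.1 / (1 + jw θ.1 * l) ≤ (Bf (l, θ)).re := by
    rw [div_le_iff₀ (by positivity)] at h2 ⊢
    nlinarith
  refine le_trans ?_ h4
  apply div_le_div_of_nonneg_left ha.le (by positivity)
  nlinarith

abbrev P6 := V3 × V3

/-- exponent -/
def Ef (z : (ℝ × ℝ) × P6) : ℂ :=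
  -(tt z.1 * (z.2.1 ⬝ᵥ z.2.1 : ℝ)) - Mf (nrm3 z.2.2, z.1) * (cr2 z.2 : ℝ)

lemma Ef_re (z : (ℝ × ℝ) × P6) :
    (Ef z).re ≤ -(jw z.1.1 / (1 + nrm3 z.2.2) * nrm3 z.2.1 ^ 2) := by
  obtain ⟨θ, ξ, η⟩ := z
  have ha := jw_pos θ.1
  have hE : (Ef (θ, ξ, η)).re = -(jw θ.1 * nrm3 ξ ^ 2) - (Mf (nrm3 η, θ)).re * cr2 (ξ, η) := by
    simp [Ef, dot_self3, tt_re, ← Complex.ofReal_pow]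
  rw [hE]
  dsimp only
  rcases (nrm3_nonneg η).eq_or_lt with h | h
  · have hc : cr2 (ξ, η) = 0 := by
      have := cr2_nonneg (ξ, η)
      have h2 : cr2 (ξ, η) = - (ξ ⬝ᵥ η) ^ 2 := by
        simp only [cr2, dot_self3 η, ← h]; ring
      nlinarith [sq_nonneg (ξ ⬝ᵥ η)]
    rw [hc, ← h]; simp
  · set l := nrm3 η with hl
    have hB := Bf_re h θ
    have hM : (Bf (l, θ)).re = jw θ.1 + l ^ 2 * (Mf (l, θ)).re := by
      rw [Mf_eq, Complex.add_re, tt_re, ← Complex.ofReal_pow, Complex.re_ofReal_mul]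
    have hcr : cr2 (ξ, η) = nrm3 ξ ^ 2 * l ^ 2 - (ξ ⬝ᵥ η) ^ 2 := by
      simp only [cr2, dot_self3, hl]
    have hcn := cr2_nonneg (ξ, η)
    have ha2 : jw θ.1 / (1 + l) ≤ jw θ.1 := div_le_self ha.le (by linarith)
    have hl2 : 0 < l ^ 2 := by positivity
    set c := jw θ.1 / (1 + l)
    have key : l ^ 2 * (c * nrm3 ξ ^ 2) ≤ l ^ 2 * (jw θ.1 * nrm3 ξ ^ 2 + (Mf (l, θ)).re * cr2 (ξ, η)) := by
      have e1 : l ^ 2 * (jw θ.1 * nrm3 ξ ^ 2 + (Mf (l, θ)).re * cr2 (ξ, η))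
          = jw θ.1 * (ξ ⬝ᵥ η) ^ 2 + (Bf (l, θ)).re * cr2 (ξ, η) := by
        rw [hM, hcr]; ring
      have e2 : l ^ 2 * (c * nrm3 ξ ^ 2) = c * (ξ ⬝ᵥ η) ^ 2 + c * cr2 (ξ, η) := by
        rw [hcr]; ring
      rw [e1, e2]; gcongr
    have := le_of_mul_le_mul_left key hl2
    linarith

def Tσ (z : (ℝ × ℝ) × P6) : ℂ := Sf (nrm3 z.2.2, z.1) * Complex.exp (Ef z)

lemma htg_Tσ : Tσ.HasTemperateGrowth := by
  have h1 : Function.HasTemperateGrowth (fun z : (ℝ × ℝ) × P6 => z.1) :=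
    (ContinuousLinearMap.fst ℝ (ℝ × ℝ) P6).hasTemperateGrowth
  have hξ : Function.HasTemperateGrowth (fun z : (ℝ × ℝ) × P6 => z.2.1) :=
    ((ContinuousLinearMap.fst ℝ V3 V3).comp (ContinuousLinearMap.snd ℝ (ℝ × ℝ) P6)).hasTemperateGrowth
  have hη : Function.HasTemperateGrowth (fun z : (ℝ × ℝ) × P6 => z.2.2) :=
    ((ContinuousLinearMap.snd ℝ V3 V3).comp (ContinuousLinearMap.snd ℝ (ℝ × ℝ) P6)).hasTemperateGrowth
  refine (htg_even3 htg_Sf Sf_even hη h1).mul (htg_cexp_of_le (C := 0) ?_ ?_)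
  · refine (((htg_tt.comp h1).mul (htg_ofReal (htg_dot hξ hξ))).neg).sub
      ((htg_even3 htg_Mf Mf_even hη h1).mul (htg_ofReal ?_))
    exact ((htg_dot hξ hξ).mul (htg_dot hη hη)).sub ((htg_dot hξ hη).pow 2)
  · intro z
    refine (Ef_re z).trans ?_
    have := jw_pos z.1.1
    have := nrm3_nonneg z.2.2
    rw [neg_nonpos]; positivity

lemma norm_le_nrm3 (x : V3) : ‖x‖ ≤ nrm3 x :=
  (pi_norm_le_iff_of_nonneg (nrm3_nonneg x)).2 fun j => abs_le_nrm3 x j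

lemma jb6 (p : P6) : 1 + ‖p‖ ≤ (1 + nrm3 p.1) * (1 + nrm3 p.2) := by
  have h1 := norm_le_nrm3 p.1
  have h2 := norm_le_nrm3 p.2
  have h3 := nrm3_nonneg p.1
  have h4 := nrm3_nonneg p.2
  have : ‖p‖ ≤ nrm3 p.1 + nrm3 p.2 := by
    rw [Prod.norm_def]; exact max_le (by linarith) (by linarith)
  nlinarith [mul_nonneg h3 h4]

lemma Tσ_decay (k : ℕ) : ∃ (N : ℕ) (C : ℝ), 0 ≤ C ∧ ∀ θ p,
      (1 + ‖p‖) ^ k * ‖Tσ (θ, p)‖ ≤ C * (1 + ‖θ‖) ^ N := by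
  refine ⟨3 * k + 2, 2 ^ k * (k.factorial * Real.exp 1) * ((2 * k).factorial * Real.exp 1) *
    (5 * (1 + 2 * Real.pi)), by have := Real.pi_pos; positivity, fun θ p => ?_⟩
  obtain ⟨ξ, η⟩ := p
  set l := nrm3 η with hl
  set x := nrm3 ξ with hx
  have hl0 : 0 ≤ l := nrm3_nonneg η
  have hx0 : 0 ≤ x := nrm3_nonneg ξ
  set a := jw θ.1 with ha
  have ha0 : 0 < a := jw_pos θ.1
  have ha1 : a ≤ 1 := jw_le_one θ.1
  have hw : |θ.1| ≤ ‖θ‖ := le_max_left _ _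
  have hj : (1:ℝ) ≤ 1 + ‖θ‖ := by linarith [norm_nonneg θ]
  set c := a / (1 + l) with hc
  have hc0 : 0 < c := by positivity
  have hc1 : c ≤ 1 := by rw [hc, div_le_one (by positivity)]; linarith
  have hT : ‖Tσ (θ, ξ, η)‖ ≤ (Kf θ * Real.exp (-(a * l))) * Real.exp (-(c * x ^ 2)) := by
    rw [Tσ, norm_mul, Complex.norm_exp]
    have h1 := Sf_le (l, θ)
    have h2 := Ef_re (θ, ξ, η)
    rw [abs_of_nonneg (show 0 ≤ ((l, θ) : Z3).1 from hl0)] at h1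
    gcongr
    exact (norm_nonneg _).trans h1
  have e1 := exp_decay_a k hc0 hc1 (sq_nonneg x)
  have e2 := exp_decay_jw (2 * k) θ.1 hl0
  have e3 : (1 + x) ^ k ≤ 2 ^ k * (1 + x ^ 2) ^ k := by
    rw [← mul_pow]; gcongr; nlinarith [sq_nonneg (x - 1), sq_nonneg x]
  have e4 : (1 / c) ^ k ≤ (1 + l) ^ k * (1 + ‖θ‖) ^ k := by
    rw [← mul_pow]
    have := inv_jw_le θ.1
    have h5 : 1 / c = (1 + l) * (1 / a) := by rw [hc]; field_simp
    rw [h5]; gcongr; exact this.trans (by linarith)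
  have e5 : (1 + ‖((ξ, η) : P6)‖) ^ k ≤ (1 + x) ^ k * (1 + l) ^ k := by
    rw [← mul_pow]; gcongr; exact jb6 (ξ, η)
  have e6 : (1 + |θ.1|) ^ (2 * k) ≤ (1 + ‖θ‖) ^ (2 * k) := by gcongr
  have eK := Kf_le θ
  have hK := Kf_pos θ
  have hp := Real.pi_pos
  calc (1 + ‖((ξ, η) : P6)‖) ^ k * ‖Tσ (θ, ξ, η)‖
      ≤ ((2 ^ k * (1 + x ^ 2) ^ k) * (1 + l) ^ k) *
        ((Kf θ * Real.exp (-(a * l))) * Real.exp (-(c * x ^ 2))) := by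
        gcongr; exact e5.trans (by gcongr)
    _ = 2 ^ k * ((1 + x ^ 2) ^ k * Real.exp (-(c * x ^ 2))) * (1 + l) ^ k *
        (Kf θ * Real.exp (-(a * l))) := by ring
    _ ≤ 2 ^ k * (((1 + l) ^ k * (1 + ‖θ‖) ^ k) * (k.factorial * Real.exp 1)) * (1 + l) ^ k *
        (Kf θ * Real.exp (-(a * l))) := by
        refine mul_le_mul_of_nonneg_right (mul_le_mul_of_nonneg_right (mul_le_mul_of_nonneg_left
          (e1.trans ?_) (by positivity)) (by positivity)) (by positivity)
        gcongr
    _ = 2 ^ k * (k.factorial * Real.exp 1) * (1 + ‖θ‖) ^ k * Kf θ *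
        ((1 + l) ^ (2 * k) * Real.exp (-(a * l))) := by ring
    _ ≤ 2 ^ k * (k.factorial * Real.exp 1) * (1 + ‖θ‖) ^ k * ((5 * (1 + 2 * Real.pi)) * (1 + ‖θ‖) ^ 2) *
        ((1 + ‖θ‖) ^ (2 * k) * ((2 * k).factorial * Real.exp 1)) := by
        refine mul_le_mul (mul_le_mul_of_nonneg_left eK (by positivity)) (e2.trans ?_)
          (by positivity) (by positivity)
        gcongr
    _ = _ := by ring

lemma Tσ_rot {k : Mat3} (hk : k ∈ SO3) (θ x y) :
    Tσ (θ, k.mulVec x, k.mulVec y) = Tσ (θ, x, y) := by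
  simp only [Tσ, Ef, cr2, nrm3_rot hk, so3_dot hk]

lemma Tσ_zero (θ x) : Tσ (θ, x, 0) = Complex.exp (-(tt θ * (nrm3 x ^ 2 : ℝ))) := by
  have : nrm3 0 = 0 := by simp [nrm3]
  simp only [Tσ, Ef, cr2, this, Sf_zero, dot_self3]
  simp

lemma f0_rep (f0 : 𝓢(ℝ, ℂ)) : ∃ m : ℝ × ℝ → ℂ, Mom volume m ∧
    ∀ s, f0 s = ∫ θ, m θ * Complex.exp (-(tt θ * (s : ℝ))) := by
  obtain ⟨m, hm, h⟩ := wlemma f0 id Function.HasTemperateGrowth.id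
  refine ⟨m, hm, fun s => ?_⟩
  rw [h]; congr 1; ext1 z
  congr 2
  simp only [tt]
  push_cast
  simp
  ring

end sigma

section fzero
open scoped SchwartzMap

lemma two_pi_ne : (2 * Real.pi : ℝ) ≠ 0 := by have := Real.pi_pos; positivity

def sc6 : P6 ≃L[ℝ] P6 :=
  ContinuousLinearEquiv.equivOfInverse ((2 * Real.pi) • ContinuousLinearMap.id ℝ P6)
    ((2 * Real.pi)⁻¹ • ContinuousLinearMap.id ℝ P6)
    (fun x => by
      show (2 * Real.pi)⁻¹ • ((2 * Real.pi) • x) = x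
      rw [smul_smul, inv_mul_cancel₀ two_pi_ne, one_smul])
    (fun x => by
      show (2 * Real.pi) • ((2 * Real.pi)⁻¹ • x) = x
      rw [smul_smul, mul_inv_cancel₀ two_pi_ne, one_smul])

lemma sc6_apply (q : P6) : sc6 q = ((2 * Real.pi) • q.1, (2 * Real.pi) • q.2) := rfl

lemma F0_exists {m : ℝ × ℝ → ℂ} (hm : Mom volume m) : ∃ F0 : 𝓢(P6, ℂ), Inv3 F0 ∧
    ∀ q : P6, FT F0 q = ∫ θ, m θ * Tσ (θ, ((2 * Real.pi) • q.1, (2 * Real.pi) • q.2)) := by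
  obtain ⟨S, hS⟩ := master hm htg_Tσ Tσ_decay
  let S' := SchwartzMap.compCLMOfContinuousLinearEquiv ℝ sc6 S
  have hS' : ∀ q : P6, S' q = ∫ θ, m θ * Tσ (θ, ((2 * Real.pi) • q.1, (2 * Real.pi) • q.2)) := by
    intro q
    have : S' q = S (sc6 q) := rfl
    rw [this, hS, sc6_apply]
  refine ⟨FTI S', FTI_inv ?_, fun q => by rw [FT_FTI, hS']⟩
  intro k hk x y
  rw [hS', hS']
  congr 1; ext1 θ
  simp only [← mulVec_smul, Tσ_rot hk]

def e3v (a : ℝ) : V3 := Pi.single 2 a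

lemma FT_ee (G : 𝓢(P6, ℂ)) (R : ℝ) :
    ∫ p : P6, G p * ee R p.1 = FT G (e3v (-(R / (2 * Real.pi))), 0) := by
  rw [FT_apply]; congr 1; ext1 p
  rw [mul_comm, ee]
  congr 3
  simp only [dt, e3v, dotProduct_single, dotProduct_zero]
  congr 1
  have := Real.pi_pos
  field_simp
  ring

lemma nrm3_e3v (a : ℝ) : nrm3 (e3v a) ^ 2 = a ^ 2 := by
  rw [nrm3_sq]; simp [e3v]

lemma F0_sing {m : ℝ × ℝ → ℂ} (f0 : 𝓢(ℝ, ℂ))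
    (hf0 : ∀ s, f0 s = ∫ θ, m θ * Complex.exp (-(tt θ * (s : ℝ)))) (F0 : 𝓢(P6, ℂ))
    (hF0 : ∀ q : P6, FT F0 q = ∫ θ, m θ * Tσ (θ, ((2 * Real.pi) • q.1, (2 * Real.pi) • q.2))) (x : V3) :
    FT F0 (x, 0) = f0 (nrm3 ((2 * Real.pi) • x) ^ 2) := by
  rw [hF0, hf0]
  simp only [smul_zero, Tσ_zero]

lemma smul_e3v (c a : ℝ) : c • e3v a = e3v (c * a) := by
  simp [e3v, ← Pi.single_smul]

lemma F0_ee {m : ℝ × ℝ → ℂ} (f0 : 𝓢(ℝ, ℂ))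
    (hf0 : ∀ s, f0 s = ∫ θ, m θ * Complex.exp (-(tt θ * (s : ℝ)))) (F0 : 𝓢(P6, ℂ))
    (hF0 : ∀ q : P6, FT F0 q = ∫ θ, m θ * Tσ (θ, ((2 * Real.pi) • q.1, (2 * Real.pi) • q.2))) (R : ℝ) :
    ∫ p : P6, F0 p * ee R p.1 = f0 (R ^ 2) := by
  rw [FT_ee, F0_sing f0 hf0 F0 hF0, smul_e3v, nrm3_e3v]
  congr 1
  have := Real.pi_pos
  field_simp

lemma rot_e3 (a : ℝ) : (r13 Real.pi).mulVec (e3v a) = e3v (-a) := by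
  ext i
  fin_cases i <;> simp [r13, e3v, Matrix.mulVec, dotProduct, Pi.single_apply]

def emb3 : ℝ →L[ℝ] P6 :=
  (ContinuousLinearMap.inl ℝ V3 V3).comp
    ((ContinuousLinearMap.single ℝ (fun _ : Fin 3 => ℝ) 2).comp
      ((-(2 * Real.pi)⁻¹) • ContinuousLinearMap.id ℝ ℝ))

lemma emb3_apply (R : ℝ) : emb3 R = (e3v (-(R / (2 * Real.pi))), 0) := by
  simp only [emb3, e3v, ContinuousLinearMap.comp_apply]
  simp
  ring_nf

lemma f0_exists (F : 𝓢(P6, ℂ)) (hF : Inv3 F) :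
    ∃ f0 : 𝓢(ℝ, ℂ), ∀ R, f0 (R ^ 2) = ∫ p : P6, F p * ee R p.1 := by
  have hanti : AntilipschitzWith ⟨2 * Real.pi, by have := Real.pi_pos; positivity⟩ emb3 := by
    refine emb3.antilipschitz_of_bound fun x => ?_
    rw [emb3_apply, Prod.norm_def]
    have h1 : ‖e3v (-(x / (2 * Real.pi)))‖ = |x| / (2 * Real.pi) := by
      rw [e3v, Pi.norm_single, norm_neg, norm_div, Real.norm_eq_abs, Real.norm_eq_abs,
        abs_of_pos (by have := Real.pi_pos; positivity : 0 < 2 * Real.pi)]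
    have h2 : ‖x‖ = (2 * Real.pi) * (|x| / (2 * Real.pi)) := by
      have := Real.pi_pos
      rw [Real.norm_eq_abs]; field_simp
    rw [h2]
    refine mul_le_mul_of_nonneg_left ?_ (by have := Real.pi_pos; positivity)
    rw [← h1]; exact le_max_left _ _
  let h := SchwartzMap.compCLMOfAntilipschitz ℝ emb3.hasTemperateGrowth hanti (FT F)
  have hh : ∀ R, h R = FT F (e3v (-(R / (2 * Real.pi))), 0) := by
    intro R
    have : h R = FT F (emb3 R) := rfl
    rw [this, emb3_apply]
  obtain ⟨f0, hf0⟩ := even_root h (fun R => by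
    rw [hh, hh, ← FT_inv hF (r13 Real.pi) (r13_mem _), rot_e3, mulVec_zero]
    congr 3; ring)
  exact ⟨f0, fun R => by rw [hf0, hh, FT_ee]⟩

end fzero

section laguerre
open scoped SchwartzMap

lemma lag_eq (l : ℕ) (u : ℝ) : lag l u = Real.exp (-(u / 2)) *
    ∑ k ∈ Finset.range (l + 1), (l.choose k : ℝ) * ((-u) ^ k / k.factorial) := by
  rw [lag, ← iteratedDeriv_eq_iterate]
  have h1 : ∀ n : ℕ, iteratedDeriv n (fun v : ℝ => Real.exp (-v)) u = (-1) ^ n * Real.exp (-u) := by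
    intro n
    have := iteratedDeriv_comp_neg n Real.exp u
    rw [iteratedDeriv_eq_iterate (f := Real.exp), Real.iter_deriv_exp, smul_eq_mul] at this
    exact this
  have h2 := iteratedDeriv_fun_mul (n := l) (x := u) (f := fun v : ℝ => v ^ l)
    (g := fun v : ℝ => Real.exp (-v)) (by fun_prop) (by fun_prop)
  have hpw : ∀ n : ℕ, iteratedDeriv n (fun v : ℝ => v ^ l) u = l.descFactorial n * u ^ (l - n) :=
    fun n => iteratedDeriv_pow l n
  rw [h2, ← Finset.sum_range_reflect, Finset.mul_sum, Finset.mul_sum]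
  refine Finset.sum_congr rfl fun k hk => ?_
  have hk' : k ≤ l := Nat.lt_succ_iff.1 (Finset.mem_range.1 hk)
  have e1 : l + 1 - 1 - k = l - k := by omega
  have e2 : l - (l - k) = k := by omega
  rw [e1, h1, hpw, e2, Nat.choose_symm hk']
  have h3 : (l.descFactorial (l - k) : ℝ) = l.factorial / k.factorial := by
    have := Nat.factorial_mul_descFactorial (Nat.sub_le l k)
    rw [e2] at this
    rw [eq_div_iff (by positivity), ← this]; push_cast; ring
  rw [h3]
  have h4 : Real.exp (-(u / 2)) = Real.exp (u / 2) * Real.exp (-u) := by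
    rw [← Real.exp_add]; congr 1; ring
  rw [h4]
  have : (l.factorial : ℝ) ≠ 0 := by positivity
  have h5 : (-u) ^ k = (-1) ^ k * u ^ k := neg_pow u k
  rw [h5]
  field_simp

lemma laplace_integrable (k : ℕ) {c : ℂ} (hc : 0 < c.re) :
    IntegrableOn (fun y : ℝ => (y : ℂ) ^ k * Complex.exp (-(c * y))) (Set.Ioi 0) := by
  have h := integrableOn_rpow_mul_exp_neg_mul_rpow (s := k) (p := 1) (b := c.re)
    (by have : (0:ℝ) ≤ k := by positivity
        linarith) one_pos hc
  refine Integrable.mono' h (by fun_prop) ?_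
  filter_upwards [ae_restrict_mem measurableSet_Ioi] with y hy
  have hy' : (0:ℝ) < y := hy
  rw [norm_mul, Complex.norm_exp, norm_pow, Complex.norm_real, Real.norm_of_nonneg hy'.le]
  simp

lemma laplace_int (k : ℕ) {c : ℂ} (hc : 0 < c.re) :
    ∫ y in Set.Ioi (0:ℝ), (y : ℂ) ^ k * Complex.exp (-(c * y)) = k.factorial / c ^ (k + 1) := by
  have hc0 : c ≠ 0 := by rintro rfl; simp at hc
  have hder : ∀ (n : ℕ) (y : ℝ), HasDerivAt (fun y : ℝ => (y : ℂ) ^ n * Complex.exp (-(c * y)))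
      (n * (y : ℂ) ^ (n - 1) * Complex.exp (-(c * y)) - c * ((y : ℂ) ^ n * Complex.exp (-(c * y)))) y := by
    intro n y
    have e1 : HasDerivAt (fun y : ℝ => (y : ℂ)) 1 y := Complex.ofRealCLM.hasDerivAt
    have e2 := e1.fun_pow n
    have e3 := (e1.const_mul c).fun_neg.cexp
    exact (e2.fun_mul e3).congr_deriv (by ring)
  have hlim : ∀ n : ℕ, Filter.Tendsto (fun y : ℝ => (y : ℂ) ^ n * Complex.exp (-(c * y)))
      Filter.atTop (nhds 0) := by
    intro n
    rw [tendsto_zero_iff_norm_tendsto_zero]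
    refine (tendsto_rpow_mul_exp_neg_mul_atTop_nhds_zero n c.re hc).congr' ?_
    filter_upwards [Filter.eventually_gt_atTop 0] with y hy
    rw [norm_mul, Complex.norm_exp, norm_pow, Complex.norm_real, Real.norm_of_nonneg hy.le]
    simp
  induction k with
  | zero =>
    have h := integral_Ioi_of_hasDerivAt_of_tendsto' (a := 0) (fun x _ => hder 0 x)
      (by simpa [IntegrableOn] using (laplace_integrable 0 hc).const_mul (-c)) (hlim 0)
    simp only [Nat.cast_zero, zero_mul, zero_sub, pow_zero, one_mul] at h
    rw [integral_neg, integral_const_mul] at h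
    simp at h
    simp only [pow_zero, one_mul, zero_add, pow_one, Nat.factorial_zero, Nat.cast_one]
    rw [eq_div_iff hc0, mul_comm]; exact h
  | succ k ih =>
    have i1 := (laplace_integrable k hc).const_mul ((k : ℂ) + 1)
    have i2 := (laplace_integrable (k + 1) hc).const_mul c
    have h := integral_Ioi_of_hasDerivAt_of_tendsto' (a := 0)
      (f' := fun y : ℝ => ((k : ℂ) + 1) * ((y : ℂ) ^ k * Complex.exp (-(c * y))) -
        c * ((y : ℂ) ^ (k + 1) * Complex.exp (-(c * y))))
      (fun x _ => (hder (k + 1) x).congr_deriv (by push_cast; simp; ring)) (i1.sub i2) (hlim (k + 1))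
    rw [integral_sub i1 i2, integral_const_mul, integral_const_mul, ih] at h
    simp at h
    rw [eq_div_iff (by positivity), Nat.factorial_succ]
    push_cast
    have h' := sub_eq_zero.1 h
    rw [pow_succ, mul_comm (c ^ (k + 1)) c, ← mul_assoc, mul_comm _ c, ← h']
    field_simp

lemma gauss_mom (k : ℕ) {c : ℂ} (hc : 0 < c.re) :
    ∫ z : ℂ, ((‖z‖ ^ 2 : ℝ) : ℂ) ^ k * Complex.exp (-(c * (‖z‖ ^ 2 : ℝ)))
      = Real.pi * k.factorial / c ^ (k + 1) := by
  have h1 := integral_fun_norm_addHaar (volume : Measure ℂ)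
    (fun y : ℝ => ((y ^ 2 : ℝ) : ℂ) ^ k * Complex.exp (-(c * (y ^ 2 : ℝ))))
  rw [h1]
  have h2 := integral_comp_rpow_Ioi (fun y : ℝ => (y : ℂ) ^ k * Complex.exp (-(c * y)))
    (p := 2) (by norm_num)
  have h4 := laplace_int k hc
  have h5 : ∫ y in Set.Ioi (0:ℝ), y ^ (Module.finrank ℝ ℂ - 1) •
      (((y ^ 2 : ℝ) : ℂ) ^ k * Complex.exp (-(c * (y ^ 2 : ℝ)))) = (1/2 : ℂ) * (k.factorial / c ^ (k + 1)) := by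
    rw [← h4, ← h2, ← integral_const_mul]
    refine setIntegral_congr_fun measurableSet_Ioi fun y hy => ?_
    have : y ^ (2 - 1 : ℝ) = y := by norm_num
    simp only [Complex.finrank_real_complex, this, Real.rpow_two]
    simp
    ring
  rw [h5]
  simp [Measure.real, Complex.volume_ball]
  ring

end laguerre

section laguerre2
open scoped SchwartzMap FourierTransform

lemma rd_mul {E : Type} [NormedAddCommGroup E] {f g : E → ℂ} (hf : RD f) (hg : PB g) :
    RD (fun x => g x * f x) := by
  intro k
  obtain ⟨n, C, hC, h⟩ := hg
  obtain ⟨D, hD, h'⟩ := hf (k + n)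
  refine ⟨C * D, by positivity, fun x => ?_⟩
  rw [norm_mul]
  calc (1 + ‖x‖) ^ k * (‖g x‖ * ‖f x‖) ≤ (1 + ‖x‖) ^ k * ((C * (1 + ‖x‖) ^ n) * ‖f x‖) := by
        gcongr; exact h x
    _ = C * ((1 + ‖x‖) ^ (k + n) * ‖f x‖) := by ring
    _ ≤ C * D := by gcongr; exact h' x

lemma htg_nsq : Function.HasTemperateGrowth (fun z : ℂ => ((‖z‖ ^ 2 : ℝ) : ℂ)) :=
  htg_ofReal (by
    have : (fun z : ℂ => ‖z‖ ^ 2) = fun z : ℂ => z.re * z.re + z.im * z.im := by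
      ext z; rw [← Complex.normSq_eq_norm_sq, Complex.normSq_apply]
    rw [this]
    have h1 := Complex.reCLM.hasTemperateGrowth
    have h2 := Complex.imCLM.hasTemperateGrowth
    exact (h1.mul h1).add (h2.mul h2))

lemma re_mul_nsq (c : ℂ) (z : ℂ) : (-(c * (‖z‖ ^ 2 : ℝ))).re = -(c.re * ‖z‖ ^ 2) := by
  rw [Complex.neg_re, Complex.re_mul_ofReal]

lemma htg_gauss {c : ℂ} (hc : 0 < c.re) :
    Function.HasTemperateGrowth (fun z : ℂ => Complex.exp (-(c * (‖z‖ ^ 2 : ℝ)))) := by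
  refine htg_cexp_of_le (C := 0) (((Function.HasTemperateGrowth.const c).mul htg_nsq).neg) fun z => ?_
  rw [re_mul_nsq, neg_nonpos]; positivity

lemma rd_gauss {c : ℂ} (hc : 0 < c.re) :
    RD (fun z : ℂ => Complex.exp (-(c * (‖z‖ ^ 2 : ℝ)))) := by
  intro k
  refine ⟨2 ^ k * ((1 / (min c.re 1)) ^ k * (k.factorial * Real.exp 1)), by positivity, fun z => ?_⟩
  rw [Complex.norm_exp, re_mul_nsq]
  set x := ‖z‖
  have hx : 0 ≤ x := norm_nonneg z
  have e3 : (1 + x) ^ k ≤ 2 ^ k * (1 + x ^ 2) ^ k := by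
    rw [← mul_pow]; gcongr; nlinarith [sq_nonneg (x - 1), sq_nonneg x]
  have h := exp_decay_a k (a := min c.re 1) (d := x ^ 2) (by positivity) (min_le_right _ _) (by positivity)
  calc (1 + x) ^ k * Real.exp (-(c.re * x ^ 2))
      ≤ (2 ^ k * (1 + x ^ 2) ^ k) * Real.exp (-((min c.re 1) * x ^ 2)) := by
        gcongr; exact min_le_left _ _
    _ = 2 ^ k * ((1 + x ^ 2) ^ k * Real.exp (-((min c.re 1) * x ^ 2))) := by ring
    _ ≤ _ := by gcongr

def gaussS (c : ℂ) (hc : 0 < c.re) : 𝓢(ℂ, ℂ) := mkSchwartz _ (htg_gauss hc) (rd_gauss hc)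
lemma gaussS_apply (c : ℂ) (hc : 0 < c.re) (z : ℂ) :
    gaussS c hc z = Complex.exp (-(c * (‖z‖ ^ 2 : ℝ))) := rfl

def pol (lam : ℝ) (l : ℕ) (z : ℂ) : ℂ := ∑ k ∈ Finset.range (l + 1),
  (l.choose k : ℂ) * ((-(lam / 2)) ^ k / k.factorial) * ((‖z‖ ^ 2 : ℝ) : ℂ) ^ k

lemma htg_pol (lam : ℝ) (l : ℕ) : (pol lam l).HasTemperateGrowth := by
  unfold pol
  exact Function.HasTemperateGrowth.sum fun k _ => (Function.HasTemperateGrowth.const _).mul (htg_nsq.pow k)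

lemma lag_pol (lam : ℝ) (l : ℕ) (z : ℂ) : ((lag l (lam / 2 * ‖z‖ ^ 2) : ℝ) : ℂ) =
    pol lam l z * Complex.exp (-(((lam / 4 : ℝ) : ℂ) * (‖z‖ ^ 2 : ℝ))) := by
  rw [lag_eq, pol]
  push_cast
  rw [mul_comm]
  congr 1
  · refine Finset.sum_congr rfl fun k _ => ?_
    rw [neg_pow, neg_pow ((lam : ℂ) / 2), mul_pow]; ring
  · congr 1; ring

lemma lag_gauss {lam : ℝ} (hlam : 0 < lam) (l : ℕ) {c : ℂ} (hc : 0 < c.re) :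
    ∫ z : ℂ, ((lag l (lam / 2 * ‖z‖ ^ 2) : ℝ) : ℂ) * Complex.exp (-(c * (‖z‖ ^ 2 : ℝ)))
      = Real.pi * (c - lam / 4) ^ l / (c + lam / 4) ^ (l + 1) := by
  set d : ℂ := c + lam / 4 with hd
  have hdre : 0 < d.re := by
    have : d.re = c.re + lam / 4 := by simp [hd]
    rw [this]; positivity
  have hd0 : d ≠ 0 := by rintro h; rw [h] at hdre; simp at hdre
  have hi : ∀ k : ℕ, Integrable (fun z : ℂ => ((‖z‖ ^ 2 : ℝ) : ℂ) ^ k * Complex.exp (-(d * (‖z‖ ^ 2 : ℝ)))) := by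
    intro k
    by_contra h
    have h1 := gauss_mom k hdre
    rw [integral_undef h] at h1
    have : (Real.pi * k.factorial / d ^ (k + 1) : ℂ) ≠ 0 := by
      have := Real.pi_pos
      refine div_ne_zero (mul_ne_zero ?_ ?_) (pow_ne_zero _ hd0)
      · exact_mod_cast this.ne'
      · exact_mod_cast k.factorial_ne_zero
    exact this h1.symm
  have e : ∀ z : ℂ, ((lag l (lam / 2 * ‖z‖ ^ 2) : ℝ) : ℂ) * Complex.exp (-(c * (‖z‖ ^ 2 : ℝ))) =
      ∑ k ∈ Finset.range (l + 1), ((l.choose k : ℂ) * ((-(lam / 2)) ^ k / k.factorial)) *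
        (((‖z‖ ^ 2 : ℝ) : ℂ) ^ k * Complex.exp (-(d * (‖z‖ ^ 2 : ℝ)))) := by
    intro z
    rw [lag_pol, mul_assoc, ← Complex.exp_add, pol, Finset.sum_mul]
    refine Finset.sum_congr rfl fun k _ => ?_
    rw [mul_assoc (_ * _)]
    congr 3
    rw [hd]; push_cast; ring
  simp_rw [e]
  rw [integral_finsetSum _ fun k _ => (hi k).const_mul _]
  simp_rw [integral_const_mul, gauss_mom _ hdre]
  have hcd : c - lam / 4 = -(lam / 2) + d := by rw [hd]; ring
  rw [hcd, add_pow, Finset.mul_sum, Finset.sum_div]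
  refine Finset.sum_congr rfl fun k hk => ?_
  have hk' : k ≤ l := Nat.lt_succ_iff.1 (Finset.mem_range.1 hk)
  have hf : (k.factorial : ℂ) ≠ 0 := by exact_mod_cast k.factorial_ne_zero
  have hp : d ^ (l + 1) = d ^ (l - k) * d ^ (k + 1) := by rw [← pow_add]; congr 1; omega
  rw [hp]
  have h1 : d ^ (l - k) ≠ 0 := pow_ne_zero _ hd0
  have h2 : d ^ (k + 1) ≠ 0 := pow_ne_zero _ hd0
  field_simp

def ellS (lam : ℝ) (hlam : 0 < lam) (l : ℕ) : 𝓢(ℂ, ℂ) :=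
  mkSchwartz (fun z => pol lam l z * Complex.exp (-(((lam / 4 : ℝ) : ℂ) * (‖z‖ ^ 2 : ℝ))))
    ((htg_pol lam l).mul (htg_gauss (by rw [Complex.ofReal_re]; positivity)))
    (rd_mul (rd_gauss (by rw [Complex.ofReal_re]; positivity)) (htg_pb (htg_pol lam l)))

lemma ellS_apply (lam : ℝ) (hlam : 0 < lam) (l : ℕ) (z : ℂ) :
    ellS lam hlam l z = ((lag l (lam / 2 * ‖z‖ ^ 2) : ℝ) : ℂ) := by
  rw [lag_pol]; rfl

lemma ell_hat {lam : ℝ} (hlam : 0 < lam) (l : ℕ) {B : ℂ} (hB : 0 < B.re) :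
    ∫ ζ : ℂ, 𝓕 (ellS lam hlam l) ζ * Complex.exp (-((4 * Real.pi ^ 2 * B) * (‖ζ‖ ^ 2 : ℝ)))
      = (1 / (4 * B)) * ((1 / (4 * B)) - lam / 4) ^ l / ((1 / (4 * B)) + lam / 4) ^ (l + 1) := by
  have hpi := Real.pi_pos
  have hpi' : (Real.pi : ℂ) ≠ 0 := by exact_mod_cast hpi.ne'
  have hb : 0 < (4 * Real.pi ^ 2 * B : ℂ).re := by
    have : (4 * Real.pi ^ 2 * B : ℂ) = ((4 * Real.pi ^ 2 : ℝ) : ℂ) * B := by push_cast; ring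
    rw [this, Complex.re_ofReal_mul]; positivity
  have hB0 : B ≠ 0 := by rintro rfl; simp at hB
  have hc : 0 < (1 / (4 * B)).re := by
    have : (1 / (4 * B) : ℂ) = ((1 / 4 : ℝ) : ℂ) * B⁻¹ := by push_cast; field_simp
    rw [this, Complex.re_ofReal_mul, Complex.inv_re]
    have := Complex.normSq_pos.2 hB0
    positivity
  have h1 := SchwartzMap.integral_fourier_mul_eq (ellS lam hlam l) (gaussS _ hb)
  simp only [gaussS_apply] at h1
  rw [h1]
  have h2 : ∀ z : ℂ, 𝓕 (gaussS _ hb) z = (1 / (4 * Real.pi * B)) * Complex.exp (-((1 / (4 * B)) * (‖z‖ ^ 2 : ℝ))) := by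
    intro z
    have h3 := fourier_gaussian_innerProductSpace hb z
    rw [SchwartzMap.fourier_coe]
    have h4 : (gaussS _ hb : ℂ → ℂ) = fun v : ℂ => cexp (-(4 * Real.pi ^ 2 * B) * ‖v‖ ^ 2) := by
      ext v; rw [gaussS_apply]; push_cast; congr 1; ring
    rw [h4, h3, Complex.finrank_real_complex]
    have e1 : (((2 : ℕ) : ℂ) / 2) = 1 := by norm_num
    rw [e1, Complex.cpow_one]
    congr 1
    · field_simp
    · congr 1; push_cast; field_simp
  have h5 : ∀ z : ℂ, ellS lam hlam l z * 𝓕 (gaussS _ hb) z = (1 / (4 * Real.pi * B)) *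
    (((lag l (lam / 2 * ‖z‖ ^ 2) : ℝ) : ℂ) * Complex.exp (-((1 / (4 * B)) * (‖z‖ ^ 2 : ℝ)))) := by
    intro z; rw [h2, ellS_apply]; ring
  simp_rw [h5]
  rw [integral_const_mul, lag_gauss hlam l hc]
  field_simp

lemma ell_alg {lam : ℝ} (hlam : 0 < lam) (l : ℕ) (θ : ℝ × ℝ) :
    Sf (lam, θ) * ∫ ζ : ℂ, 𝓕 (ellS lam hlam l) ζ *
      Complex.exp (-((4 * Real.pi ^ 2 * Bf (lam, θ)) * (‖ζ‖ ^ 2 : ℝ)))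
      = Complex.exp (-(tt θ * (lam * (2 * l + 1) : ℝ))) := by
  have hBr : 0 < (Bf (lam, θ)).re := by
    refine lt_of_lt_of_le ?_ (Bf_re hlam θ)
    have := jw_pos θ.1
    positivity
  have hB0 : Bf (lam, θ) ≠ 0 := by intro h; rw [h] at hBr; simp at hBr
  rw [ell_hat hlam l hBr]
  have hm : (lam : ℂ) * Bf (lam, θ) = Tf (lam, θ) := Bf_mul (lam, θ)
  have hl0 : (lam : ℂ) ≠ 0 := by exact_mod_cast hlam.ne'
  have hch := cosh_ne (lam, θ)
  set Q := Qf (lam, θ) with hQ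
  have hT : Tf (lam, θ) = Complex.sinh Q / Complex.cosh Q := rfl
  have hS : Sf (lam, θ) = 1 / Complex.cosh Q := rfl
  have hB : Bf (lam, θ) = Complex.sinh Q / (lam * Complex.cosh Q) := by
    rw [hT] at hm; field_simp at hm ⊢; linear_combination hm
  have hsh : Complex.sinh Q ≠ 0 := by
    intro h; rw [hB, h] at hB0; simp at hB0
  have e1 : Complex.cosh Q + Complex.sinh Q = Complex.exp Q := Complex.cosh_add_sinh Q
  have e2 : Complex.cosh Q - Complex.sinh Q = Complex.exp (-Q) := Complex.cosh_sub_sinh Q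
  have f1 : 1 / (4 * Bf (lam, θ)) - lam / 4 = (lam / (4 * Complex.sinh Q)) * Complex.exp (-Q) := by
    rw [hB, ← e2]; field_simp
  have f2 : 1 / (4 * Bf (lam, θ)) + lam / 4 = (lam / (4 * Complex.sinh Q)) * Complex.exp Q := by
    rw [hB, ← e1]; field_simp
  have f3 : 1 / (4 * Bf (lam, θ)) = (lam / (4 * Complex.sinh Q)) * Complex.cosh Q := by
    rw [hB]; field_simp
  rw [f1, f2, f3, hS]
  have f4 : Complex.exp (-(tt θ * (lam * (2 * l + 1) : ℝ))) =
      Complex.exp (-Q) ^ l / Complex.exp Q ^ (l + 1) := by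
    rw [← Complex.exp_nat_mul, ← Complex.exp_nat_mul, ← Complex.exp_sub]
    congr 1
    rw [hQ, Qf]; push_cast; ring
  rw [f4]
  set a := (lam : ℂ) / (4 * Complex.sinh Q) with ha
  have ha0 : a ≠ 0 := div_ne_zero hl0 (mul_ne_zero (by norm_num) hsh)
  have := Complex.exp_ne_zero Q
  rw [mul_pow, mul_pow, pow_succ a]
  field_simp

end laguerre2

section gelfand
open scoped SchwartzMap FourierTransform

def qz (lam r : ℝ) (ζ : ℂ) : P6 :=
  (![-ζ.re, -ζ.im, -(r / (2 * Real.pi))], ![0, 0, -(lam / (2 * Real.pi))])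

lemma ellS_inv {lam : ℝ} (hlam : 0 < lam) (l : ℕ) (z : ℂ) : ellS lam hlam l z =
    ∫ ζ : ℂ, Complex.exp ((2 * Real.pi * (ζ.re * z.re + ζ.im * z.im) : ℝ) * Complex.I) *
      𝓕 (ellS lam hlam l) ζ := by
  have h : ellS lam hlam l = 𝓕⁻ (𝓕 (ellS lam hlam l)) := (FourierTransform.fourierInv_fourier_eq _).symm
  conv_lhs => rw [h]
  rw [SchwartzMap.fourierInv_coe, Real.fourierInv_eq']
  congr 1; ext1 ζ
  rw [Complex.inner, smul_eq_mul]
  congr 4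
  simp
  ring

def Hh (lam : ℝ) (hlam : 0 < lam) (l : ℕ) (r : ℝ) (p : P6) : ℂ :=
  Complex.exp ((lam * p.2 2 + r * p.1 2 : ℝ) * Complex.I) * ellS lam hlam l ⟨p.1 0, p.1 1⟩

lemma norm_mk_sq (a b : ℝ) : ‖(⟨a, b⟩ : ℂ)‖ ^ 2 = a ^ 2 + b ^ 2 := by
  rw [← Complex.normSq_eq_norm_sq, Complex.normSq_apply]; ring

lemma conj_sph (μ : Measure Mat3) {lam : ℝ} (hlam : 0 < lam) (l : ℕ) (r : ℝ) (x y : V3) :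
    (starRingEnd ℂ) (sph μ lam l r x y) = ∫ k, Hh lam hlam l r (k.mulVec x, k.mulVec y) ∂μ := by
  rw [sph, ← integral_conj]
  congr 1; ext1 k
  rw [Hh, ellS_apply, norm_mk_sq]
  simp only [map_mul, ← Complex.exp_conj, map_neg, Complex.conj_I, Complex.conj_ofReal]
  rw [mul_right_comm, ← Complex.exp_add]
  congr 2
  push_cast; ring

lemma cont_Hh {lam : ℝ} (hlam : 0 < lam) (l : ℕ) (r : ℝ) : Continuous (Hh lam hlam l r) := by
  have h1 : Continuous fun p : P6 => (⟨p.1 0, p.1 1⟩ : ℂ) := by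
    have : (fun p : P6 => (⟨p.1 0, p.1 1⟩ : ℂ)) = fun p : P6 => (p.1 0 : ℂ) + (p.1 1 : ℂ) * Complex.I := by
      ext p; apply Complex.ext <;> simp
    rw [this]; fun_prop
  unfold Hh
  exact (by fun_prop : Continuous fun p : P6 => Complex.exp ((lam * p.2 2 + r * p.1 2 : ℝ) * Complex.I)).mul
    ((ellS lam hlam l).continuous.comp h1)

lemma bdd_Hh {lam : ℝ} (hlam : 0 < lam) (l : ℕ) (r : ℝ) : ∃ C, ∀ p, ‖Hh lam hlam l r p‖ ≤ C := by
  obtain ⟨C, hC, h⟩ := schwartz_rd (ellS lam hlam l) 0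
  refine ⟨C, fun p => ?_⟩
  rw [Hh, norm_mul, Complex.norm_exp_ofReal_mul_I, one_mul]
  simpa using h ⟨p.1 0, p.1 1⟩

lemma Hh_eq {lam : ℝ} (hlam : 0 < lam) (l : ℕ) (r : ℝ) (p : P6) : Hh lam hlam l r p =
    ∫ ζ : ℂ, Complex.exp ((-2 * Real.pi * dt p (qz lam r ζ) : ℝ) * Complex.I) *
      𝓕 (ellS lam hlam l) ζ := by
  rw [Hh, ellS_inv, ← integral_const_mul]
  congr 1; ext1 ζ
  rw [← mul_assoc, ← Complex.exp_add]
  congr 2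
  rw [← add_mul, ← Complex.ofReal_add]
  congr 2
  have := Real.pi_pos
  simp [dt, qz, dotProduct, Fin.sum_univ_three]
  field_simp
  ring

lemma cont_qz (lam r : ℝ) : Continuous (qz lam r) := by
  unfold qz
  refine Continuous.prodMk (continuous_pi fun i => ?_) continuous_const
  fin_cases i <;> simp <;> fun_prop

lemma cont_dt : Continuous (fun z : P6 × P6 => dt z.1 z.2) := by
  unfold dt; simp only [dotProduct, Fin.sum_univ_three]; fun_prop

lemma Hh_int (F0 : 𝓢(P6, ℂ)) {lam : ℝ} (hlam : 0 < lam) (l : ℕ) (r : ℝ) :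
    ∫ p, F0 p * Hh lam hlam l r p = ∫ ζ : ℂ, 𝓕 (ellS lam hlam l) ζ * FT F0 (qz lam r ζ) := by
  set L := 𝓕 (ellS lam hlam l) with hL
  have hi : Integrable (Function.uncurry fun (p : P6) (ζ : ℂ) =>
      F0 p * (Complex.exp ((-2 * Real.pi * dt p (qz lam r ζ) : ℝ) * Complex.I) * L ζ))
      ((volume : Measure P6).prod (volume : Measure ℂ)) := by
    have h1 := (F0.integrable (μ := (volume : Measure P6))).mul_prod (L.integrable (μ := (volume : Measure ℂ)))
    have hc : Continuous fun z : P6 × ℂ =>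
        Complex.exp ((-2 * Real.pi * dt z.1 (qz lam r z.2) : ℝ) * Complex.I) := by
      have : Continuous fun z : P6 × ℂ => dt z.1 (qz lam r z.2) :=
        cont_dt.comp (continuous_fst.prodMk ((cont_qz lam r).comp continuous_snd))
      fun_prop
    have h2 := h1.bdd_mul (c := 1) hc.aestronglyMeasurable
      (Filter.Eventually.of_forall fun z => (Complex.norm_exp_ofReal_mul_I _).le)
    refine h2.congr (Filter.Eventually.of_forall fun z => ?_)
    simp only [Function.uncurry]; ring
  simp_rw [Hh_eq, ← integral_const_mul]
  rw [integral_integral_swap hi]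
  congr 1; ext1 ζ
  rw [FT_apply, ← integral_const_mul]
  congr 1; ext1 p
  ring

lemma Tσ_qz {lam : ℝ} (hlam : 0 < lam) (r : ℝ) (θ : ℝ × ℝ) (ζ : ℂ) :
    Tσ (θ, ((2 * Real.pi) • (qz lam r ζ).1, (2 * Real.pi) • (qz lam r ζ).2)) =
      Sf (lam, θ) * Complex.exp (-(tt θ * (r ^ 2 : ℝ))) *
        Complex.exp (-((4 * Real.pi ^ 2 * Bf (lam, θ)) * (‖ζ‖ ^ 2 : ℝ))) := by
  have hpi := Real.pi_pos
  have hv1 : (2 * Real.pi) • (qz lam r ζ).1 = ![-(2 * Real.pi * ζ.re), -(2 * Real.pi * ζ.im), -r] := by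
    ext i; fin_cases i <;> simp [qz]; field_simp
  have hv2 : (2 * Real.pi) • (qz lam r ζ).2 = ![0, 0, -lam] := by
    ext i; fin_cases i <;> simp [qz]; field_simp
  have hn : nrm3 ![0, 0, -lam] = lam := by
    simp [nrm3, Real.sqrt_sq hlam.le]
  rw [hv1, hv2, Tσ, Ef]
  simp only [hn]
  rw [mul_assoc (Sf (lam, θ)), ← Complex.exp_add]
  congr 2
  rw [Mf_eq]
  have hz : ‖ζ‖ ^ 2 = ζ.re ^ 2 + ζ.im ^ 2 := norm_mk_sq ζ.re ζ.im
  rw [hz]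
  simp [cr2, dotProduct, Fin.sum_univ_three]
  ring

lemma gelfand_main {m : ℝ × ℝ → ℂ} (hm : Mom volume m) (f0 : 𝓢(ℝ, ℂ))
    (hf0 : ∀ s, f0 s = ∫ θ, m θ * Complex.exp (-(tt θ * (s : ℝ)))) (F0 : 𝓢(P6, ℂ))
    (hF0 : ∀ q : P6, FT F0 q = ∫ θ, m θ * Tσ (θ, ((2 * Real.pi) • q.1, (2 * Real.pi) • q.2)))
    {lam : ℝ} (hlam : 0 < lam) (l : ℕ) (r : ℝ) :
    ∫ p, F0 p * Hh lam hlam l r p = f0 (lam * (2 * l + 1) + r ^ 2) := by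
  rw [Hh_int, hf0]
  simp_rw [hF0, Tσ_qz hlam, ← integral_const_mul]
  set L := 𝓕 (ellS lam hlam l) with hL
  have hBc : Continuous fun θ : ℝ × ℝ => Bf (lam, θ) :=
    htg_Bf.1.continuous.comp (by fun_prop : Continuous fun θ : ℝ × ℝ => ((lam, θ) : Z3))
  have hSc : Continuous fun θ : ℝ × ℝ => Sf (lam, θ) :=
    htg_Sf.1.continuous.comp (by fun_prop : Continuous fun θ : ℝ × ℝ => ((lam, θ) : Z3))
  have htc : Continuous tt := htg_tt.1.continuous
  have hi1 : Integrable (fun θ => m θ * (Sf (lam, θ) * Complex.exp (-(tt θ * (r ^ 2 : ℝ))))) := by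
    refine hm.int_mul (by fun_prop) (C := 5 * (1 + 2 * Real.pi)) (k := 2) fun θ => ?_
    rw [norm_mul]
    refine le_trans (mul_le_of_le_one_right (norm_nonneg _) ?_) ((Sf_le' (lam, θ)).trans (Kf_le θ))
    rw [Complex.norm_exp, Real.exp_le_one_iff, Complex.neg_re, Complex.re_mul_ofReal, tt_re, neg_nonpos]
    exact mul_nonneg (jw_pos _).le (sq_nonneg _)
  have hi : Integrable (Function.uncurry fun (ζ : ℂ) (θ : ℝ × ℝ) =>
      L ζ * (m θ * (Sf (lam, θ) * Complex.exp (-(tt θ * (r ^ 2 : ℝ))) *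
        Complex.exp (-((4 * Real.pi ^ 2 * Bf (lam, θ)) * (‖ζ‖ ^ 2 : ℝ))))))
      ((volume : Measure ℂ).prod (volume : Measure (ℝ × ℝ))) := by
    have h1 := (L.integrable (μ := (volume : Measure ℂ))).mul_prod hi1
    have hc : Continuous fun z : ℂ × (ℝ × ℝ) =>
        Complex.exp (-((4 * Real.pi ^ 2 * Bf (lam, z.2)) * (‖z.1‖ ^ 2 : ℝ))) := by
      have : Continuous fun z : ℂ × (ℝ × ℝ) => Bf (lam, z.2) := hBc.comp continuous_snd
      fun_prop
    have h2 := h1.bdd_mul (c := 1) hc.aestronglyMeasurable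
      (Filter.Eventually.of_forall fun z => by
        have hBr : 0 ≤ (Bf (lam, z.2)).re := by
          refine le_trans ?_ (Bf_re hlam z.2)
          have := jw_pos z.2.1
          positivity
        have e : (4 * Real.pi ^ 2 * Bf (lam, z.2) : ℂ).re = 4 * Real.pi ^ 2 * (Bf (lam, z.2)).re := by
          have : (4 * Real.pi ^ 2 * Bf (lam, z.2) : ℂ) = ((4 * Real.pi ^ 2 : ℝ) : ℂ) * Bf (lam, z.2) := by
            push_cast; ring
          rw [this, Complex.re_ofReal_mul]
        rw [Complex.norm_exp, Real.exp_le_one_iff, re_mul_nsq, e, neg_nonpos]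
        positivity)
    refine h2.congr (Filter.Eventually.of_forall fun z => ?_)
    simp only [Function.uncurry]; ring
  rw [integral_integral_swap hi]
  congr 1; ext1 θ
  have e1 : ∀ ζ : ℂ, L ζ * (m θ * (Sf (lam, θ) * Complex.exp (-(tt θ * (r ^ 2 : ℝ))) *
        Complex.exp (-((4 * Real.pi ^ 2 * Bf (lam, θ)) * (‖ζ‖ ^ 2 : ℝ))))) =
      (m θ * Complex.exp (-(tt θ * (r ^ 2 : ℝ))) * Sf (lam, θ)) * (L ζ *
        Complex.exp (-((4 * Real.pi ^ 2 * Bf (lam, θ)) * (‖ζ‖ ^ 2 : ℝ)))) := fun ζ => by ring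
  simp_rw [e1]
  rw [integral_const_mul, mul_assoc, ell_alg hlam l θ, mul_assoc, ← Complex.exp_add]
  congr 2
  push_cast; ring

lemma gelfand {μ : Measure Mat3} (hμ : IsHaarSO3 μ) {m : ℝ × ℝ → ℂ} (hm : Mom volume m) (f0 : 𝓢(ℝ, ℂ))
    (hf0 : ∀ s, f0 s = ∫ θ, m θ * Complex.exp (-(tt θ * (s : ℝ)))) (F0 : 𝓢(P6, ℂ)) (hI : Inv3 F0)
    (hF0 : ∀ q : P6, FT F0 q = ∫ θ, m θ * Tσ (θ, ((2 * Real.pi) • q.1, (2 * Real.pi) • q.2)))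
    (lam : ℝ) (hlam : 0 < lam) (l : ℕ) (r : ℝ) :
    ∫ p : V3 × V3, F0 p * (starRingEnd ℂ) (sph μ lam l r p.1 p.2) = f0 (lam * (2 * l + 1) + r ^ 2) := by
  simp_rw [conj_sph μ hlam]
  obtain ⟨C, hC⟩ := bdd_Hh hlam l r
  rw [haar_avg hμ F0 hI (cont_Hh hlam l r) hC]
  exact gelfand_main hm f0 hf0 F0 hF0 hlam l r

end gelfand

section circ
open scoped SchwartzMap

def Hc (s : ℝ) : ℂ := ∫ t in (0:ℝ)..1, ((Ac (4 * Real.pi ^ 2 * Real.cos (2 * Real.pi * t) ^ 2 * s) : ℝ) : ℂ)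

lemma htg_Hc : Hc.HasTemperateGrowth := by
  refine htg_integral_unit (T := fun z : ℝ × ℝ =>
    ((Ac (4 * Real.pi ^ 2 * Real.cos (2 * Real.pi * z.1) ^ 2 * z.2) : ℝ) : ℂ)) (htg_ofReal ?_)
  have h1 : Function.HasTemperateGrowth (fun z : ℝ × ℝ => z.1) :=
    (ContinuousLinearMap.fst ℝ ℝ ℝ).hasTemperateGrowth
  have h2 : Function.HasTemperateGrowth (fun z : ℝ × ℝ => z.2) :=
    (ContinuousLinearMap.snd ℝ ℝ ℝ).hasTemperateGrowth
  have h3 := (Function.HasTemperateGrowth.const (E := ℝ × ℝ) (2 * Real.pi)).mul h1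
  have h4 := ((Function.HasTemperateGrowth.const (E := ℝ × ℝ) (4 * Real.pi ^ 2)).mul
    ((htg_cos.comp h3).pow 2)).mul h2
  exact htg_Ac.comp h4

def Fr (ρ t : ℝ) : ℂ := Complex.exp ((2 * Real.pi * (ρ * Real.cos (2 * Real.pi * t)) : ℝ) * Complex.I)

lemma Fr_per (ρ : ℝ) : Function.Periodic (Fr ρ) 1 := by
  intro t
  rw [Fr, Fr, mul_add, mul_one, Real.cos_add_two_pi]

lemma Fr_shift (ρ a : ℝ) : ∫ t in (0:ℝ)..1, Fr ρ (t + a) = ∫ t in (0:ℝ)..1, Fr ρ t := by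
  rw [intervalIntegral.integral_comp_add_right]
  have := (Fr_per ρ).intervalIntegral_add_eq a 0
  rw [add_comm a 1] at this
  simpa using this

lemma cont_Fr (ρ : ℝ) : Continuous (Fr ρ) := by unfold Fr; fun_prop

lemma circ (P Q : ℝ) : ∫ t in (0:ℝ)..1, Complex.exp ((2 * Real.pi *
    (P * Real.cos (2 * Real.pi * t) + Q * Real.sin (2 * Real.pi * t)) : ℝ) * Complex.I) =
    Hc (P ^ 2 + Q ^ 2) := by
  have hpi := Real.pi_pos
  set z : ℂ := ⟨P, Q⟩ with hz
  set ρ := ‖z‖ with hρ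
  have hP : ρ * Real.cos z.arg = P := Complex.norm_mul_cos_arg z
  have hQ : ρ * Real.sin z.arg = Q := Complex.norm_mul_sin_arg z
  have hρ2 : P ^ 2 + Q ^ 2 = ρ ^ 2 := (norm_mk_sq P Q).symm
  have h1 : ∀ t : ℝ, Complex.exp ((2 * Real.pi *
      (P * Real.cos (2 * Real.pi * t) + Q * Real.sin (2 * Real.pi * t)) : ℝ) * Complex.I) =
      Fr ρ (t + -(z.arg / (2 * Real.pi))) := by
    intro t
    rw [Fr]
    have : 2 * Real.pi * (t + -(z.arg / (2 * Real.pi))) = 2 * Real.pi * t - z.arg := by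
      field_simp; ring
    rw [this, Real.cos_sub, ← hP, ← hQ]
    congr 3; ring
  simp only [h1]
  rw [Fr_shift, hρ2]
  have h2 : ∀ t, Fr ρ t + Fr ρ (t + 1 / 2) = 2 *
      ((Ac (4 * Real.pi ^ 2 * Real.cos (2 * Real.pi * t) ^ 2 * ρ ^ 2) : ℝ) : ℂ) := by
    intro t
    have e1 : 4 * Real.pi ^ 2 * Real.cos (2 * Real.pi * t) ^ 2 * ρ ^ 2 =
      (2 * Real.pi * (ρ * Real.cos (2 * Real.pi * t))) ^ 2 := by ring
    have e2 : 2 * Real.pi * (t + 1 / 2) = 2 * Real.pi * t + Real.pi := by ring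
    rw [e1, Ac_sq, Fr, Fr, e2, Real.cos_add_pi, Complex.ofReal_cos, Complex.cos]
    push_cast
    ring_nf
  have h3 : (2 : ℂ) * Hc (ρ ^ 2) = 2 * ∫ t in (0:ℝ)..1, Fr ρ t := by
    rw [Hc, ← intervalIntegral.integral_const_mul]
    simp only [← h2]
    have hc : Continuous (fun t => Fr ρ (t + 1 / 2)) := (cont_Fr ρ).comp (by fun_prop)
    rw [intervalIntegral.integral_add ((cont_Fr ρ).intervalIntegrable _ _)
      (hc.intervalIntegrable _ _)]
    rw [Fr_shift]; ring
  exact (mul_left_cancel₀ two_ne_zero h3).symm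

lemma rot2 (a b : ℝ) : ∃ t : ℝ, Real.cos t * a - Real.sin t * b = 0 := by
  set z : ℂ := ⟨b, a⟩
  refine ⟨z.arg, ?_⟩
  have hP : ‖z‖ * Real.cos z.arg = b := Complex.norm_mul_cos_arg z
  have hQ : ‖z‖ * Real.sin z.arg = a := Complex.norm_mul_sin_arg z
  rw [← hP, ← hQ]; ring

lemma so3_mul {k k' : Mat3} (hk : k ∈ SO3) (hk' : k' ∈ SO3) : k * k' ∈ SO3 := by
  refine ⟨?_, by rw [det_mul, hk.2, hk'.2, one_mul]⟩
  rw [transpose_mul, Matrix.mul_assoc, ← Matrix.mul_assoc k', hk'.1, Matrix.one_mul, hk.1]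

lemma rot_to_e3 (n : V3) : ∃ k ∈ SO3, ∃ a, k.mulVec n = e3v a := by
  obtain ⟨s, hs⟩ := rot2 (n 1) (n 2)
  set n' := (r23 s).mulVec n with hn'
  obtain ⟨t, ht⟩ := rot2 (n' 0) (n' 2)
  refine ⟨r13 t * r23 s, so3_mul (r13_mem t) (r23_mem s), ((r13 t).mulVec n') 2, ?_⟩
  rw [← mulVec_mulVec, ← hn']
  have h1 : n' 1 = 0 := by
    rw [hn', ← hs]; simp [r23, Matrix.mulVec, dotProduct, Fin.sum_univ_three]; ring
  ext i
  fin_cases i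
  · simp [e3v, r13, Matrix.mulVec, dotProduct, Fin.sum_univ_three]
    linarith
  · simp [e3v, r13, Matrix.mulVec, dotProduct, Fin.sum_univ_three, h1]
  · simp [e3v]

lemma rot_planar (ξ η : V3) : ∃ k ∈ SO3, (k.mulVec ξ) 2 = 0 ∧ (k.mulVec η) 2 = 0 := by
  obtain ⟨n, hn, h⟩ := (Matrix.exists_mulVec_eq_zero_iff (M := !![ξ 0, ξ 1, ξ 2; η 0, η 1, η 2; 0, 0, 0])).2
    (by simp [det_fin_three])
  have h1 : ξ ⬝ᵥ n = 0 := by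
    have := congrFun h 0; simpa [Matrix.mulVec, dotProduct, Fin.sum_univ_three] using this
  have h2 : η ⬝ᵥ n = 0 := by
    have := congrFun h 1; simpa [Matrix.mulVec, dotProduct, Fin.sum_univ_three] using this
  obtain ⟨k, hk, a, ha⟩ := rot_to_e3 n
  have ha0 : a ≠ 0 := by
    rintro rfl
    apply hn
    rw [← so3_inv hk n, ha]; simp [e3v]
  refine ⟨k, hk, ?_, ?_⟩
  · have := so3_dot hk ξ n
    rw [ha, h1, e3v, dotProduct_single] at this
    exact (mul_eq_zero.1 this).resolve_right ha0
  · have := so3_dot hk η n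
    rw [ha, h2, e3v, dotProduct_single] at this
    exact (mul_eq_zero.1 this).resolve_right ha0

end circ

section planar
open scoped SchwartzMap

abbrev E4 := EuclideanSpace ℝ (Fin 4)

def pl : E4 →L[ℝ] P6 := LinearMap.toContinuousLinearMap
  { toFun := fun X => (![X 0, X 1, 0], ![X 2, X 3, 0])
    map_add' := fun X Y => by
      ext i <;> fin_cases i <;> simp
    map_smul' := fun c X => by
      ext i <;> fin_cases i <;> simp }

lemma pl_apply (X : E4) : pl X = (![X 0, X 1, 0], ![X 2, X 3, 0]) := rfl

def q4 (X : E4) : ℝ := X 0 ^ 2 + X 1 ^ 2 + (X 2 ^ 2 + X 3 ^ 2)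

lemma htg_q4 : q4.HasTemperateGrowth := by
  have h : ∀ j, Function.HasTemperateGrowth (fun X : E4 => X j) := fun j =>
    (EuclideanSpace.proj (𝕜 := ℝ) j : E4 →L[ℝ] ℝ).hasTemperateGrowth
  exact (((h 0).pow 2).add ((h 1).pow 2)).add (((h 2).pow 2).add ((h 3).pow 2))

lemma pl_anti : AntilipschitzWith 2 pl := by
  refine pl.antilipschitz_of_bound fun X => ?_
  rw [pl_apply]
  set M := ‖((![X 0, X 1, 0], ![X 2, X 3, 0]) : P6)‖ with hM
  have hM0 : 0 ≤ M := norm_nonneg _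
  have h1 : ‖(![X 0, X 1, 0] : V3)‖ ≤ M := le_max_left _ _
  have h2 : ‖(![X 2, X 3, 0] : V3)‖ ≤ M := le_max_right _ _
  have a0 : |X 0| ≤ M := by simpa using (norm_le_pi_norm (![X 0, X 1, 0] : V3) 0).trans h1
  have a1 : |X 1| ≤ M := by simpa using (norm_le_pi_norm (![X 0, X 1, 0] : V3) 1).trans h1
  have a2 : |X 2| ≤ M := by simpa using (norm_le_pi_norm (![X 2, X 3, 0] : V3) 0).trans h2
  have a3 : |X 3| ≤ M := by simpa using (norm_le_pi_norm (![X 2, X 3, 0] : V3) 1).trans h2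
  have hs : ∀ {a : ℝ}, |a| ≤ M → a ^ 2 ≤ M ^ 2 := fun h => by
    rw [← sq_abs]; exact pow_le_pow_left₀ (abs_nonneg _) h 2
  rw [EuclideanSpace.norm_eq]
  refine Real.sqrt_le_iff.2 ⟨by positivity, ?_⟩
  simp only [Fin.sum_univ_four, Real.norm_eq_abs, sq_abs]
  have := hs a0; have := hs a1; have := hs a2; have := hs a3
  push_cast
  nlinarith

def r12 (a : ℝ) : Mat3 := !![Real.cos a, -Real.sin a, 0; Real.sin a, Real.cos a, 0; 0, 0, 1]

lemma r12_mem (a : ℝ) : r12 a ∈ SO3 := by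
  have := Real.sin_sq_add_cos_sq a
  constructor
  · ext i j
    fin_cases i <;> fin_cases j <;> simp [r12, Matrix.mul_apply, Fin.sum_univ_three] <;> linarith
  · simp [r12, det_fin_three]; linarith

def rot4 (a : ℝ) (X : E4) : E4 := !₂[Real.cos a * X 0 - Real.sin a * X 1, Real.sin a * X 0 + Real.cos a * X 1,
  Real.cos a * X 2 - Real.sin a * X 3, Real.sin a * X 2 + Real.cos a * X 3]

def ref4 (X : E4) : E4 := !₂[X 0, -X 1, X 2, -X 3]

lemma pl_rot4 (a : ℝ) (X : E4) : pl (rot4 a X) = ((r12 a).mulVec (pl X).1, (r12 a).mulVec (pl X).2) := by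
  rw [pl_apply, pl_apply]
  ext i <;> fin_cases i <;> simp [rot4, r12, Matrix.mulVec, dotProduct, Fin.sum_univ_three] <;> ring

lemma pl_ref4 (X : E4) : pl (ref4 X) = ((r23 Real.pi).mulVec (pl X).1, (r23 Real.pi).mulVec (pl X).2) := by
  rw [pl_apply, pl_apply]
  ext i <;> fin_cases i <;> simp [ref4, r23, Matrix.mulVec, dotProduct, Fin.sum_univ_three]

lemma q4_rot (a : ℝ) (X : E4) : q4 (rot4 a X) = q4 X := by
  have := Real.sin_sq_add_cos_sq a
  simp [q4, rot4]
  linear_combination (X 0 ^ 2 + X 1 ^ 2 + X 2 ^ 2 + X 3 ^ 2) * this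

def Pp (X Y : E4) : ℝ := X 0 * Y 0 + X 1 * Y 1 + X 2 * Y 2 + X 3 * Y 3
def Qq (X Y : E4) : ℝ := X 0 * Y 1 - X 1 * Y 0 + (X 2 * Y 3 - X 3 * Y 2)

lemma inner_rot (a : ℝ) (X Y : E4) : inner ℝ (rot4 a X) Y = Pp X Y * Real.cos a + Qq X Y * Real.sin a := by
  simp [PiLp.inner_apply, Fin.sum_univ_four, rot4, Pp, Qq]
  ring

lemma planar_rep (f : 𝓢(P6, ℂ)) (hf : Inv3 f) : ∃ m : ℝ × E4 → ℂ, Mom volume m ∧ ∀ X : E4,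
    f (pl X) = ∫ z, m z * (Complex.exp (-(jw z.1 * q4 X) : ℝ) * Hc (Pp X z.2 ^ 2 + Qq X z.2 ^ 2)) := by
  let φ : 𝓢(E4, ℂ) := SchwartzMap.compCLMOfAntilipschitz ℝ pl.hasTemperateGrowth pl_anti f
  obtain ⟨m, hm, h⟩ := wlemma φ q4 htg_q4
  refine ⟨m, hm, fun X => ?_⟩
  set G : ℝ → (ℝ × E4) → ℂ := fun t z => m z * Complex.exp (2 * Real.pi * Complex.I *
    (inner ℝ (rot4 (2 * Real.pi * t) X) z.2 : ℝ) - (jw z.1 * q4 X : ℝ)) with hG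
  have h1 : ∀ t : ℝ, f (pl X) = ∫ z, G t z := by
    intro t
    have e : f (pl (rot4 (2 * Real.pi * t) X)) = f (pl X) := by
      rw [pl_rot4]; exact hf _ (r12_mem _) _ _
    rw [← e]
    have := h (rot4 (2 * Real.pi * t) X)
    rw [q4_rot] at this
    exact this
  have h2 : f (pl X) = ∫ t in (0:ℝ)..1, ∫ z, G t z := by
    simp only [← h1]; simp
  have hn : ∀ t (z : ℝ × E4), ‖Complex.exp (2 * Real.pi * Complex.I *
    (inner ℝ (rot4 (2 * Real.pi * t) X) z.2 : ℝ) - (jw z.1 * q4 X : ℝ))‖ ≤ 1 := by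
    intro t z
    rw [Complex.norm_exp]
    have := mul_nonneg (jw_pos z.1).le (show 0 ≤ q4 X by unfold q4; positivity)
    simpa using this
  rw [h2, intervalIntegral_integral_swap]
  · congr 1; ext1 z
    simp only [hG]
    rw [← circ, ← intervalIntegral.integral_const_mul, ← intervalIntegral.integral_const_mul]
    refine intervalIntegral.integral_congr fun t _ => ?_
    rw [← Complex.exp_add, inner_rot]
    congr 1
    push_cast; ring
  · have hI : Integrable (fun w : ℝ × (ℝ × E4) => (1:ℝ) * ‖m w.2‖)
        ((volume.restrict (Set.uIoc (0:ℝ) 1)).prod volume) := by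
      have h0 : Integrable (fun z => ‖m z‖) volume := by simpa using hm.2 0
      refine Integrable.mul_prod (f := fun _ : ℝ => (1:ℝ)) ?_ h0
      rw [Set.uIoc_of_le zero_le_one]
      exact integrable_const _
    have hrc : Continuous (fun w : ℝ × (ℝ × E4) => Complex.exp (2 * Real.pi * Complex.I *
        (inner ℝ (rot4 (2 * Real.pi * w.1) X) w.2.2 : ℝ) - (jw w.2.1 * q4 X : ℝ))) := by
      simp only [inner_rot, Pp, Qq]
      have : Continuous jw := htg_jw.1.continuous
      fun_prop
    refine hI.mono' ?_ ?_
    · exact (hm.1.comp_snd).mul hrc.aestronglyMeasurable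
    · refine Filter.Eventually.of_forall fun w => ?_
      show ‖m w.2 * _‖ ≤ _
      rw [norm_mul, one_mul]
      exact mul_le_of_le_one_right (norm_nonneg _) (hn w.1 w.2)

end planar

section divis
open scoped SchwartzMap

abbrev Zt := ℝ × E4

def e1f (w : Zt × P6) : ℂ :=
  Complex.exp ((-(jw w.1.1 * (w.2.1 ⬝ᵥ w.2.1 + w.2.2 ⬝ᵥ w.2.2)) : ℝ) : ℂ)

lemma htg_w : Function.HasTemperateGrowth (fun w : Zt × P6 => w.1.1) :=
  ((ContinuousLinearMap.fst ℝ ℝ E4).comp (ContinuousLinearMap.fst ℝ Zt P6)).hasTemperateGrowth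
lemma htg_Y (j : Fin 4) : Function.HasTemperateGrowth (fun w : Zt × P6 => w.1.2 j) :=
  ((EuclideanSpace.proj (𝕜 := ℝ) j : E4 →L[ℝ] ℝ).comp
    ((ContinuousLinearMap.snd ℝ ℝ E4).comp (ContinuousLinearMap.fst ℝ Zt P6))).hasTemperateGrowth
lemma htg_ξ : Function.HasTemperateGrowth (fun w : Zt × P6 => w.2.1) :=
  ((ContinuousLinearMap.fst ℝ V3 V3).comp (ContinuousLinearMap.snd ℝ Zt P6)).hasTemperateGrowth
lemma htg_η : Function.HasTemperateGrowth (fun w : Zt × P6 => w.2.2) :=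
  ((ContinuousLinearMap.snd ℝ V3 V3).comp (ContinuousLinearMap.snd ℝ Zt P6)).hasTemperateGrowth

lemma dot_nonneg (x : V3) : 0 ≤ x ⬝ᵥ x := by rw [dot_self3]; positivity

lemma htg_e1f : e1f.HasTemperateGrowth := by
  refine htg_cexp_of_le (C := 0) (htg_ofReal ?_) fun w => ?_
  · exact ((htg_jw.comp htg_w).mul ((htg_dot htg_ξ htg_ξ).add (htg_dot htg_η htg_η))).neg
  · have := mul_nonneg (jw_pos w.1.1).le (add_nonneg (dot_nonneg w.2.1) (dot_nonneg w.2.2))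
    rw [Complex.ofReal_re]; linarith

lemma e1f_decay {U : Zt × P6 → ℂ} (hU : U.HasTemperateGrowth) (k : ℕ) :
    ∃ (N : ℕ) (C : ℝ), 0 ≤ C ∧ ∀ θ p,
      (1 + ‖p‖) ^ k * ‖e1f (θ, p) * U (θ, p)‖ ≤ C * (1 + ‖θ‖) ^ N := by
  obtain ⟨n, C, hC, hb⟩ := htg_pb hU
  refine ⟨n + (k + n), C * (2 ^ (k + n) * ((k + n).factorial * Real.exp 1)), by positivity, fun θ p => ?_⟩
  set d := p.1 ⬝ᵥ p.1 + p.2 ⬝ᵥ p.2 with hd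
  have hd0 : 0 ≤ d := add_nonneg (dot_nonneg _) (dot_nonneg _)
  have hpd : 1 + ‖p‖ ≤ 2 * (1 + d) := by
    have h1 := norm_le_nrm3 p.1
    have h2 := norm_le_nrm3 p.2
    rw [hd, dot_self3, dot_self3]
    have : ‖p‖ ≤ 1 + nrm3 p.1 ^ 2 + nrm3 p.2 ^ 2 := by
      rw [Prod.norm_def]
      exact max_le (by nlinarith [sq_nonneg (nrm3 p.1 - 1), sq_nonneg (nrm3 p.2)])
        (by nlinarith [sq_nonneg (nrm3 p.2 - 1), sq_nonneg (nrm3 p.1)])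
    nlinarith [sq_nonneg (nrm3 p.2), sq_nonneg (nrm3 p.1)]
  have he : ‖e1f (θ, p)‖ = Real.exp (-(jw θ.1 * d)) := by
    rw [e1f, Complex.norm_exp, Complex.ofReal_re]
  have hUb : ‖U (θ, p)‖ ≤ C * ((1 + ‖θ‖) * (1 + ‖p‖)) ^ n :=
    (hb _).trans (mul_le_mul_of_nonneg_left (pow_le_pow_left₀ (by positivity) (jb_prod θ p) n) hC)
  have hdec := exp_decay_jw (k + n) θ.1 hd0
  have hw : (1 + |θ.1|) ^ (k + n) ≤ (1 + ‖θ‖) ^ (k + n) :=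
    pow_le_pow_left₀ (by positivity) (by have : |θ.1| ≤ ‖θ‖ := le_max_left _ _; linarith) _
  have hp2 : (1 + ‖p‖) ^ (k + n) ≤ 2 ^ (k + n) * (1 + d) ^ (k + n) := by
    rw [← mul_pow]; exact pow_le_pow_left₀ (by positivity) hpd _
  rw [norm_mul, he]
  calc (1 + ‖p‖) ^ k * (Real.exp (-(jw θ.1 * d)) * ‖U (θ, p)‖)
      ≤ (1 + ‖p‖) ^ k * (Real.exp (-(jw θ.1 * d)) * (C * ((1 + ‖θ‖) * (1 + ‖p‖)) ^ n)) := by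
        exact mul_le_mul_of_nonneg_left (mul_le_mul_of_nonneg_left hUb (Real.exp_pos _).le) (by positivity)
    _ = C * (1 + ‖θ‖) ^ n * ((1 + ‖p‖) ^ (k + n) * Real.exp (-(jw θ.1 * d))) := by
        rw [mul_pow, pow_add]; ring
    _ ≤ C * (1 + ‖θ‖) ^ n * ((2 ^ (k + n) * (1 + d) ^ (k + n)) * Real.exp (-(jw θ.1 * d))) := by
        exact mul_le_mul_of_nonneg_left (mul_le_mul_of_nonneg_right hp2 (Real.exp_pos _).le) (by positivity)
    _ = C * (1 + ‖θ‖) ^ n * 2 ^ (k + n) * ((1 + d) ^ (k + n) * Real.exp (-(jw θ.1 * d))) := by ring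
    _ ≤ C * (1 + ‖θ‖) ^ n * 2 ^ (k + n) * ((1 + ‖θ‖) ^ (k + n) * ((k + n).factorial * Real.exp 1)) := by
        exact mul_le_mul_of_nonneg_left (hdec.trans (mul_le_mul_of_nonneg_right hw (by positivity)))
          (by positivity)
    _ = _ := by rw [pow_add (1 + ‖θ‖)]; ring

lemma int_e1f {m : Zt → ℂ} (hm : Mom volume m) {U : Zt × P6 → ℂ} (hU : U.HasTemperateGrowth) (p : P6) :
    Integrable (fun z => m z * (e1f (z, p) * U (z, p))) := by
  obtain ⟨N, C, hC, h⟩ := e1f_decay hU 0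
  refine hm.int_mul (C := C) (k := N) ?_ fun θ => by simpa using h θ p
  exact ((htg_e1f.mul hU).1.continuous).comp (by fun_prop : Continuous fun z : Zt => (z, p))

lemma hadam {H : ℝ → ℂ} (hH : H.HasTemperateGrowth) : ∃ N : ℝ × ℝ → ℂ, N.HasTemperateGrowth ∧
    ∀ t s, H (s + t) = H s + t * N (t, s) := by
  set g : ℝ × ℝ → ℂ := fun z => H (z.2 + z.1) with hg
  have hg1 : g.HasTemperateGrowth :=
    hH.comp ((ContinuousLinearMap.snd ℝ ℝ ℝ).hasTemperateGrowth.add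
      (ContinuousLinearMap.fst ℝ ℝ ℝ).hasTemperateGrowth)
  refine ⟨fun z => ∫ s in (0:ℝ)..1, dOne g (s * z.1, z.2), ?_, fun t s => ?_⟩
  · refine htg_integral_unit (T := fun y : ℝ × (ℝ × ℝ) => dOne g (y.1 * y.2.1, y.2.2)) ?_
    refine (htg_dOne hg1).comp (htg_pair ?_ ?_)
    · exact ((ContinuousLinearMap.fst ℝ ℝ (ℝ × ℝ)).hasTemperateGrowth).mul
        (((ContinuousLinearMap.fst ℝ ℝ ℝ).comp
          (ContinuousLinearMap.snd ℝ ℝ (ℝ × ℝ))).hasTemperateGrowth)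
    · exact ((ContinuousLinearMap.snd ℝ ℝ ℝ).comp
          (ContinuousLinearMap.snd ℝ ℝ (ℝ × ℝ))).hasTemperateGrowth
  · have := integral_dOne hg1 t s
    rw [Complex.real_smul] at this
    dsimp only
    rw [this]; simp [hg]

def gg (z : ℝ × ℝ) : ℂ := (1 / 2 : ℂ) * (Hc (z.2 + 2 * z.1) + Hc (z.2 - 2 * z.1))

lemma htg_gg : gg.HasTemperateGrowth := by
  have h1 : Function.HasTemperateGrowth (fun z : ℝ × ℝ => z.1) :=
    (ContinuousLinearMap.fst ℝ ℝ ℝ).hasTemperateGrowth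
  have h2 : Function.HasTemperateGrowth (fun z : ℝ × ℝ => z.2) :=
    (ContinuousLinearMap.snd ℝ ℝ ℝ).hasTemperateGrowth
  have h3 := (Function.HasTemperateGrowth.const (E := ℝ × ℝ) (2:ℝ)).mul h1
  exact (Function.HasTemperateGrowth.const _).mul ((htg_Hc.comp (h2.add h3)).add (htg_Hc.comp (h2.sub h3)))

lemma gg_even (a p : ℝ) : gg (-a, p) = gg (a, p) := by
  simp only [gg]
  rw [mul_neg, sub_neg_eq_add, ← sub_eq_add_neg, add_comm (Hc _)]

lemma gg_zero (p : ℝ) : gg (0, p) = Hc p := by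
  simp only [gg, mul_zero, add_zero, sub_zero]; ring

def PPf (t : ℝ) : ℂ := Complex.exp ((-phs t : ℝ) : ℂ)

lemma htg_PPf : PPf.HasTemperateGrowth := by
  refine htg_cexp_of_le (C := 2) (htg_ofReal htg_phs.neg) fun t => ?_
  have := phs_ge t
  have := abs_nonneg t
  rw [Complex.ofReal_re]; linarith

def dd (Y : E4) : ℝ := Y 0 * Y 3 - Y 1 * Y 2
def xx (Y : E4) : ℝ := Y 0 ^ 2 + Y 1 ^ 2
def yy (Y : E4) : ℝ := Y 2 ^ 2 + Y 3 ^ 2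
def xy (Y : E4) : ℝ := Y 0 * Y 2 + Y 1 * Y 3

def vv (w : Zt × P6) : V3 :=
  Pi.single 0 (dd w.1.2 * (w.2.1 1 * w.2.2 2 - w.2.1 2 * w.2.2 1)) +
  Pi.single 1 (dd w.1.2 * (w.2.1 2 * w.2.2 0 - w.2.1 0 * w.2.2 2)) +
  Pi.single 2 (dd w.1.2 * (w.2.1 0 * w.2.2 1 - w.2.1 1 * w.2.2 0))

lemma htg_dd : Function.HasTemperateGrowth (fun w : Zt × P6 => dd w.1.2) :=
  ((htg_Y 0).mul (htg_Y 3)).sub ((htg_Y 1).mul (htg_Y 2))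
lemma htg_xx : Function.HasTemperateGrowth (fun w : Zt × P6 => xx w.1.2) :=
  ((htg_Y 0).pow 2).add ((htg_Y 1).pow 2)
lemma htg_yy : Function.HasTemperateGrowth (fun w : Zt × P6 => yy w.1.2) :=
  ((htg_Y 2).pow 2).add ((htg_Y 3).pow 2)
lemma htg_xy : Function.HasTemperateGrowth (fun w : Zt × P6 => xy w.1.2) :=
  ((htg_Y 0).mul (htg_Y 2)).add ((htg_Y 1).mul (htg_Y 3))

lemma htg_single {E : Type} [NormedAddCommGroup E] [NormedSpace ℝ E] {f : E → ℝ}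
    (hf : f.HasTemperateGrowth) (j : Fin 3) : Function.HasTemperateGrowth (fun x => (Pi.single j (f x) : V3)) :=
  (ContinuousLinearMap.single ℝ (fun _ : Fin 3 => ℝ) j).hasTemperateGrowth.comp hf

lemma htg_vv : vv.HasTemperateGrowth := by
  have c : ∀ i j, Function.HasTemperateGrowth (fun w : Zt × P6 => w.2.1 i * w.2.2 j) := fun i j =>
    (htg_proj htg_ξ i).mul (htg_proj htg_η j)
  exact ((htg_single (htg_dd.mul ((c 1 2).sub (c 2 1))) 0).add
    (htg_single (htg_dd.mul ((c 2 0).sub (c 0 2))) 1)).add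
    (htg_single (htg_dd.mul ((c 0 1).sub (c 1 0))) 2)

def hh (w : Zt × P6) : ℝ := nrm3 (vv w)

lemma hh_sq (w : Zt × P6) : hh w ^ 2 = dd w.1.2 ^ 2 * cr2 w.2 := by
  rw [hh, nrm3_sq]
  simp [vv, cr2, dotProduct, Fin.sum_univ_three, Pi.single_apply]
  ring

lemma cr2_rot {k : Mat3} (hk : k ∈ SO3) (x y : V3) : cr2 (k.mulVec x, k.mulVec y) = cr2 (x, y) := by
  simp only [cr2, so3_dot hk]

lemma hh_rot {k : Mat3} (hk : k ∈ SO3) (z : Zt) (x y : V3) :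
    hh (z, k.mulVec x, k.mulVec y) = hh (z, x, y) := by
  have h : hh (z, k.mulVec x, k.mulVec y) ^ 2 = hh (z, x, y) ^ 2 := by
    rw [hh_sq, hh_sq]; dsimp only; rw [cr2_rot hk]
  exact (sq_eq_sq₀ (nrm3_nonneg _) (nrm3_nonneg _)).1 h

def uu (w : Zt × P6) : ℝ := (w.2.1 ⬝ᵥ w.2.1) * xx w.1.2 +
  (2 * (w.2.1 ⬝ᵥ w.2.2) * xy w.1.2 + (w.2.2 ⬝ᵥ w.2.2) * yy w.1.2)

lemma htg_tu : Function.HasTemperateGrowth (fun w : Zt × P6 =>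
    2 * (w.2.1 ⬝ᵥ w.2.2) * xy w.1.2 + (w.2.2 ⬝ᵥ w.2.2) * yy w.1.2) :=
  (((Function.HasTemperateGrowth.const 2).mul (htg_dot htg_ξ htg_η)).mul htg_xy).add
    ((htg_dot htg_η htg_η).mul htg_yy)

lemma htg_u0 : Function.HasTemperateGrowth (fun w : Zt × P6 => (w.2.1 ⬝ᵥ w.2.1) * xx w.1.2) :=
  (htg_dot htg_ξ htg_ξ).mul htg_xx

lemma htg_uu : uu.HasTemperateGrowth := htg_u0.add htg_tu

lemma e1f_rot {k : Mat3} (hk : k ∈ SO3) (z : Zt) (x y : V3) :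
    e1f (z, k.mulVec x, k.mulVec y) = e1f (z, x, y) := by
  simp only [e1f, so3_dot hk]

lemma uu_rot {k : Mat3} (hk : k ∈ SO3) (z : Zt) (x y : V3) :
    uu (z, k.mulVec x, k.mulVec y) = uu (z, x, y) := by
  simp only [uu, so3_dot hk]

lemma rep6 (f : 𝓢(P6, ℂ)) (hf : Inv3 f) : ∃ m : Zt → ℂ, Mom volume m ∧ ∀ p : P6,
    f p = ∫ z, m z * (e1f (z, p) * gg (hh (z, p), uu (z, p))) := by
  obtain ⟨m, hm, h⟩ := planar_rep f hf
  refine ⟨m, hm, fun p => ?_⟩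
  have planar : ∀ X : E4, f (pl X) = ∫ z, m z * (e1f (z, pl X) * gg (hh (z, pl X), uu (z, pl X))) := by
    intro X
    have h1 := h X
    have h2 := h (ref4 X)
    rw [pl_ref4, hf _ (r23_mem _), show ((pl X).1, (pl X).2) = pl X from rfl] at h2
    have hU : ∀ s : ℝ, Function.HasTemperateGrowth (fun w : Zt × P6 => Hc (uu w +
        s * ((w.2.1 0 * w.2.2 1 - w.2.1 1 * w.2.2 0) * dd w.1.2))) := fun s =>
      htg_Hc.comp (htg_uu.add ((Function.HasTemperateGrowth.const s).mul
        ((((htg_proj htg_ξ 0).mul (htg_proj htg_η 1)).sub ((htg_proj htg_ξ 1).mul (htg_proj htg_η 0))).mul htg_dd)))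
    have i1 := int_e1f hm (hU 2) (pl X)
    have i2 := int_e1f hm (hU (-2)) (pl X)
    have e1 : ∀ z : Zt, m z * (Complex.exp (-(jw z.1 * q4 X) : ℝ) * Hc (Pp X z.2 ^ 2 + Qq X z.2 ^ 2)) =
        m z * (e1f (z, pl X) * Hc (uu (z, pl X) +
          2 * (((pl X).1 0 * (pl X).2 1 - (pl X).1 1 * (pl X).2 0) * dd z.2))) := by
      intro z
      congr 2
      · rw [e1f]; congr 3; simp [pl_apply, q4, dotProduct, Fin.sum_univ_three]; left; ring
      · congr 1; simp [pl_apply, uu, Pp, Qq, xx, yy, xy, dd, dotProduct, Fin.sum_univ_three]; ring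
    have e2 : ∀ z : Zt, m z * (Complex.exp (-(jw z.1 * q4 (ref4 X)) : ℝ) *
          Hc (Pp (ref4 X) z.2 ^ 2 + Qq (ref4 X) z.2 ^ 2)) =
        m z * (e1f (z, pl X) * Hc (uu (z, pl X) +
          (-2) * (((pl X).1 0 * (pl X).2 1 - (pl X).1 1 * (pl X).2 0) * dd z.2))) := by
      intro z
      congr 2
      · rw [e1f]; congr 3; simp [pl_apply, q4, ref4, dotProduct, Fin.sum_univ_three]; left; ring
      · congr 1; simp [pl_apply, uu, Pp, Qq, ref4, xx, yy, xy, dd, dotProduct, Fin.sum_univ_three]; ring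
    simp only [e1] at h1
    simp only [e2] at h2
    have e3 : ∀ z : Zt, m z * (e1f (z, pl X) * gg (hh (z, pl X), uu (z, pl X))) =
        (1 / 2 : ℂ) * (m z * (e1f (z, pl X) * Hc (uu (z, pl X) +
          2 * (((pl X).1 0 * (pl X).2 1 - (pl X).1 1 * (pl X).2 0) * dd z.2))) +
          m z * (e1f (z, pl X) * Hc (uu (z, pl X) +
          (-2) * (((pl X).1 0 * (pl X).2 1 - (pl X).1 1 * (pl X).2 0) * dd z.2)))) := by
      intro z
      set w' := ((pl X).1 0 * (pl X).2 1 - (pl X).1 1 * (pl X).2 0) * dd z.2 with hw'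
      have hs : hh (z, pl X) ^ 2 = w' ^ 2 := by
        rw [hh_sq, hw']
        simp [pl_apply, cr2, dotProduct, Fin.sum_univ_three]; ring
      have hgg : gg (hh (z, pl X), uu (z, pl X)) = gg (w', uu (z, pl X)) := by
        rcases sq_eq_sq_iff_eq_or_eq_neg.1 hs with h | h <;> rw [h]
        exact gg_even _ _
      rw [hgg, gg, neg_mul, ← sub_eq_add_neg]; ring
    simp only [e3]
    rw [integral_const_mul, integral_add i1 i2, ← h1, ← h2]; ring
  obtain ⟨k, hk, h1, h2⟩ := rot_planar p.1 p.2
  set X : E4 := !₂[(k.mulVec p.1) 0, (k.mulVec p.1) 1, (k.mulVec p.2) 0, (k.mulVec p.2) 1] with hX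
  have hp : pl X = (k.mulVec p.1, k.mulVec p.2) := by
    rw [pl_apply]
    ext i <;> fin_cases i <;> simp [hX, h1, h2]
  have := planar X
  rw [hp, hf k hk] at this
  simp only [e1f_rot hk, hh_rot hk, uu_rot hk] at this
  exact this

end divis

section final
open scoped SchwartzMap

lemma htg_pp : Function.HasTemperateGrowth (fun w : Zt × P6 => (1 - jw w.1.1) * (w.2.2 ⬝ᵥ w.2.2)) :=
  ((Function.HasTemperateGrowth.const 1).sub (htg_jw.comp htg_w)).mul (htg_dot htg_η htg_η)

lemma division (f : 𝓢(P6, ℂ)) (hf : Inv3 f) (h0 : ∀ x, f (x, 0) = 0) :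
    ∃ A B : 𝓢(P6, ℂ), Inv3 A ∧ Inv3 B ∧ ∀ p : P6,
      f p = (p.2 ⬝ᵥ p.2 : ℝ) * A p + (p.1 ⬝ᵥ p.2 : ℝ) * B p := by
  obtain ⟨m, hm, hrep⟩ := rep6 f hf
  obtain ⟨M, hM, hMe, hMs⟩ := even_sub htg_gg gg_even
  obtain ⟨N, hN, hNs⟩ := hadam htg_Hc
  obtain ⟨L, hL, hLs⟩ := hadam htg_PPf
  set Mw : Zt × P6 → ℂ := fun w => M (hh w, uu w) with hMw
  set Nw : Zt × P6 → ℂ := fun w => N (2 * (w.2.1 ⬝ᵥ w.2.2) * xy w.1.2 + (w.2.2 ⬝ᵥ w.2.2) * yy w.1.2,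
    (w.2.1 ⬝ᵥ w.2.1) * xx w.1.2) with hNw
  set Lw : Zt × P6 → ℂ := fun w => L ((1 - jw w.1.1) * (w.2.2 ⬝ᵥ w.2.2), 0) with hLw
  set Hw : Zt × P6 → ℂ := fun w => Hc ((w.2.1 ⬝ᵥ w.2.1) * xx w.1.2) with hHw
  set Pw : Zt × P6 → ℂ := fun w => PPf ((1 - jw w.1.1) * (w.2.2 ⬝ᵥ w.2.2)) with hPw
  have tM : Mw.HasTemperateGrowth := htg_even3 hM hMe htg_vv htg_uu
  have tN : Nw.HasTemperateGrowth := hN.comp (htg_pair htg_tu htg_u0)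
  have tL : Lw.HasTemperateGrowth := hL.comp (htg_pair htg_pp (Function.HasTemperateGrowth.const 0))
  have tH : Hw.HasTemperateGrowth := htg_Hc.comp htg_u0
  have tP : Pw.HasTemperateGrowth := htg_PPf.comp htg_pp
  set UA : Zt × P6 → ℂ := fun w => ((w.2.1 ⬝ᵥ w.2.1) * dd w.1.2 ^ 2 : ℝ) * Mw w + (yy w.1.2 : ℝ) * Nw w +
    (jw w.1.1 - 1 : ℝ) * Lw w * Hw w with hUA
  set UB : Zt × P6 → ℂ := fun w => (-((w.2.1 ⬝ᵥ w.2.2) * dd w.1.2 ^ 2) : ℝ) * Mw w +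
    (2 * xy w.1.2 : ℝ) * Nw w with hUB
  have tA : UA.HasTemperateGrowth :=
    (((htg_ofReal ((htg_dot htg_ξ htg_ξ).mul (htg_dd.pow 2))).mul tM).add ((htg_ofReal htg_yy).mul tN)).add
      (((htg_ofReal ((htg_jw.comp htg_w).sub (Function.HasTemperateGrowth.const 1))).mul tL).mul tH)
  have tB : UB.HasTemperateGrowth :=
    ((htg_ofReal ((htg_dot htg_ξ htg_η).mul (htg_dd.pow 2)).neg).mul tM).add
      ((htg_ofReal ((Function.HasTemperateGrowth.const 2).mul htg_xy)).mul tN)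
  obtain ⟨A, hA⟩ := master hm (htg_e1f.mul tA) (fun k => e1f_decay tA k)
  obtain ⟨B, hB⟩ := master hm (htg_e1f.mul tB) (fun k => e1f_decay tB k)
  refine ⟨A, B, ?_, ?_, fun p => ?_⟩
  · intro k hk x y
    rw [hA, hA]
    congr 1; ext1 z
    simp only [Pi.mul_apply, hUA, hMw, hNw, hLw, hHw, e1f_rot hk, hh_rot hk, uu_rot hk, so3_dot hk]
  · intro k hk x y
    rw [hB, hB]
    congr 1; ext1 z
    simp only [Pi.mul_apply, hUB, hMw, hNw, hLw, hHw, e1f_rot hk, hh_rot hk, uu_rot hk, so3_dot hk]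
  · have i2 := int_e1f hm (tP.mul tH) p
    have i3 := (int_e1f hm tA p).const_mul ((p.2 ⬝ᵥ p.2 : ℝ) : ℂ)
    have i4 := (int_e1f hm tB p).const_mul ((p.1 ⬝ᵥ p.2 : ℝ) : ℂ)
    have z2 : ∫ z, m z * (e1f (z, p) * (Pw * Hw) (z, p)) = 0 := by
      have hz := hrep (p.1, 0)
      rw [h0] at hz
      have : ∀ z, m z * (e1f (z, p) * (Pw * Hw) (z, p)) =
          Complex.exp ((-(p.2 ⬝ᵥ p.2) : ℝ) : ℂ) *
          (m z * (e1f (z, (p.1, 0)) * gg (hh (z, (p.1, 0)), uu (z, (p.1, 0))))) := by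
        intro z
        have hh0 : hh (z, (p.1, 0)) = 0 := by
          have := hh_sq (z, (p.1, 0))
          simp [cr2] at this
          exact this
        have hu : uu (z, (p.1, 0)) = (p.1 ⬝ᵥ p.1) * xx z.2 := by simp [uu]
        have he : e1f (z, p) * Pw (z, p) = Complex.exp ((-(p.2 ⬝ᵥ p.2) : ℝ) : ℂ) * e1f (z, (p.1, 0)) := by
          rw [hPw]
          dsimp only
          rw [PPf, phs_of_nonneg (mul_nonneg (by have := jw_le_one z.1; linarith) (dot_nonneg _)), e1f, e1f,
            ← Complex.exp_add, ← Complex.exp_add, ← Complex.ofReal_add, ← Complex.ofReal_add]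
          congr 2
          simp
          ring
        rw [hh0, hu, gg_zero, Pi.mul_apply]
        rw [show m z * (e1f (z, p) * (Pw (z, p) * Hw (z, p))) = m z * ((e1f (z, p) * Pw (z, p)) * Hw (z, p)) by ring,
          he, hHw]
        ring
      simp only [this]
      rw [integral_const_mul, ← hz, mul_zero]
    have key : ∀ z, m z * (e1f (z, p) * gg (hh (z, p), uu (z, p))) =
        m z * (e1f (z, p) * (Pw * Hw) (z, p)) +
        (((p.2 ⬝ᵥ p.2 : ℝ) : ℂ) * (m z * (e1f (z, p) * UA (z, p))) +
        ((p.1 ⬝ᵥ p.2 : ℝ) : ℂ) * (m z * (e1f (z, p) * UB (z, p)))) := by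
      intro z
      have k1 := hMs (hh (z, p)) (uu (z, p))
      rw [hh_sq, gg_zero, Complex.real_smul] at k1
      have k2 := hNs (2 * (p.1 ⬝ᵥ p.2) * xy z.2 + (p.2 ⬝ᵥ p.2) * yy z.2) ((p.1 ⬝ᵥ p.1) * xx z.2)
      have k3 := hLs ((1 - jw z.1) * (p.2 ⬝ᵥ p.2)) 0
      have k4 : PPf 0 = 1 := by rw [PPf, phs_of_nonneg le_rfl]; simp
      rw [zero_add, k4] at k3
      rw [k1, show uu (z, p) = (p.1 ⬝ᵥ p.1) * xx z.2 +
        (2 * (p.1 ⬝ᵥ p.2) * xy z.2 + (p.2 ⬝ᵥ p.2) * yy z.2) from rfl, k2]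
      simp only [Pi.mul_apply, hUA, hUB, hMw, hNw, hLw, hHw, hPw, k3]
      simp only [uu, cr2]
      push_cast
      ring
    rw [hrep]
    simp only [key]
    have i34 : Integrable (fun z => ((p.2 ⬝ᵥ p.2 : ℝ) : ℂ) * (m z * (e1f (z, p) * UA (z, p))) +
        ((p.1 ⬝ᵥ p.2 : ℝ) : ℂ) * (m z * (e1f (z, p) * UB (z, p)))) := i3.add i4
    rw [integral_add i2 i34, integral_add i3 i4, z2, zero_add, integral_const_mul,
      integral_const_mul, hA, hB]
    rfl

lemma sing_eq (F : 𝓢(P6, ℂ)) (hF : Inv3 F) (f0 : 𝓢(ℝ, ℂ))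
    (h : ∀ R, f0 (R ^ 2) = ∫ p : P6, F p * ee R p.1) (x : V3) :
    FT F (x, 0) = f0 (nrm3 ((2 * Real.pi) • x) ^ 2) := by
  obtain ⟨k, hk, a, ha⟩ := rot_to_e3 x
  have h1 := FT_inv hF k hk x 0
  rw [mulVec_zero, ha] at h1
  have h2 : nrm3 ((2 * Real.pi) • x) ^ 2 = (-(2 * Real.pi * a)) ^ 2 := by
    rw [← nrm3_rot hk, mulVec_smul, ha, smul_e3v, nrm3_e3v]; ring
  rw [← h1, h2, h, FT_ee]
  congr 3
  have := Real.pi_pos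
  field_simp

lemma Inv3.sub {f g : 𝓢(P6, ℂ)} (hf : Inv3 f) (hg : Inv3 g) : Inv3 (f - g) := by
  intro k hk x y
  show f _ - g _ = f _ - g _
  rw [hf k hk, hg k hk]

lemma Inv3.smul {f : 𝓢(P6, ℂ)} (c : ℂ) (hf : Inv3 f) : Inv3 (c • f) := by
  intro k hk x y
  show c * f _ = c * f _
  rw [hf k hk]

lemma htg_dd1 : Function.HasTemperateGrowth (fun q : P6 => q.2 ⬝ᵥ q.2) :=
  htg_dot (ContinuousLinearMap.snd ℝ V3 V3).hasTemperateGrowth (ContinuousLinearMap.snd ℝ V3 V3).hasTemperateGrowth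

lemma htg_dd2 : Function.HasTemperateGrowth (fun q : P6 => q.1 ⬝ᵥ q.2) :=
  htg_dot (ContinuousLinearMap.fst ℝ V3 V3).hasTemperateGrowth (ContinuousLinearMap.snd ℝ V3 V3).hasTemperateGrowth

lemma split_op (F F0 : 𝓢(P6, ℂ)) (hF : Inv3 F) (hF0 : Inv3 F0) (h : ∀ x, FT F (x, 0) = FT F0 (x, 0)) :
    ∃ F1 F2 : 𝓢(P6, ℂ), Inv3 F1 ∧ Inv3 F2 ∧ ∀ p, F p = F0 p + DeltaOp F1 p + DOp F2 p := by
  obtain ⟨A, B, hA, hB, hAB⟩ := division (FT F - FT F0) ((FT_inv hF).sub (FT_inv hF0))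
    (fun x => by rw [_root_.sub_apply, h, sub_self])
  set c : ℂ := (4 * Real.pi ^ 2 : ℂ)⁻¹ with hc
  have hc0 : (4 * Real.pi ^ 2 : ℂ) ≠ 0 := by
    have : (Real.pi : ℂ) ≠ 0 := Complex.ofReal_ne_zero.2 Real.pi_ne_zero
    exact mul_ne_zero (by norm_num) (pow_ne_zero 2 this)
  refine ⟨FTI (c • A), FTI (c • B), FTI_inv (hA.smul c), FTI_inv (hB.smul c), fun p => ?_⟩
  rw [delta_FTI (c • A) (cmul (fun q => q.2 ⬝ᵥ q.2) A) (fun q => by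
      rw [cmul_apply htg_dd1, _root_.smul_apply, smul_eq_mul, hc]; field_simp),
    dop_FTI (c • B) (cmul (fun q => q.1 ⬝ᵥ q.2) B) (fun q => by
      rw [cmul_apply htg_dd2, _root_.smul_apply, smul_eq_mul, hc]; field_simp)]
  have e : FT F = FT F0 + (cmul (fun q => q.2 ⬝ᵥ q.2) A + cmul (fun q => q.1 ⬝ᵥ q.2) B) := by
    ext q
    have := hAB q
    rw [_root_.sub_apply] at this
    rw [_root_.add_apply, _root_.add_apply, cmul_apply htg_dd1, cmul_apply htg_dd2, ← this]; ring
  have e2 := congrArg FTI e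
  rw [FTI_FT, FTI_add, FTI_FT, FTI_add] at e2
  rw [e2, _root_.add_apply, _root_.add_apply]; ring

end final

theorem statement3 (μ : Measure Mat3) (hμ : IsHaarSO3 μ)
    (F : SchwartzMap (V3 × V3) ℂ) (hF : Inv3 ⇑F) :
    ∃ (f0 : SchwartzMap ℝ ℂ) (F0 F1 F2 : SchwartzMap (V3 × V3) ℂ),
      Inv3 ⇑F0 ∧ Inv3 ⇑F1 ∧ Inv3 ⇑F2 ∧
      (∀ p : V3 × V3, F p = F0 p + DeltaOp ⇑F1 p + DOp ⇑F2 p) ∧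
      (∀ R ≥ (0:ℝ), f0 (R ^ 2) = ∫ p : V3 × V3, F p * (sph0 R p.1 : ℂ)) ∧
      (∀ lam > (0:ℝ), ∀ l : ℕ, ∀ r : ℝ,
        ∫ p : V3 × V3, F0 p * (starRingEnd ℂ) (sph μ lam l r p.1 p.2)
          = f0 (lam * (2 * l + 1) + r ^ 2)) ∧
      (∀ R ≥ (0:ℝ), ∫ p : V3 × V3, F0 p * (sph0 R p.1 : ℂ) = f0 (R ^ 2)) := by
  obtain ⟨f0, h0⟩ := f0_exists F hF
  obtain ⟨m, hm, hf0⟩ := f0_rep f0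
  obtain ⟨F0, hI, hF0⟩ := F0_exists hm
  obtain ⟨F1, F2, h1, h2, h3⟩ := split_op F F0 hF hI fun x => by
    rw [sing_eq F hF f0 h0, F0_sing f0 hf0 F0 hF0]
  refine ⟨f0, F0, F1, F2, hI, h1, h2, h3, fun R _ => ?_, fun lam hlam l r => ?_, fun R _ => ?_⟩
  · rw [sph0_int hμ F hF, h0]
  · exact gelfand hμ hm f0 hf0 F0 hI hF0 lam hlam l r
  · rw [sph0_int hμ F0 hI, F0_ee f0 hf0 F0 hF0]
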